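/- Let p ∈ [1,∞] and q⃗ = (q₁,q₂,q₃) with 1 < q_j < ∞ for each j, set α := 2/(2/p + 1/q̄) where 1/q̄ := 1/q₁+1/q₂+1/q₃, and assume α > 1, q_j ≤ 2α/(α−1) for each j, and 7 − 3α − 4α/p ≥ 0. There exists a constant C, depending only on p and q⃗, such that for every R > 0 and every suitable weak solution (u,Π) of the 3D Navier-Stokes equations on Q(R): ‖u‖_{L^∞_t L²_x(Q(R/2))}² + ‖∇u‖_{L²(Q(R/2))}² ≤ C R^{−(4−3α)/α} ‖u‖_{L^p_t L^{q⃗}_x(Q(R))}² + C R^{−(5−3α)/(α−1)} ‖u‖_{L^p_t L^{q⃗}_x(Q(R))}^{2α/(α−1)} + C R^{−5} ‖Π‖_{L¹(Q(R))}². -/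

import Mathlib

open MeasureTheory ENNReal Set Metric Filter

noncomputable section

/-- Euclidean 3-space. -/
abbrev E3 : Type := EuclideanSpace ℝ (Fin 3)

/-- The point (x₁,x₂,x₃) of ℝ³. -/
def pt3 (x1 x2 x3 : ℝ) : E3 := (WithLp.equiv 2 (Fin 3 → ℝ)).symm ![x1, x2, x3]

/-- Anisotropic Lebesgue (quasi-)norm `‖f‖_{L^{q⃗}(Ω)}` with finite exponents:
iterated L^{q₁}, L^{q₂}, L^{q₃} norms in x₁, x₂, x₃ of f extended by 0 outside Ω. -/
def anisoNorm (q1 q2 q3 : ℝ) (Ω : Set E3) (f : E3 → ℝ) : ℝ≥0∞ :=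
  (∫⁻ x3 : ℝ, (∫⁻ x2 : ℝ, (∫⁻ x1 : ℝ,
      (ENNReal.ofReal |Ω.indicator f (pt3 x1 x2 x3)|) ^ q1) ^ (q2 / q1)) ^ (q3 / q2)) ^ (1 / q3)

/-- Mixed norm `‖f‖_{L^p_t L^{q⃗}_x(Q(r))}`, time exponent `p ∈ [1,∞]`,
where `Q(r) = B(r) × (−r²,0)`. -/
def mixedNorm (p : ℝ≥0∞) (q1 q2 q3 r : ℝ) (f : E3 → ℝ → ℝ) : ℝ≥0∞ :=
  if p = ∞ then
    essSup (fun t => anisoNorm q1 q2 q3 (ball (0 : E3) r) (fun x => f x t))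
      (volume.restrict (Ioo (-(r^2)) 0))
  else
    (∫⁻ t in Ioo (-(r^2)) 0,
        (anisoNorm q1 q2 q3 (ball (0 : E3) r) (fun x => f x t)) ^ p.toReal) ^ (1 / p.toReal)

/-- Partial derivative in the i-th coordinate direction. -/
def pd (i : Fin 3) (f : E3 → ℝ) (x : E3) : ℝ := fderiv ℝ f x (EuclideanSpace.single i 1)

/-- Laplacian. -/
def lap (f : E3 → ℝ) (x : E3) : ℝ := ∑ i : Fin 3, pd i (fun y => pd i f y) x

/-- Scalar test functions compactly supported in `Q(R) = B(R) × (−R²,0)`. -/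
def IsTest (R : ℝ) (φ : E3 → ℝ → ℝ) : Prop :=
  ContDiff ℝ (⊤ : ℕ∞) (fun z : E3 × ℝ => φ z.1 z.2) ∧
  HasCompactSupport (fun z : E3 × ℝ => φ z.1 z.2) ∧
  tsupport (fun z : E3 × ℝ => φ z.1 z.2) ⊆ (ball (0 : E3) R) ×ˢ (Ioo (-(R^2)) 0)

/-- Vector test functions compactly supported in `Q(R) = B(R) × (−R²,0)`. -/
def IsTestV (R : ℝ) (w : E3 → ℝ → E3) : Prop :=
  ContDiff ℝ (⊤ : ℕ∞) (fun z : E3 × ℝ => w z.1 z.2) ∧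
  HasCompactSupport (fun z : E3 × ℝ => w z.1 z.2) ∧
  tsupport (fun z : E3 × ℝ => w z.1 z.2) ⊆ (ball (0 : E3) R) ×ˢ (Ioo (-(R^2)) 0)

/-- A suitable weak solution `(u, P)` of the 3D Navier–Stokes equations on
`Q(R) = B(R) × (−R²,0)`: `u ∈ L^∞_t L²_x` with a distributional spatial gradient
`gu ∈ L²(Q(R))`, pressure `P ∈ L^{3/2}(Q(R))`, the equations hold in the sense of
distributions, and the local energy inequality holds. -/
structure SuitableWeakSolution (R : ℝ) (u : E3 → ℝ → E3) (P : E3 → ℝ → ℝ) where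
  /-- the distributional spatial gradient: `gu x t i j = ∂ⱼuᵢ(x,t)` -/
  gu : E3 → ℝ → Fin 3 → Fin 3 → ℝ
  meas_u : Measurable (Function.uncurry u)
  meas_gu : Measurable (Function.uncurry gu)
  meas_press : Measurable (Function.uncurry P)
  /-- `u ∈ L^∞(−R²,0; L²(B(R)))` -/
  bdd_L2 : essSup (fun t => ∫⁻ x in ball (0 : E3) R, ((‖u x t‖₊ : ℝ≥0∞)) ^ 2)
      (volume.restrict (Ioo (-(R^2)) 0)) < ∞
  /-- `∇u ∈ L²(Q(R))` -/
  grad_L2 : (∫⁻ t in Ioo (-(R^2)) 0, ∫⁻ x in ball (0 : E3) R,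
      ENNReal.ofReal (∑ i : Fin 3, ∑ j : Fin 3, (gu x t i j) ^ 2)) < ∞
  /-- `P ∈ L^{3/2}(Q(R))` -/
  press_L32 : (∫⁻ t in Ioo (-(R^2)) 0, ∫⁻ x in ball (0 : E3) R,
      (ENNReal.ofReal |P x t|) ^ (3/2 : ℝ)) < ∞
  /-- `gu` is the distributional spatial gradient of `u` on `Q(R)` -/
  is_grad : ∀ φ : E3 → ℝ → ℝ, IsTest R φ → ∀ i j : Fin 3,
      (∫ t in Ioo (-(R^2)) 0, ∫ x in ball (0 : E3) R, u x t i * pd j (fun y => φ y t) x)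
        = - ∫ t in Ioo (-(R^2)) 0, ∫ x in ball (0 : E3) R, gu x t i j * φ x t
  /-- `∂ₜu − Δu + (u·∇)u + ∇P = 0` in the sense of distributions on `Q(R)` -/
  weak_NS : ∀ w : E3 → ℝ → E3, IsTestV R w →
      (∫ t in Ioo (-(R^2)) 0, ∫ x in ball (0 : E3) R,
        (-(∑ i : Fin 3, u x t i * deriv (fun s => w x s i) t)
          - (∑ i : Fin 3, u x t i * lap (fun y => w y t i) x)
          - (∑ i : Fin 3, ∑ j : Fin 3, u x t i * u x t j * pd i (fun y => w y t j) x)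
          - P x t * (∑ j : Fin 3, pd j (fun y => w y t j) x))) = 0
  /-- `div u = 0` in the sense of distributions on `Q(R)` -/
  weak_div : ∀ ψ : E3 → ℝ → ℝ, IsTest R ψ →
      (∫ t in Ioo (-(R^2)) 0, ∫ x in ball (0 : E3) R,
        ∑ i : Fin 3, u x t i * pd i (fun y => ψ y t) x) = 0
  /-- the local energy inequality -/
  local_energy : ∀ φ : E3 → ℝ → ℝ, IsTest R φ → (∀ x t, 0 ≤ φ x t) →
      ∀ᵐ t ∂(volume.restrict (Ioo (-(R^2)) 0)),
        (∫ x in ball (0 : E3) R, ‖u x t‖ ^ 2 * φ x t)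
          + 2 * ∫ s in Ioo (-(R^2)) t, ∫ x in ball (0 : E3) R,
              (∑ i : Fin 3, ∑ j : Fin 3, (gu x s i j) ^ 2) * φ x s
        ≤ (∫ s in Ioo (-(R^2)) t, ∫ x in ball (0 : E3) R,
              ‖u x s‖ ^ 2 * (deriv (fun τ => φ x τ) s + lap (fun y => φ y s) x))
          + ∫ s in Ioo (-(R^2)) t, ∫ x in ball (0 : E3) R,
              (∑ i : Fin 3, u x s i * pd i (fun y => φ y s) x) * (‖u x s‖ ^ 2 + 2 * P x s)

/-- `(0,0)` is a regular point of `u`: `u` is essentially bounded on some `Q(r)`, `r > 0`. -/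
def RegularPoint (u : E3 → ℝ → E3) : Prop :=
  ∃ r > (0 : ℝ), ∃ M : ℝ,
    ∀ᵐ z : E3 × ℝ ∂(volume.restrict ((ball (0 : E3) r) ×ˢ (Ioo (-(r^2)) 0))),
      ‖u z.1 z.2‖ ≤ M

/-- Squared `L^∞_t L²_x(Q(r))` norm. -/
def linfL2sq (r : ℝ) (u : E3 → ℝ → E3) : ℝ≥0∞ :=
  essSup (fun t => ∫⁻ x in ball (0 : E3) r, ((‖u x t‖₊ : ℝ≥0∞)) ^ 2)
    (volume.restrict (Ioo (-(r^2)) 0))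

/-- Squared `L²(Q(r))` norm of the gradient. -/
def gradL2sq (r : ℝ) (gu : E3 → ℝ → Fin 3 → Fin 3 → ℝ) : ℝ≥0∞ :=
  ∫⁻ t in Ioo (-(r^2)) 0, ∫⁻ x in ball (0 : E3) r,
    ENNReal.ofReal (∑ i : Fin 3, ∑ j : Fin 3, (gu x t i j) ^ 2)


section

lemma pt3_meas : Measurable (fun z : ℝ × ℝ × ℝ => pt3 z.1 z.2.1 z.2.2) := by
  unfold pt3
  have : Measurable (fun z : ℝ × ℝ × ℝ => (![z.1, z.2.1, z.2.2] : Fin 3 → ℝ)) := by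
    refine measurable_pi_iff.2 ?_
    intro i
    fin_cases i
    · exact measurable_fst
    · exact measurable_snd.fst
    · exact measurable_snd.snd
  exact (MeasurableEquiv.toLp 2 (Fin 3 → ℝ)).measurable.comp this

@[fun_prop] lemma pt3_meas' {X : Type*} [MeasurableSpace X] {f g h : X → ℝ} (hf : Measurable f)
    (hg : Measurable g) (hh : Measurable h) : Measurable (fun x => pt3 (f x) (g x) (h x)) :=
  pt3_meas.comp (hf.prodMk (hg.prodMk hh))

lemma pt3_0 (x y z : ℝ) : pt3 x y z 0 = x := rfl
lemma pt3_1 (x y z : ℝ) : pt3 x y z 1 = y := rfl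
lemma pt3_2 (x y z : ℝ) : pt3 x y z 2 = z := rfl

lemma lintegral_E3 {f : E3 → ℝ≥0∞} (hf : Measurable f) :
    ∫⁻ x, f x = ∫⁻ x3 : ℝ, ∫⁻ x2 : ℝ, ∫⁻ x1 : ℝ, f (pt3 x1 x2 x3) := by
  have e1 : ∫⁻ x, f x = ∫⁻ v : Fin 3 → ℝ, f ((WithLp.equiv 2 (Fin 3 → ℝ)).symm v) :=
    ((PiLp.volume_preserving_toLp (Fin 3)).lintegral_comp hf).symm
  rw [e1]
  have hf1 : Measurable (fun v : Fin 3 → ℝ => f ((WithLp.equiv 2 (Fin 3 → ℝ)).symm v)) :=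
    hf.comp (MeasurableEquiv.toLp 2 (Fin 3 → ℝ)).measurable
  have h2 := (volume_preserving_piFinSuccAbove (fun _ : Fin 3 => ℝ) 2).symm
  rw [← h2.lintegral_comp hf1]
  have hf2 := hf1.comp h2.measurable
  have e2 := lintegral_prod (μ := volume) (ν := volume) _ hf2.aemeasurable
  simp only [Function.comp_def] at e2
  rw [Measure.volume_eq_prod, e2]
  refine lintegral_congr fun x3 => ?_
  have hf3 : Measurable (fun v : Fin 2 → ℝ => f (pt3 (v 0) (v 1) x3)) := by fun_prop
  have h3 := (volume_preserving_finTwoArrow ℝ).symm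
  have hf4 := hf3.comp h3.measurable
  have e3 := h3.lintegral_comp hf3
  have : ∀ v : Fin 2 → ℝ, (f ((WithLp.equiv 2 (Fin 3 → ℝ)).symm ((MeasurableEquiv.piFinSuccAbove (fun _ : Fin 3 => ℝ) 2).symm (x3, v)))) = f (pt3 (v 0) (v 1) x3) := by
    intro v
    congr 1
    unfold pt3
    congr 1
    ext i
    fin_cases i <;> rfl
  simp_rw [this]
  have e4 := lintegral_prod_symm (μ := volume) (ν := volume) _ hf4.aemeasurable
  simp only [Function.comp_def] at e4
  rw [← e3, Measure.volume_eq_prod, e4]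
  rfl

end

section

/-- one-dimensional measure on `[-1,1]` -/
def cub : Measure ℝ := volume.restrict (Icc (-1) 1)
instance : IsFiniteMeasure cub := by unfold cub; infer_instance

/-- `L^{1/a}` norm in one variable -/
def nrm (a : ℝ) (F : ℝ → ℝ≥0∞) : ℝ≥0∞ := (∫⁻ x, F x ^ (1/a) ∂cub) ^ a

/-- iterated norms with inverse exponents -/
def mixC (g1 g2 g3 : ℝ) (G : E3 → ℝ≥0∞) : ℝ≥0∞ :=
  nrm g3 fun x3 => nrm g2 fun x2 => nrm g1 fun x1 => G (pt3 x1 x2 x3)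

lemma nrm_mono {a : ℝ} (ha : 0 < a) {F G : ℝ → ℝ≥0∞} (h : ∀ x, F x ≤ G x) :
    nrm a F ≤ nrm a G := by
  unfold nrm
  refine ENNReal.rpow_le_rpow (lintegral_mono fun x => ENNReal.rpow_le_rpow (h x) (by positivity)) ha.le

lemma mixC_mono {a b c : ℝ} (ha : 0 < a) (hb : 0 < b) (hc : 0 < c) {F G : E3 → ℝ≥0∞}
    (h : ∀ x, F x ≤ G x) : mixC a b c F ≤ mixC a b c G :=
  nrm_mono hc fun _ => nrm_mono hb fun _ => nrm_mono ha fun _ => h _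

lemma nrm_const_mul {a : ℝ} (ha : 0 < a) {F : ℝ → ℝ≥0∞} (c : ℝ≥0∞) (hF : Measurable F) :
    nrm a (fun x => c * F x) = c * nrm a F := by
  unfold nrm
  have : ∀ x, (c * F x) ^ (1/a) = c ^ (1/a) * F x ^ (1/a) := fun x =>
    ENNReal.mul_rpow_of_nonneg _ _ (by positivity)
  simp_rw [this]
  rw [lintegral_const_mul _ (by fun_prop), ENNReal.mul_rpow_of_nonneg _ _ ha.le, ← ENNReal.rpow_mul]
  rw [one_div, inv_mul_cancel₀ ha.ne', ENNReal.rpow_one]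

@[fun_prop] lemma nrm_meas {X : Type*} [MeasurableSpace X] {a : ℝ} {F : X → ℝ → ℝ≥0∞}
    (hF : Measurable (fun z : X × ℝ => F z.1 z.2)) :
    Measurable (fun x => nrm a (F x)) := by
  unfold nrm
  have : Measurable (fun x => ∫⁻ y, F x y ^ (1/a) ∂cub) :=
    Measurable.lintegral_prod_right' (f := fun z : X × ℝ => F z.1 z.2 ^ (1/a)) (by fun_prop)
  fun_prop

lemma cub_univ : cub univ = 2 := by
  simp [cub]; norm_num

lemma nrm_holder {g a b c k l m : ℝ} (hg : 0 < g) (ha : 0 < a) (hb : 0 < b) (hc : 0 < c)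
    (hk : 0 ≤ k) (hl : 0 ≤ l) (hm : 0 ≤ m) (hs : k*a + l*b + m*c ≤ g) (hg1 : g ≤ 1)
    {F1 F2 F3 : ℝ → ℝ≥0∞} (h1 : Measurable F1) (h2 : Measurable F2) (h3 : Measurable F3) :
    nrm g (fun x => F1 x ^ k * F2 x ^ l * F3 x ^ m) ≤
      2 * ((nrm a F1) ^ k * (nrm b F2) ^ l * (nrm c F3) ^ m) := by
  have key := ENNReal.lintegral_prod_norm_pow_le (μ := cub) (Finset.univ : Finset (Fin 4))
    (f := ![fun x => F1 x ^ (1/a), fun x => F2 x ^ (1/b), fun x => F3 x ^ (1/c), fun _ => 1])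
    (p := ![k*a/g, l*b/g, m*c/g, (g - (k*a + l*b + m*c))/g])
    (by intro i _; fin_cases i <;> simp <;> fun_prop)
    (by simp [Fin.sum_univ_four]; field_simp; ring)
    (by intro i _; fin_cases i <;> simp <;> positivity)
  simp only [Fin.prod_univ_four] at key
  simp only [Matrix.cons_val_zero, Matrix.cons_val_one, Matrix.cons_val, ENNReal.one_rpow, mul_one,
    lintegral_const, cub_univ, one_mul] at key
  unfold nrm
  have e : ∀ x, (F1 x ^ k * F2 x ^ l * F3 x ^ m) ^ (1/g) =
      (F1 x ^ (1/a)) ^ (k*a/g) * (F2 x ^ (1/b)) ^ (l*b/g) * (F3 x ^ (1/c)) ^ (m*c/g) := by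
    intro x
    rw [ENNReal.mul_rpow_of_nonneg _ _ (by positivity), ENNReal.mul_rpow_of_nonneg _ _ (by positivity)]
    simp only [← ENNReal.rpow_mul]
    rw [show k * (1/g) = 1/a*(k*a/g) by field_simp, show l * (1/g) = 1/b*(l*b/g) by field_simp,
      show m * (1/g) = 1/c*(m*c/g) by field_simp]
  simp_rw [e]
  refine (ENNReal.rpow_le_rpow key hg.le).trans ?_
  simp only [ENNReal.mul_rpow_of_nonneg _ _ hg.le, ← ENNReal.rpow_mul]
  rw [mul_comm (2:ℝ≥0∞)]
  have e1 : k * a / g * g = a * k := by field_simp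
  have e2 : l * b / g * g = b * l := by field_simp
  have e3 : m * c / g * g = c * m := by field_simp
  have e4 : (g - (k * a + l * b + m * c)) / g * g = g - (k * a + l * b + m * c) := by field_simp
  rw [e1, e2, e3, e4]
  gcongr
  calc (2:ℝ≥0∞) ^ (g - (k * a + l * b + m * c)) ≤ 2 ^ (1:ℝ) :=
        ENNReal.rpow_le_rpow_of_exponent_le (by norm_num) (by nlinarith [mul_nonneg hk ha.le, mul_nonneg hl hb.le, mul_nonneg hm hc.le])
    _ = 2 := by simp

lemma mixC_holder {g1 g2 g3 a1 a2 a3 k l m : ℝ} (hg1 : 0 < g1) (hg2 : 0 < g2) (hg3 : 0 < g3)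
    (ha1 : 0 < a1) (ha2 : 0 < a2) (ha3 : 0 < a3)
    (hk : 0 ≤ k) (hl : 0 ≤ l) (hm : 0 ≤ m) (hs1 : k*a1 + l*(1/2) + m*(1/2) ≤ g1) (hs2 : k*a2 + l*(1/2) + m*(1/2) ≤ g2)
    (hs3 : k*a3 + l*(1/2) + m*(1/2) ≤ g3) (hg11 : g1 ≤ 1) (hg21 : g2 ≤ 1) (hg31 : g3 ≤ 1)
    {f1 f2 f3 : E3 → ℝ≥0∞} (h1 : Measurable f1) (h2 : Measurable f2) (h3 : Measurable f3) :
    mixC g1 g2 g3 (fun x => f1 x ^ k * f2 x ^ l * f3 x ^ m) ≤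
      8 * ((mixC a1 a2 a3 f1) ^ k * (mixC (1/2) (1/2) (1/2) f2) ^ l * (mixC (1/2) (1/2) (1/2) f3) ^ m) := by
  unfold mixC
  calc _ ≤ nrm g3 fun x3 => nrm g2 fun x2 => 2 * ((nrm a1 fun x1 => f1 (pt3 x1 x2 x3)) ^ k * (nrm (1/2) fun x1 => f2 (pt3 x1 x2 x3)) ^ l * (nrm (1/2) fun x1 => f3 (pt3 x1 x2 x3)) ^ m) := by
        refine nrm_mono hg3 fun x3 => nrm_mono hg2 fun x2 => ?_
        exact nrm_holder hg1 ha1 (by norm_num) (by norm_num) hk hl hm hs1 hg11 (by fun_prop) (by fun_prop) (by fun_prop)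
    _ = nrm g3 fun x3 => 2 * nrm g2 fun x2 => ((nrm a1 fun x1 => f1 (pt3 x1 x2 x3)) ^ k * (nrm (1/2) fun x1 => f2 (pt3 x1 x2 x3)) ^ l * (nrm (1/2) fun x1 => f3 (pt3 x1 x2 x3)) ^ m) := by
        congr 1; ext x3
        exact nrm_const_mul hg2 _ (by fun_prop)
    _ = 2 * nrm g3 fun x3 => nrm g2 fun x2 => ((nrm a1 fun x1 => f1 (pt3 x1 x2 x3)) ^ k * (nrm (1/2) fun x1 => f2 (pt3 x1 x2 x3)) ^ l * (nrm (1/2) fun x1 => f3 (pt3 x1 x2 x3)) ^ m) := by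
        exact nrm_const_mul hg3 _ (by fun_prop)
    _ ≤ 2 * nrm g3 fun x3 => 2 * ((nrm a2 fun x2 => nrm a1 fun x1 => f1 (pt3 x1 x2 x3)) ^ k * (nrm (1/2) fun x2 => nrm (1/2) fun x1 => f2 (pt3 x1 x2 x3)) ^ l * (nrm (1/2) fun x2 => nrm (1/2) fun x1 => f3 (pt3 x1 x2 x3)) ^ m) := by
        gcongr
        refine nrm_mono hg3 fun x3 => ?_
        exact nrm_holder hg2 ha2 (by norm_num) (by norm_num) hk hl hm hs2 hg21 (by fun_prop) (by fun_prop) (by fun_prop)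
    _ = 2 * (2 * nrm g3 fun x3 => ((nrm a2 fun x2 => nrm a1 fun x1 => f1 (pt3 x1 x2 x3)) ^ k * (nrm (1/2) fun x2 => nrm (1/2) fun x1 => f2 (pt3 x1 x2 x3)) ^ l * (nrm (1/2) fun x2 => nrm (1/2) fun x1 => f3 (pt3 x1 x2 x3)) ^ m)) := by
        congr 1
        exact nrm_const_mul hg3 _ (by fun_prop)
    _ ≤ 2 * (2 * (2 * _)) := by
        gcongr
        exact nrm_holder hg3 ha3 (by norm_num : (0:ℝ) < 1/2) (by norm_num : (0:ℝ) < 1/2) hk hl hm hs3 hg31 (by fun_prop) (by fun_prop) (by fun_prop)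
    _ = _ := by rw [← mul_assoc, ← mul_assoc]; norm_num

lemma mixC_half_le {f : E3 → ℝ≥0∞} (hf : Measurable f) :
    mixC (1/2) (1/2) (1/2) f ≤ (∫⁻ x, f x ^ (2:ℝ)) ^ (1/2:ℝ) := by
  rw [lintegral_E3 (by fun_prop)]
  unfold mixC nrm
  simp only [← ENNReal.rpow_mul]
  norm_num
  refine ENNReal.rpow_le_rpow ?_ (by norm_num)
  refine (lintegral_mono fun x3 => lintegral_mono fun x2 => setLIntegral_le_lintegral _ _).trans ?_
  refine (lintegral_mono fun x3 => setLIntegral_le_lintegral _ _).trans ?_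
  exact setLIntegral_le_lintegral _ _

lemma mixC_le_aniso {q1 q2 q3 : ℝ} (h1 : 0 < q1) (h2 : 0 < q2) (h3 : 0 < q3) (Ω : Set E3) (f : E3 → ℝ) :
    mixC (1/q1) (1/q2) (1/q3) (fun x => ENNReal.ofReal |Ω.indicator f x|) ≤ anisoNorm q1 q2 q3 Ω f := by
  unfold mixC nrm anisoNorm
  simp only [← ENNReal.rpow_mul, one_div_one_div]
  refine ENNReal.rpow_le_rpow ?_ (by positivity)
  refine (setLIntegral_le_lintegral _ _).trans (lintegral_mono fun x3 => ?_)
  rw [show 1/q2*q3 = q3/q2 by ring]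
  refine ENNReal.rpow_le_rpow ?_ (by positivity)
  refine (setLIntegral_le_lintegral _ _).trans (lintegral_mono fun x2 => ?_)
  rw [show 1/q1*q2 = q2/q1 by ring]
  refine ENNReal.rpow_le_rpow ?_ (by positivity)
  exact (setLIntegral_le_lintegral _ _)

/-- kernel of the strip -/
def ker1 (s x y : ℝ) : ℝ≥0∞ := if |x - y| < s then 1 else 0

@[fun_prop] lemma ker1_meas {X : Type*} [MeasurableSpace X] {s : ℝ} {f g : X → ℝ} (hf : Measurable f)
    (hg : Measurable g) : Measurable (fun x => ker1 s (f x) (g x)) := by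
  unfold ker1
  refine Measurable.ite ?_ measurable_const measurable_const
  have : Measurable (fun x => |f x - g x|) := (hf.sub hg).abs
  exact measurableSet_lt this measurable_const

lemma ker1_int_left (s : ℝ) (x : ℝ) : ∫⁻ y, ker1 s x y ∂cub ≤ ENNReal.ofReal (2*s) := by
  refine (setLIntegral_le_lintegral _ _).trans ?_
  have : (fun y => ker1 s x y) = (ball x s).indicator (fun _ => 1) := by
    ext y
    simp [ker1, indicator, Real.dist_eq, abs_sub_comm]
  rw [this, lintegral_indicator measurableSet_ball]
  simp

lemma ker1_int_right (s : ℝ) (y : ℝ) : ∫⁻ x, ker1 s x y ≤ ENNReal.ofReal (2*s) := by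
  have : (fun x => ker1 s x y) = (ball y s).indicator (fun _ => 1) := by
    ext x
    simp [ker1, indicator, Real.dist_eq]
  rw [this, lintegral_indicator measurableSet_ball]
  simp

lemma young1 {s t g : ℝ} (ht : 0 ≤ t) (hg : g = 1/3 + t) (hg1 : g < 1)
    {φ A : ℝ → ℝ≥0∞} (hφ : Measurable φ) (hA : Measurable A) :
    ∫⁻ x, ∫⁻ y, φ x * (ker1 s x y * A y) ∂cub ≤
      ENNReal.ofReal (2*s) ^ (1-t) * ((∫⁻ x, φ x ^ (3/2:ℝ)) ^ (2/3:ℝ) * nrm g A) := by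
  have hg0 : 0 < g := by linarith
  have key := ENNReal.lintegral_prod_norm_pow_le (μ := (volume : Measure ℝ).prod cub) (Finset.univ : Finset (Fin 3))
    (f := ![fun z => φ z.1 ^ (3/2:ℝ) * A z.2 ^ (1/g), fun z => φ z.1 ^ (3/2:ℝ) * ker1 s z.1 z.2, fun z => A z.2 ^ (1/g) * ker1 s z.1 z.2])
    (p := ![t, 1 - g, 1/3])
    (by intro i _; fin_cases i <;> simp <;> fun_prop)
    (by simp [Fin.sum_univ_three]; linarith)
    (by intro i _; fin_cases i <;> simp <;> linarith)
  simp only [Fin.prod_univ_three] at key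
  simp only [Matrix.cons_val_zero, Matrix.cons_val_one, Matrix.cons_val] at key
  have e : ∀ z : ℝ × ℝ, (φ z.1 ^ (3/2:ℝ) * A z.2 ^ (1/g)) ^ t * (φ z.1 ^ (3/2:ℝ) * ker1 s z.1 z.2) ^ (1-g) * (A z.2 ^ (1/g) * ker1 s z.1 z.2) ^ (1/3:ℝ) = φ z.1 * (ker1 s z.1 z.2 * A z.2) := by
    intro z
    have h1g : 0 ≤ 1 - g := by linarith
    have a1 : φ z.1 = (φ z.1 ^ (3/2:ℝ)) ^ t * (φ z.1 ^ (3/2:ℝ)) ^ (1-g) := by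
      rw [← ENNReal.rpow_add_of_nonneg _ _ ht h1g, ← ENNReal.rpow_mul]
      rw [show 3/2 * (t + (1-g)) = 1 by rw [hg]; ring, ENNReal.rpow_one]
    have a2 : A z.2 = (A z.2 ^ (1/g)) ^ t * (A z.2 ^ (1/g)) ^ (1/3:ℝ) := by
      rw [← ENNReal.rpow_add_of_nonneg _ _ ht (by norm_num), ← ENNReal.rpow_mul]
      rw [show 1/g * (t + 1/3) = 1 by rw [show t + 1/3 = g by linarith]; field_simp, ENNReal.rpow_one]
    have a3 : ker1 s z.1 z.2 = ker1 s z.1 z.2 ^ (1-g) * ker1 s z.1 z.2 ^ (1/3:ℝ) := by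
      unfold ker1
      split_ifs
      · simp
      · simp
    rw [ENNReal.mul_rpow_of_nonneg _ _ ht, ENNReal.mul_rpow_of_nonneg _ _ h1g, ENNReal.mul_rpow_of_nonneg _ _ (by norm_num : (0:ℝ) ≤ 1/3)]
    conv_rhs => rw [a1, a2, a3]
    ring
  simp_rw [e] at key
  rw [lintegral_prod _ (by fun_prop)] at key
  refine key.trans ?_
  have i1 : ∫⁻ z, φ z.1 ^ (3/2:ℝ) * A z.2 ^ (1/g) ∂((volume : Measure ℝ).prod cub) = (∫⁻ x, φ x ^ (3/2:ℝ)) * ∫⁻ y, A y ^ (1/g) ∂cub :=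
    lintegral_prod_mul (f := fun x => φ x ^ (3/2:ℝ)) (g := fun y => A y ^ (1/g)) (by fun_prop) (by fun_prop)
  have i2 : ∫⁻ z, φ z.1 ^ (3/2:ℝ) * ker1 s z.1 z.2 ∂((volume : Measure ℝ).prod cub) ≤ ENNReal.ofReal (2*s) * (∫⁻ x, φ x ^ (3/2:ℝ)) := by
    rw [lintegral_prod _ (by fun_prop), ← lintegral_const_mul _ (by fun_prop)]
    refine lintegral_mono fun x => ?_
    simp only
    rw [lintegral_const_mul _ (by fun_prop), mul_comm]
    gcongr
    exact ker1_int_left s x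
  have i3 : ∫⁻ z, A z.2 ^ (1/g) * ker1 s z.1 z.2 ∂((volume : Measure ℝ).prod cub) ≤ ENNReal.ofReal (2*s) * (∫⁻ x, A x ^ (1/g) ∂cub) := by
    rw [lintegral_prod_symm _ (by fun_prop), ← lintegral_const_mul _ (by fun_prop)]
    refine lintegral_mono fun x => ?_
    simp only
    rw [lintegral_const_mul _ (by fun_prop), mul_comm]
    gcongr
    exact ker1_int_right s x
  have h1g : 0 ≤ 1 - g := by linarith
  rw [i1]
  refine (mul_le_mul' (mul_le_mul' le_rfl (ENNReal.rpow_le_rpow i2 h1g)) (ENNReal.rpow_le_rpow i3 (by norm_num))).trans ?_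
  unfold nrm
  generalize (∫⁻ x, φ x ^ (3/2:ℝ)) = X
  generalize (∫⁻ x, A x ^ (1/g) ∂cub) = Y
  rw [ENNReal.mul_rpow_of_nonneg _ _ ht, ENNReal.mul_rpow_of_nonneg _ _ h1g, ENNReal.mul_rpow_of_nonneg _ _ (by norm_num : (0:ℝ) ≤ 1/3)]
  have b1 : X ^ (2/3:ℝ) = X ^ t * X ^ (1-g) := by
    rw [← ENNReal.rpow_add_of_nonneg _ _ ht h1g]; congr 1; rw [hg]; ring
  have b2 : Y ^ g = Y ^ t * Y ^ (1/3:ℝ) := by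
    rw [← ENNReal.rpow_add_of_nonneg _ _ ht (by norm_num)]; congr 1; rw [hg]; ring
  have b3 : ENNReal.ofReal (2*s) ^ (1-t) = ENNReal.ofReal (2*s) ^ (1-g) * ENNReal.ofReal (2*s) ^ (1/3:ℝ) := by
    rw [← ENNReal.rpow_add_of_nonneg _ _ h1g (by norm_num)]; congr 1; rw [hg]; ring
  rw [b1, b2, b3]
  apply le_of_eq
  ring


@[fun_prop] lemma lint_meas {X Y : Type*} [MeasurableSpace X] [MeasurableSpace Y] {ν : Measure Y} [SFinite ν]
    {F : X → Y → ℝ≥0∞} (hF : Measurable (fun z : X × Y => F z.1 z.2)) :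
    Measurable (fun x => ∫⁻ y, F x y ∂ν) :=
  Measurable.lintegral_prod_right' (f := fun z : X × Y => F z.1 z.2) hF

/-- ball kernel -/
def kerB (s : ℝ) (x y : E3) : ℝ≥0∞ := if dist x y < s then 1 else 0

lemma kerB_meas (s : ℝ) : Measurable (fun z : E3 × E3 => kerB s z.1 z.2) := by
  unfold kerB
  refine Measurable.ite ?_ measurable_const measurable_const
  exact measurableSet_lt (by fun_prop) measurable_const

@[fun_prop] lemma kerB_meas' {X : Type*} [MeasurableSpace X] {s : ℝ} {f g : X → E3} (hf : Measurable f)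
    (hg : Measurable g) : Measurable (fun x => kerB s (f x) (g x)) :=
  Measurable.comp (g := fun z : E3 × E3 => kerB s z.1 z.2) (f := fun x => (f x, g x)) (kerB_meas s) (hf.prodMk hg)

lemma abs_coord_le_dist (x y : E3) (i : Fin 3) : |x i - y i| ≤ dist x y := by
  rw [dist_eq_norm]
  exact PiLp.norm_apply_le (x - y) i

lemma kerB_le (s : ℝ) (x1 x2 x3 y1 y2 y3 : ℝ) : kerB s (pt3 x1 x2 x3) (pt3 y1 y2 y3) ≤
    ker1 s x3 y3 * (ker1 s x2 y2 * ker1 s x1 y1) := by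
  unfold kerB
  split_ifs with h
  · have h1 := (abs_coord_le_dist (pt3 x1 x2 x3) (pt3 y1 y2 y3) 0).trans_lt h
    have h2 := (abs_coord_le_dist (pt3 x1 x2 x3) (pt3 y1 y2 y3) 1).trans_lt h
    have h3 := (abs_coord_le_dist (pt3 x1 x2 x3) (pt3 y1 y2 y3) 2).trans_lt h
    rw [pt3_0, pt3_0] at h1
    rw [pt3_1, pt3_1] at h2
    rw [pt3_2, pt3_2] at h3
    simp [ker1, h1, h2, h3]
  · exact zero_le

lemma lint_cub {F : ℝ → ℝ≥0∞} (hF : ∀ x, 1 < |x| → F x = 0) : ∫⁻ x, F x = ∫⁻ x, F x ∂cub := by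
  unfold cub
  rw [← lintegral_indicator measurableSet_Icc]
  refine lintegral_congr fun x => ?_
  by_cases h : x ∈ Icc (-1:ℝ) 1
  · simp [h]
  · rw [indicator_of_notMem h, hF]
    by_contra h'
    exact h (abs_le.1 (not_lt.1 h'))

lemma lintegral_E3_cub {f : E3 → ℝ≥0∞} (hf : Measurable f) (h0 : ∀ x, 1 < ‖x‖ → f x = 0) :
    ∫⁻ x, f x = ∫⁻ x3, ∫⁻ x2, ∫⁻ x1, f (pt3 x1 x2 x3) ∂cub ∂cub ∂cub := by
  have hn : ∀ (x : E3) i, 1 < |x i| → f x = 0 := fun x i h =>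
    h0 x (h.trans_le (PiLp.norm_apply_le x i))
  rw [lintegral_E3 hf]
  rw [lint_cub]
  · refine lintegral_congr fun x3 => ?_
    rw [lint_cub]
    · refine lintegral_congr fun x2 => ?_
      rw [lint_cub]
      intro x1 h
      exact hn _ 0 h
    · intro x2 h
      simp only [hn (pt3 _ x2 x3) 1 h, lintegral_zero]
  · intro x3 h
    simp only [hn (pt3 _ _ x3) 2 h, lintegral_zero]

lemma young3 {s t1 t2 t3 g1 g2 g3 : ℝ} (ht1 : 0 ≤ t1) (hg1 : g1 = 1/3 + t1) (hg11 : g1 < 1)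
    (ht2 : 0 ≤ t2) (hg2 : g2 = 1/3 + t2) (hg21 : g2 < 1) (ht3 : 0 ≤ t3) (hg3 : g3 = 1/3 + t3) (hg31 : g3 < 1)
    {φ A : E3 → ℝ≥0∞} (hφ : Measurable φ) (hA : Measurable A) (hA0 : ∀ x, 1 < ‖x‖ → A x = 0) :
    ∫⁻ x, ∫⁻ y, φ x * (kerB s x y * A y) ≤
      ENNReal.ofReal (2*s) ^ (1-t1) * (ENNReal.ofReal (2*s) ^ (1-t2) * (ENNReal.ofReal (2*s) ^ (1-t3)
        * ((∫⁻ x, φ x ^ (3/2:ℝ)) ^ (2/3:ℝ) * mixC g1 g2 g3 A))) := by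
  calc _ = ∫⁻ x3, ∫⁻ x2, ∫⁻ x1, ∫⁻ y3, ∫⁻ y2, ∫⁻ y1, φ (pt3 x1 x2 x3) * (kerB s (pt3 x1 x2 x3) (pt3 y1 y2 y3) * A (pt3 y1 y2 y3)) ∂cub ∂cub ∂cub := by
        rw [lintegral_E3 (by fun_prop)]
        refine lintegral_congr fun x3 => lintegral_congr fun x2 => lintegral_congr fun x1 => ?_
        rw [lintegral_E3_cub (by fun_prop)]
        intro y hy
        simp [hA0 y hy]
    _ ≤ ∫⁻ x3, ∫⁻ x2, ∫⁻ x1, ∫⁻ y3, ∫⁻ y2, ∫⁻ y1, ker1 s x3 y3 * (ker1 s x2 y2 * (φ (pt3 x1 x2 x3) * (ker1 s x1 y1 * A (pt3 y1 y2 y3)))) ∂cub ∂cub ∂cub := by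
        refine lintegral_mono fun x3 => lintegral_mono fun x2 => lintegral_mono fun x1 => lintegral_mono fun y3 => lintegral_mono fun y2 => lintegral_mono fun y1 => ?_
        calc _ ≤ φ (pt3 x1 x2 x3) * ((ker1 s x3 y3 * (ker1 s x2 y2 * ker1 s x1 y1)) * A (pt3 y1 y2 y3)) := by
              gcongr; exact kerB_le ..
          _ = _ := by ring
    _ = ∫⁻ x3, ∫⁻ y3, ∫⁻ x2, ∫⁻ y2, ∫⁻ x1, ∫⁻ y1, ker1 s x3 y3 * (ker1 s x2 y2 * (φ (pt3 x1 x2 x3) * (ker1 s x1 y1 * A (pt3 y1 y2 y3)))) ∂cub ∂volume ∂cub ∂volume ∂cub := by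
        refine lintegral_congr fun x3 => ?_
        symm
        rw [lintegral_lintegral_swap (by unfold Function.uncurry; fun_prop)]
        refine lintegral_congr fun x2 => ?_
        symm
        rw [lintegral_lintegral_swap (by unfold Function.uncurry; fun_prop)]
        refine lintegral_congr fun y3 => ?_
        rw [lintegral_lintegral_swap (by unfold Function.uncurry; fun_prop)]
    _ = ∫⁻ x3, ∫⁻ y3, ker1 s x3 y3 * ∫⁻ x2, ∫⁻ y2, ker1 s x2 y2 * ∫⁻ x1, ∫⁻ y1, (φ (pt3 x1 x2 x3) * (ker1 s x1 y1 * A (pt3 y1 y2 y3))) ∂cub ∂volume ∂cub ∂volume ∂cub := by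
        refine lintegral_congr fun x3 => lintegral_congr fun y3 => ?_
        rw [← lintegral_const_mul _ (by fun_prop)]
        refine lintegral_congr fun x2 => ?_
        rw [← lintegral_const_mul _ (by fun_prop)]
        refine lintegral_congr fun y2 => ?_
        rw [← mul_assoc, ← lintegral_const_mul _ (by fun_prop)]
        refine lintegral_congr fun x1 => ?_
        rw [← lintegral_const_mul _ (by fun_prop)]
        simp_rw [mul_assoc]
    _ ≤ ∫⁻ x3, ∫⁻ y3, ker1 s x3 y3 * ∫⁻ x2, ∫⁻ y2, ker1 s x2 y2 * (ENNReal.ofReal (2*s) ^ (1-t1) * ((∫⁻ x1, φ (pt3 x1 x2 x3) ^ (3/2:ℝ)) ^ (2/3:ℝ) * nrm g1 fun y1 => A (pt3 y1 y2 y3))) ∂cub ∂volume ∂cub := by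
        gcongr with x3 y3 x2 y2
        exact young1 ht1 hg1 hg11 (by fun_prop) (by fun_prop)
    _ = ∫⁻ x3, ∫⁻ y3, ker1 s x3 y3 * (ENNReal.ofReal (2*s) ^ (1-t1) * ∫⁻ x2, ∫⁻ y2, ((∫⁻ x1, φ (pt3 x1 x2 x3) ^ (3/2:ℝ)) ^ (2/3:ℝ) * (ker1 s x2 y2 * nrm g1 fun y1 => A (pt3 y1 y2 y3))) ∂cub ∂volume) ∂cub := by
        refine lintegral_congr fun x3 => lintegral_congr fun y3 => ?_
        congr 1
        rw [← lintegral_const_mul _ (by fun_prop)]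
        refine lintegral_congr fun x2 => ?_
        rw [← lintegral_const_mul _ (by fun_prop)]
        refine lintegral_congr fun y2 => ?_
        ring
    _ ≤ ∫⁻ x3, ∫⁻ y3, ker1 s x3 y3 * (ENNReal.ofReal (2*s) ^ (1-t1) * (ENNReal.ofReal (2*s) ^ (1-t2) * ((∫⁻ x2, ((∫⁻ x1, φ (pt3 x1 x2 x3) ^ (3/2:ℝ)) ^ (2/3:ℝ)) ^ (3/2:ℝ)) ^ (2/3:ℝ) * nrm g2 fun y2 => nrm g1 fun y1 => A (pt3 y1 y2 y3)))) ∂cub ∂volume := by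
        gcongr with x3 y3
        exact young1 ht2 hg2 hg21 (by fun_prop) (by fun_prop)
    _ = ENNReal.ofReal (2*s) ^ (1-t1) * (ENNReal.ofReal (2*s) ^ (1-t2) * ∫⁻ x3, ∫⁻ y3, ((∫⁻ x2, ((∫⁻ x1, φ (pt3 x1 x2 x3) ^ (3/2:ℝ)) ^ (2/3:ℝ)) ^ (3/2:ℝ)) ^ (2/3:ℝ) * (ker1 s x3 y3 * nrm g2 fun y2 => nrm g1 fun y1 => A (pt3 y1 y2 y3))) ∂cub ∂volume) := by
        rw [← mul_assoc, ← lintegral_const_mul _ (by fun_prop)]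
        refine lintegral_congr fun x2 => ?_
        rw [← lintegral_const_mul _ (by fun_prop)]
        refine lintegral_congr fun y2 => ?_
        ring
    _ ≤ _ := by
        gcongr
        refine (young1 ht3 hg3 hg31 (by fun_prop) (by fun_prop)).trans ?_
        gcongr
        · rw [lintegral_E3 (by fun_prop)]
          simp only [← ENNReal.rpow_mul]
          norm_num
        · exact le_rfl

end

section

def fB (ρ : ℝ) (v : E3 → E3) : E3 → ℝ≥0∞ := (ball 0 ρ).indicator (fun x => ‖v x‖ₑ)
def QB (ρ : ℝ) (v : E3 → E3) (s : ℝ) (y : E3) : ℝ≥0∞ :=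
  ∫⁻ z, (ball (0:E3) ρ).indicator 1 z * (kerB (2*s) y z * ‖v y - v z‖ₑ ^ (2:ℝ))
def QB1 (ρ : ℝ) (v : E3 → E3) (s : ℝ) (y : E3) : ℝ≥0∞ :=
  ((ball (0:E3) ρ).indicator 1 y * QB ρ v s y) ^ (1/2:ℝ)
def GB (θ ρ : ℝ) (v : E3 → E3) (s : ℝ) (y : E3) : ℝ≥0∞ := fB ρ v y ^ (1-θ) * QB1 ρ v s y ^ θ
def VB (s : ℝ) : ℝ≥0∞ := volume (ball (0:E3) s)
def avB (s : ℝ) (F : E3 → ℝ≥0∞) (x : E3) : ℝ≥0∞ := (VB s)⁻¹ * ∫⁻ y, kerB s x y * F y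

@[fun_prop] lemma ind1_meas {ρ : ℝ} : Measurable ((ball (0:E3) ρ).indicator (1 : E3 → ℝ≥0∞)) :=
  measurable_one.indicator measurableSet_ball
lemma fB_meas {ρ : ℝ} {v : E3 → E3} (hv : Measurable v) : Measurable (fB ρ v) :=
  hv.enorm.indicator measurableSet_ball
lemma QB_meas {ρ s : ℝ} {v : E3 → E3} (hv : Measurable v) : Measurable (QB ρ v s) := by
  unfold QB
  refine lint_meas ?_
  have : Measurable (fun z : E3 × E3 => ‖v z.1 - v z.2‖ₑ) := by fun_prop
  fun_prop
lemma QB1_meas {ρ s : ℝ} {v : E3 → E3} (hv : Measurable v) : Measurable (QB1 ρ v s) := by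
  have := QB_meas (ρ := ρ) (s := s) hv
  unfold QB1
  fun_prop
lemma GB_meas {θ ρ s : ℝ} {v : E3 → E3} (hv : Measurable v) : Measurable (GB θ ρ v s) := by
  have := QB1_meas (ρ := ρ) (s := s) hv
  have := fB_meas (ρ := ρ) hv
  unfold GB
  fun_prop

lemma VB_pos {s : ℝ} (hs : 0 < s) : VB s ≠ 0 := (measure_ball_pos _ _ hs).ne'
lemma VB_fin {s : ℝ} : VB s ≠ ∞ := measure_ball_lt_top.ne
lemma VB_eq {s : ℝ} (hs : 0 < s) : VB s = ENNReal.ofReal s ^ (3:ℝ) * VB 1 := by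
  unfold VB
  rw [Measure.addHaar_ball_of_pos _ _ hs]
  simp
  rw [ENNReal.ofReal_pow hs.le]

lemma kerB_int {s : ℝ} (x : E3) : ∫⁻ y, kerB s x y = VB s := by
  have : (fun y => kerB s x y) = (ball x s).indicator (fun _ => 1) := by
    ext y
    simp [kerB, indicator, dist_comm]
  rw [this, lintegral_indicator measurableSet_ball]
  simp only [lintegral_const, one_mul, Measure.restrict_apply MeasurableSet.univ, univ_inter]
  unfold VB
  exact Measure.addHaar_ball_center _ _ _

lemma kerB_symm (s : ℝ) (x y : E3) : kerB s x y = kerB s y x := by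
  unfold kerB; rw [dist_comm]

lemma kerB_mono {s t : ℝ} (h : s ≤ t) (x y : E3) : kerB s x y ≤ kerB t x y := by
  unfold kerB
  split_ifs with h1 h2
  · exact le_rfl
  · exact absurd (h1.trans_le h) h2
  · exact zero_le
  · exact le_rfl

lemma diff_split {θ : ℝ} (h0 : 0 < θ) (h1 : θ < 1) (a b : E3) :
    ‖a‖ₑ ≤ ‖b‖ₑ + (‖a‖ₑ ^ (1-θ) + ‖b‖ₑ ^ (1-θ)) * ‖a - b‖ₑ ^ θ := by
  have e1 : ‖a‖ₑ ≤ ‖b‖ₑ + ‖a - b‖ₑ := by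
    calc ‖a‖ₑ = ‖b + (a - b)‖ₑ := by congr 1; abel
      _ ≤ _ := enorm_add_le _ _
  refine e1.trans ?_
  gcongr
  calc ‖a - b‖ₑ = ‖a - b‖ₑ ^ (1-θ) * ‖a - b‖ₑ ^ θ := by
        rw [← ENNReal.rpow_add_of_nonneg _ _ (by linarith) h0.le]; simp
    _ ≤ _ := by
        gcongr
        refine (ENNReal.rpow_le_rpow (enorm_sub_le) (by linarith)).trans ?_
        exact ENNReal.rpow_add_le_add_rpow _ _ (by linarith) (by linarith)

lemma kerB_rpow {s t : ℝ} (ht : 0 < t) (x y : E3) : kerB s x y ^ t = kerB s x y := by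
  unfold kerB; split_ifs <;> simp [ht]

lemma inner_holder {θ s : ℝ} (h0 : 0 < θ) (h1 : θ < 1) {v : E3 → E3} (hv : Measurable v) (x : E3) (b : E3) :
    ∫⁻ z, kerB s x z * ‖b - v z‖ₑ ^ θ ≤ VB s ^ (1 - θ/2) * (∫⁻ z, kerB s x z * ‖b - v z‖ₑ ^ (2:ℝ)) ^ (θ/2) := by
  have hm : Measurable (fun z => ‖b - v z‖ₑ) := by fun_prop
  have key := ENNReal.lintegral_prod_norm_pow_le (μ := (volume : Measure E3)) (Finset.univ : Finset (Fin 2))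
    (f := ![fun z => kerB s x z, fun z => kerB s x z * ‖b - v z‖ₑ ^ (2:ℝ)])
    (p := ![1 - θ/2, θ/2])
    (by intro i _; fin_cases i <;> simp only [Fin.isValue, Matrix.cons_val_zero, Matrix.cons_val_one, Fin.zero_eta, Fin.mk_one] <;> fun_prop)
    (by simp [Fin.sum_univ_two])
    (by intro i _; fin_cases i <;> simp <;> linarith)
  simp only [Fin.prod_univ_two, Matrix.cons_val_zero, Matrix.cons_val_one] at key
  rw [kerB_int] at key
  refine le_trans (le_of_eq ?_) key
  refine lintegral_congr fun z => ?_
  rw [ENNReal.mul_rpow_of_nonneg _ _ (by linarith), kerB_rpow (by linarith), kerB_rpow (by linarith), ← ENNReal.rpow_mul]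
  rw [show 2 * (θ/2) = θ by ring, ← mul_assoc]
  unfold kerB; split_ifs <;> simp

lemma inB {ρ ρ2 s : ℝ} (h : ρ2 + s ≤ ρ) {x y : E3} (hx : ‖x‖ < ρ2) (hy : dist x y < s) : y ∈ ball (0:E3) ρ := by
  rw [mem_ball_zero_iff]
  calc ‖y‖ = ‖x - (x - y)‖ := by congr 1; abel
    _ ≤ ‖x‖ + ‖x - y‖ := norm_sub_le _ _
    _ < ρ := by rw [← dist_eq_norm]; linarith

lemma av_step {θ ρ ρ2 s : ℝ} (h0 : 0 < θ) (h1 : θ < 1) (hs : 0 < s) (hr : ρ2 + s ≤ ρ) {v : E3 → E3}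
    (hv : Measurable v) {x : E3} (hx : ‖x‖ < ρ2) :
    avB (s/2) (fB ρ v) x ≤ avB s (fB ρ v) x + 16 * (VB s ^ (-(1+θ/2)) * ∫⁻ y, kerB s x y * GB θ ρ v s y) := by
  have hf := fB_meas (ρ := ρ) hv
  have hG := GB_meas (θ := θ) (ρ := ρ) (s := s) hv
  have hn : Measurable (fun z : E3 × E3 => ‖v z.1 - v z.2‖ₑ) := by fun_prop
  set f := fB ρ v with hfd
  have fv : ∀ y, dist x y < s → f y = ‖v y‖ₑ := fun y hy => by
    rw [hfd, fB, indicator_of_mem (inB hr hx hy)]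
  have pw : ∀ y z, kerB (s/2) x y * f y * kerB s x z ≤ kerB (s/2) x y * (kerB s x z * f z) +
      (kerB s x y * f y ^ (1-θ) * (kerB s x z * ‖v y - v z‖ₑ ^ θ) + kerB s x z * f z ^ (1-θ) * (kerB s x y * ‖v z - v y‖ₑ ^ θ)) := by
    intro y z
    by_cases hy : dist x y < s/2
    · by_cases hz : dist x z < s
      · have hy' : dist x y < s := by linarith
        have := diff_split h0 h1 (v y) (v z)
        rw [fv y hy', fv z hz, enorm_sub_rev (v z) (v y)]
        simp only [kerB, hy, hz, hy', if_true, one_mul, mul_one]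
        rw [← add_mul]; exact this
      · simp [kerB, hz]
    · simp [kerB, hy]
  have inner : ∀ y, kerB s x y * f y ^ (1-θ) * ∫⁻ z, (kerB s x z * ‖v y - v z‖ₑ ^ θ) ≤
      VB s ^ (1-θ/2) * (kerB s x y * GB θ ρ v s y) := by
    intro y
    by_cases hy : dist x y < s
    · have hyB := inB hr hx hy
      simp only [kerB, hy, if_true, one_mul]
      have e : ∫⁻ z, kerB s x z * ‖v y - v z‖ₑ ^ (2:ℝ) ≤ QB ρ v s y := by
        unfold QB
        refine lintegral_mono fun z => ?_
        by_cases hz : dist x z < s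
        · have hzB := inB hr hx hz
          have : dist y z < 2*s := by linarith [dist_triangle_left y z x]
          simp [kerB, hz, this, hzB]
        · simp [kerB, hz]
      have e2 : QB1 ρ v s y ^ θ = QB ρ v s y ^ (θ/2) := by
        unfold QB1
        rw [indicator_of_mem hyB, ← ENNReal.rpow_mul]
        simp
        congr 1; ring
      unfold GB
      rw [e2]
      calc _ ≤ f y ^ (1-θ) * (VB s ^ (1 - θ/2) * (∫⁻ z, kerB s x z * ‖v y - v z‖ₑ ^ (2:ℝ)) ^ (θ/2)) := by
            gcongr; exact inner_holder h0 h1 hv x (v y)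
        _ ≤ f y ^ (1-θ) * (VB s ^ (1 - θ/2) * (QB ρ v s y) ^ (θ/2)) := by gcongr
        _ = _ := by ring
    · simp [kerB, hy]
  set I := ∫⁻ y, kerB s x y * GB θ ρ v s y with hI
  set a := ∫⁻ y, kerB (s/2) x y * f y with ha
  set b := ∫⁻ y, kerB s x y * f y with hb
  have main : a * VB s ≤ VB (s/2) * b + 2 * (VB s ^ (1-θ/2) * I) := by
    have l1 : a * VB s = ∫⁻ y, ∫⁻ z, kerB (s/2) x y * f y * kerB s x z := by
      rw [← kerB_int x, ha, ← lintegral_mul_const _ (by fun_prop)]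
      refine lintegral_congr fun y => ?_
      rw [lintegral_const_mul _ (by fun_prop)]
    have l2 : ∫⁻ y, ∫⁻ z, kerB (s/2) x y * (kerB s x z * f z) = VB (s/2) * b := by
      rw [← kerB_int x, ← lintegral_mul_const _ (by fun_prop)]
      refine lintegral_congr fun y => ?_
      rw [lintegral_const_mul _ (by fun_prop)]
    have l3 : ∫⁻ y, ∫⁻ z, kerB s x y * f y ^ (1-θ) * (kerB s x z * ‖v y - v z‖ₑ ^ θ) ≤ VB s ^ (1-θ/2) * I := by
      rw [hI, ← lintegral_const_mul _ (by fun_prop)]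
      refine lintegral_mono fun y => ?_
      rw [lintegral_const_mul _ (by fun_prop)]
      exact inner y
    have l4 : ∫⁻ y, ∫⁻ z, kerB s x z * f z ^ (1-θ) * (kerB s x y * ‖v z - v y‖ₑ ^ θ) =
        ∫⁻ y, ∫⁻ z, kerB s x y * f y ^ (1-θ) * (kerB s x z * ‖v y - v z‖ₑ ^ θ) := by
      rw [lintegral_lintegral_swap]
      unfold Function.uncurry
      have : Measurable (fun z : E3 × E3 => ‖v z.2 - v z.1‖ₑ) := by fun_prop
      fun_prop
    rw [l1]
    have hn2 : Measurable (fun z : E3 × E3 => ‖v z.2 - v z.1‖ₑ) := by fun_prop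
    calc _ ≤ ∫⁻ y, ∫⁻ z, (kerB (s/2) x y * (kerB s x z * f z) +
          (kerB s x y * f y ^ (1-θ) * (kerB s x z * ‖v y - v z‖ₑ ^ θ) + kerB s x z * f z ^ (1-θ) * (kerB s x y * ‖v z - v y‖ₑ ^ θ))) :=
          lintegral_mono fun y => lintegral_mono fun z => pw y z
      _ = (∫⁻ y, ∫⁻ z, kerB (s/2) x y * (kerB s x z * f z)) + ((∫⁻ y, ∫⁻ z, kerB s x y * f y ^ (1-θ) * (kerB s x z * ‖v y - v z‖ₑ ^ θ)) +
          (∫⁻ y, ∫⁻ z, kerB s x z * f z ^ (1-θ) * (kerB s x y * ‖v z - v y‖ₑ ^ θ))) := by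
          rw [← lintegral_add_left (by fun_prop), ← lintegral_add_left (by fun_prop)]
          refine lintegral_congr fun y => ?_
          rw [← lintegral_add_left (by fun_prop), ← lintegral_add_left (by fun_prop)]
      _ ≤ _ := by
          rw [l4, l2, two_mul]
          gcongr
  have hV := VB_pos hs
  have hV2 := VB_pos (half_pos hs)
  have hVf := VB_fin (s := s)
  have h8 : VB s = 8 * VB (s/2) := by
    rw [VB_eq hs, VB_eq (half_pos hs), ENNReal.ofReal_div_of_pos (by norm_num), ENNReal.div_rpow_of_nonneg _ _ (by norm_num)]
    norm_num
    rw [← mul_assoc, ENNReal.mul_div_cancel (by norm_num) (by norm_num)]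
  unfold avB
  rw [← ha, ← hb]
  calc (VB (s/2))⁻¹ * a = (VB (s/2))⁻¹ * (VB s)⁻¹ * (a * VB s) := by
        rw [show (VB (s/2))⁻¹ * (VB s)⁻¹ * (a * VB s) = (VB (s/2))⁻¹ * a * ((VB s)⁻¹ * VB s) by ring, ENNReal.inv_mul_cancel hV hVf, mul_one]
    _ ≤ (VB (s/2))⁻¹ * (VB s)⁻¹ * (VB (s/2) * b + 2 * (VB s ^ (1-θ/2) * I)) := by gcongr
    _ = ((VB (s/2))⁻¹ * VB (s/2)) * ((VB s)⁻¹ * b) + (VB (s/2))⁻¹ * (VB s)⁻¹ * 2 * VB s ^ (1-θ/2) * I := by ring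
    _ = _ := by
        rw [ENNReal.inv_mul_cancel hV2 VB_fin, one_mul]
        congr 1
        have : (VB (s/2))⁻¹ = 8 * (VB s)⁻¹ := by
          rw [h8, ENNReal.mul_inv (by norm_num) (by norm_num), ← mul_assoc, ENNReal.mul_inv_cancel (by norm_num) (by norm_num), one_mul]
        rw [this, show -(1+θ/2) = (-1) + ((-1) + (1-θ/2)) by ring, ENNReal.rpow_add _ _ hV hVf, ENNReal.rpow_add _ _ hV hVf, ENNReal.rpow_neg_one]
        ring

end

section

structure GNP (a1 a2 a3 κ θ t1 t2 t3 : ℝ) : Prop where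
  a1p : 0 < a1
  a2p : 0 < a2
  a3p : 0 < a3
  κ0 : 0 ≤ κ
  θ0 : 0 < θ
  θ1 : θ < 1
  κθ : κ + θ ≤ 1
  t10 : 0 ≤ t1
  t20 : 0 ≤ t2
  t30 : 0 ≤ t3
  t11 : 1/3 + t1 < 1
  t21 : 1/3 + t2 < 1
  t31 : 1/3 + t3 < 1
  c1 : κ * a1 + (1-κ)/2 ≤ 1/3 + t1
  c2 : κ * a2 + (1-κ)/2 ≤ 1/3 + t2
  c3 : κ * a3 + (1-κ)/2 ≤ 1/3 + t3
  T : t1 + t2 + t3 < θ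

/-- the majorant -/
def MB (θ ρ : ℝ) (v : E3 → E3) (δ : ℝ) (x : E3) : ℝ≥0∞ :=
  avB δ (fB ρ v) x + 16 * ∑' k : ℕ, (VB (δ/2^k) ^ (-(1+θ/2)) * ∫⁻ y, kerB (δ/2^k) x y * GB θ ρ v (δ/2^k) y)

lemma avB_meas {s : ℝ} {F : E3 → ℝ≥0∞} (hF : Measurable F) : Measurable (avB s F) := by
  unfold avB
  fun_prop

lemma MB_meas {θ ρ δ : ℝ} {v : E3 → E3} (hv : Measurable v) : Measurable (MB θ ρ v δ) := by
  unfold MB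
  have := avB_meas (s := δ) (fB_meas (ρ := ρ) hv)
  refine this.add (Measurable.const_mul (Measurable.tsum fun k => ?_) _)
  have := GB_meas (θ := θ) (ρ := ρ) (s := δ/2^k) hv
  fun_prop

lemma avB_le_MB {θ ρ ρ2 δ : ℝ} (h0 : 0 < θ) (h1 : θ < 1) (hs : 0 < δ) (hr : ρ2 + δ ≤ ρ) {v : E3 → E3}
    (hv : Measurable v) {x : E3} (hx : ‖x‖ < ρ2) (k : ℕ) : avB (δ/2^k) (fB ρ v) x ≤ MB θ ρ v δ x := by
  have : ∀ k : ℕ, avB (δ/2^k) (fB ρ v) x ≤ avB δ (fB ρ v) x + 16 * ∑ k ∈ Finset.range k, (VB (δ/2^k) ^ (-(1+θ/2)) * ∫⁻ y, kerB (δ/2^k) x y * GB θ ρ v (δ/2^k) y) := by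
    intro k
    induction k with
    | zero => simp
    | succ k ih =>
      have hle : δ/2^k ≤ δ := div_le_self hs.le (one_le_pow₀ (by norm_num))
      have := av_step (θ := θ) (ρ := ρ) (ρ2 := ρ2) (s := δ/2^k) h0 h1 (by positivity) (by linarith) hv hx
      rw [show δ/2^(k+1) = δ/2^k/2 by field_simp; ring, Finset.sum_range_succ, mul_add, ← add_assoc]
      exact this.trans (by gcongr)
  refine (this k).trans ?_
  unfold MB
  gcongr
  exact ENNReal.sum_le_tsum _

lemma leb_point {F : E3 → ℝ≥0∞} (hF : Measurable F) (hfin : ∫⁻ x, F x ≠ ∞) {δ : ℝ} (hδ : 0 < δ) :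
    ∀ᵐ x, Tendsto (fun k : ℕ => avB (δ/2^k) F x) atTop (nhds (F x)) := by
  have key := (IsUnifLocDoublingMeasure.vitaliFamily (volume : Measure E3) 1).ae_tendsto_lintegral_div hF.aemeasurable hfin
  filter_upwards [key] with x hx
  have hlim : Tendsto (fun k : ℕ => δ/2^k) atTop (nhds 0) := by
    have := (tendsto_pow_atTop_nhds_zero_of_lt_one (r := (1/2:ℝ)) (by norm_num) (by norm_num)).const_mul δ
    simpa [div_eq_mul_inv] using this
  have ht : Tendsto (fun k : ℕ => closedBall x (δ/2^k)) atTop ((IsUnifLocDoublingMeasure.vitaliFamily (volume : Measure E3) 1).filterAt x) := by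
    refine IsUnifLocDoublingMeasure.tendsto_closedBall_filterAt (K := 1) volume (fun _ => x) (fun k : ℕ => δ/2^k) ?_ ?_
    · rw [tendsto_nhdsWithin_iff]
      exact ⟨hlim, Eventually.of_forall fun k => by simp; positivity⟩
    · exact Eventually.of_forall fun k => by simp; positivity
  have := hx.comp ht
  refine this.congr fun k => ?_
  have hpos : 0 < δ/2^k := by positivity
  simp only [Function.comp_apply]
  unfold avB
  rw [Measure.addHaar_closedBall_eq_addHaar_ball, Measure.addHaar_ball_center, div_eq_mul_inv, mul_comm]
  unfold VB
  congr 1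
  have hae : (ball x (δ/2^k) : Set E3) =ᵐ[volume] closedBall x (δ/2^k) := by
    refine ae_eq_of_subset_of_measure_ge ball_subset_closedBall ?_ measurableSet_ball.nullMeasurableSet measure_closedBall_lt_top.ne
    rw [Measure.addHaar_closedBall_eq_addHaar_ball]
  rw [← setLIntegral_congr hae, ← lintegral_indicator measurableSet_ball]
  refine lintegral_congr fun y => ?_
  simp [kerB, indicator, dist_comm]

lemma fB_le_MB {θ ρ ρ2 δ : ℝ} (h0 : 0 < θ) (h1 : θ < 1) (hs : 0 < δ) (hr : ρ2 + δ ≤ ρ) {v : E3 → E3}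
    (hv : Measurable v) (hfin : ∫⁻ x, fB ρ v x ≠ ∞) : ∀ᵐ x, ‖x‖ < ρ2 → fB ρ v x ≤ MB θ ρ v δ x := by
  filter_upwards [leb_point (fB_meas hv) hfin hs] with x hx hx2
  exact le_of_tendsto hx (Eventually.of_forall fun k => avB_le_MB h0 h1 hs hr hv hx2 k)

lemma scal1 {σ V : ℝ≥0∞} (h0 : σ ≠ 0) (h1 : σ ≠ ∞) (hV1 : V ≠ ∞) {r t1 t2 t3 : ℝ} :
    (σ ^ (3:ℝ) * V) ^ (-r) * ((2*σ) ^ (1-t1) * ((2*σ) ^ (1-t2) * (2*σ) ^ (1-t3))) =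
      V ^ (-r) * 2 ^ (3 - (t1+t2+t3)) * σ ^ (3 - 3*r - (t1+t2+t3)) := by
  rw [ENNReal.mul_rpow_of_ne_top (by simp [h1]) hV1, ENNReal.mul_rpow_of_ne_top (by norm_num) h1, ENNReal.mul_rpow_of_ne_top (by norm_num) h1, ENNReal.mul_rpow_of_ne_top (by norm_num) h1]
  have e1 : (2:ℝ≥0∞) ^ (3 - (t1+t2+t3)) = 2 ^ (1-t1) * (2 ^ (1-t2) * 2 ^ (1-t3)) := by
    rw [← ENNReal.rpow_add _ _ (by norm_num) (by norm_num), ← ENNReal.rpow_add _ _ (by norm_num) (by norm_num)]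
    congr 1; ring
  have e2 : σ ^ (3 - 3*r - (t1+t2+t3)) = (σ ^ (3:ℝ)) ^ (-r) * (σ ^ (1-t1) * (σ ^ (1-t2) * σ ^ (1-t3))) := by
    rw [← ENNReal.rpow_mul, ← ENNReal.rpow_add _ _ h0 h1, ← ENNReal.rpow_add _ _ h0 h1, ← ENNReal.rpow_add _ _ h0 h1]
    congr 1; ring
  rw [e1, e2]
  ring

lemma fB_zero {ρ : ℝ} (hρ : ρ ≤ 1) (v : E3 → E3) (x : E3) (hx : 1 < ‖x‖) : fB ρ v x = 0 := by
  unfold fB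
  rw [indicator_of_notMem]
  simp; linarith

lemma GN_term {a1 a2 a3 κ θ t1 t2 t3 : ℝ} (H : GNP a1 a2 a3 κ θ t1 t2 t3) {ρ s r : ℝ} (hρ : ρ ≤ 1) (hs : 0 < s)
    {v : E3 → E3} (hv : Measurable v) {N L W : ℝ≥0∞} (hN : mixC a1 a2 a3 (fB ρ v) ≤ N)
    (hL : (∫⁻ x, fB ρ v x ^ (2:ℝ)) ^ (1/2:ℝ) ≤ L) {F : E3 → ℝ≥0∞} (hF : Measurable F)
    (hW : (∫⁻ x, F x ^ (2:ℝ)) ^ (1/2:ℝ) ≤ W) {Φ : E3 → ℝ≥0∞} (hΦ : Measurable Φ) :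
    ∫⁻ x, Φ x * (VB s ^ (-r) * ∫⁻ y, kerB s x y * (fB ρ v y ^ (1-θ) * F y ^ θ)) ≤
      8 * VB 1 ^ (-r) * 2 ^ (3 - (t1+t2+t3)) * ENNReal.ofReal s ^ (3 - 3*r - (t1+t2+t3)) * ((∫⁻ x, Φ x ^ (3/2:ℝ)) ^ (2/3:ℝ) * (N ^ κ * L ^ (1-κ-θ) * W ^ θ)) := by
  have hf := fB_meas (ρ := ρ) hv
  obtain ⟨a1p, a2p, a3p, κ0, θ0, θ1, κθ, t10, t20, t30, t11, t21, t31, c1, c2, c3, T⟩ := H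
  set G : E3 → ℝ≥0∞ := fun y => fB ρ v y ^ (1-θ) * F y ^ θ with hG
  have hGm : Measurable G := by fun_prop
  have hG0 : ∀ x, 1 < ‖x‖ → G x = 0 := by
    intro x hx
    simp only [hG, fB_zero hρ v x hx]
    rw [ENNReal.zero_rpow_of_pos (by linarith), zero_mul]
  have e1 : ∫⁻ x, Φ x * (VB s ^ (-r) * ∫⁻ y, kerB s x y * G y) = VB s ^ (-r) * ∫⁻ x, ∫⁻ y, Φ x * (kerB s x y * G y) := by
    rw [← lintegral_const_mul _ (by fun_prop)]
    refine lintegral_congr fun x => ?_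
    rw [lintegral_const_mul _ (by fun_prop)]
    ring
  have hmix : mixC (1/3+t1) (1/3+t2) (1/3+t3) G ≤ 8 * (N ^ κ * L ^ (1-κ-θ) * W ^ θ) := by
    have eG : G = fun x => fB ρ v x ^ κ * fB ρ v x ^ (1-κ-θ) * F x ^ θ := by
      ext x
      rw [hG, ← ENNReal.rpow_add_of_nonneg _ _ κ0 (by linarith)]
      simp only
      congr 2; ring
    rw [eG]
    refine (mixC_holder (by linarith) (by linarith) (by linarith) a1p a2p a3p κ0 (by linarith) θ0.le (by linarith) (by linarith) (by linarith) t11.le t21.le t31.le hf hf hF).trans ?_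
    gcongr
    · linarith
    · exact (mixC_half_le hf).trans hL
    · exact (mixC_half_le hF).trans hW
  rw [e1]
  refine (mul_le_mul' le_rfl (young3 (s := s) t10 rfl t11 t20 rfl t21 t30 rfl t31 hΦ hGm hG0)).trans ?_
  have h2s : ENNReal.ofReal (2*s) = 2 * ENNReal.ofReal s := by
    rw [ENNReal.ofReal_mul (by norm_num)]; norm_num
  rw [h2s, VB_eq hs]
  have := scal1 (σ := ENNReal.ofReal s) (V := VB 1) (by simp [hs]) (by simp) VB_fin (r := r) (t1 := t1) (t2 := t2) (t3 := t3)
  generalize (∫⁻ x, Φ x ^ (3/2:ℝ)) ^ (2/3:ℝ) = X at *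
  calc _ = ((ENNReal.ofReal s ^ (3:ℝ) * VB 1) ^ (-r) * ((2*ENNReal.ofReal s) ^ (1-t1) * ((2*ENNReal.ofReal s) ^ (1-t2) * (2*ENNReal.ofReal s) ^ (1-t3)))) * (X * mixC (1/3+t1) (1/3+t2) (1/3+t3) G) := by ring
    _ ≤ _ := by
      rw [this]
      refine (mul_le_mul' le_rfl (mul_le_mul' le_rfl hmix)).trans (le_of_eq ?_)
      ring

end

section

lemma geo_sum {β : ℝ} (hβ : 0 < β) : ∃ S : ℝ≥0∞, S ≠ ∞ ∧ ∀ δ : ℝ, 0 < δ → δ ≤ 1 →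
    ∑' k : ℕ, ENNReal.ofReal (δ/2^k) ^ β ≤ S := by
  set r : ℝ≥0∞ := ENNReal.ofReal (1/2) ^ β with hr
  have hr1 : r < 1 := by
    rw [hr]; exact ENNReal.rpow_lt_one (by rw [ENNReal.ofReal_lt_one]; norm_num) hβ
  refine ⟨(1 - r)⁻¹, ?_, ?_⟩
  · rw [Ne, ENNReal.inv_eq_top]; exact (tsub_pos_of_lt hr1).ne'
  · intro δ h0 h1
    rw [← ENNReal.tsum_geometric]
    refine ENNReal.tsum_le_tsum fun k => ?_
    rw [hr, ← ENNReal.rpow_natCast, ← ENNReal.rpow_mul, mul_comm, ENNReal.rpow_mul, ENNReal.rpow_natCast]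
    refine ENNReal.rpow_le_rpow ?_ hβ.le
    rw [← ENNReal.ofReal_pow (by norm_num)]
    refine ENNReal.ofReal_le_ofReal ?_
    rw [div_pow, one_pow]
    gcongr

lemma GN_M {a1 a2 a3 κ θ t1 t2 t3 : ℝ} (H : GNP a1 a2 a3 κ θ t1 t2 t3) : ∃ C : ℝ≥0∞, C ≠ ∞ ∧
    ∀ (ρ δ : ℝ) (v : E3 → E3) (N L W : ℝ≥0∞), ρ ≤ 1 → 0 < δ → δ ≤ 1 → Measurable v →
    mixC a1 a2 a3 (fB ρ v) ≤ N → (∫⁻ x, fB ρ v x ^ (2:ℝ)) ^ (1/2:ℝ) ≤ L →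
    (∀ s : ℝ, 0 < s → s ≤ 1 → (∫⁻ x, QB1 ρ v s x ^ (2:ℝ)) ^ (1/2:ℝ) ≤ ENNReal.ofReal s ^ (5/2:ℝ) * W) →
    ∀ Φ : E3 → ℝ≥0∞, Measurable Φ → ∫⁻ x, Φ x * MB θ ρ v δ x ≤
      C * ENNReal.ofReal δ ^ (-1:ℝ) * ((∫⁻ x, Φ x ^ (3/2:ℝ)) ^ (2/3:ℝ) * (N ^ κ * L ^ (1-κ-θ) * (L ^ θ + W ^ θ))) := by
  obtain ⟨S, hS, hS'⟩ := geo_sum (β := θ - (t1+t2+t3)) (by linarith [H.T])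
  set c1 : ℝ≥0∞ := 8 * VB 1 ^ (-(1:ℝ)) * 2 ^ (3 - (t1+t2+t3)) with hc1
  set c2 : ℝ≥0∞ := 8 * VB 1 ^ (-(1+θ/2)) * 2 ^ (3 - (t1+t2+t3)) with hc2
  have hV : ∀ r : ℝ, VB 1 ^ r ≠ ∞ := fun r => ENNReal.rpow_ne_top_of_ne_zero (VB_pos one_pos) VB_fin
  have h2 : ∀ r : ℝ, (2:ℝ≥0∞) ^ r ≠ ∞ := fun r => ENNReal.rpow_ne_top_of_ne_zero (by norm_num) (by norm_num)
  have hc1f : c1 ≠ ∞ := ENNReal.mul_ne_top (ENNReal.mul_ne_top (by norm_num) (hV _)) (h2 _)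
  have hc2f : c2 ≠ ∞ := ENNReal.mul_ne_top (ENNReal.mul_ne_top (by norm_num) (hV _)) (h2 _)
  refine ⟨c1 + 16 * (c2 * S), ENNReal.add_ne_top.2 ⟨hc1f, ENNReal.mul_ne_top (by norm_num) (ENNReal.mul_ne_top hc2f hS)⟩, ?_⟩
  intro ρ δ v N L W hρ hδ hδ1 hv hN hL hW Φ hΦ
  have hf := fB_meas (ρ := ρ) hv
  set X := (∫⁻ x, Φ x ^ (3/2:ℝ)) ^ (2/3:ℝ) with hX
  set D := ENNReal.ofReal δ ^ (-1:ℝ) with hD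
  have hσ1 : ENNReal.ofReal δ ≤ 1 := by rw [ENNReal.ofReal_le_one]; exact hδ1
  have hD1 : 1 ≤ D := by
    rw [hD, ENNReal.rpow_neg_one, ENNReal.one_le_inv]; exact hσ1
  have p1 : ∫⁻ x, Φ x * avB δ (fB ρ v) x ≤ c1 * D * (X * (N ^ κ * L ^ (1-κ-θ) * L ^ θ)) := by
    have := GN_term H (r := 1) hρ hδ hv hN hL hf hL hΦ
    have e : ∀ y, fB ρ v y ^ (1-θ) * fB ρ v y ^ θ = fB ρ v y := fun y => by
      rw [← ENNReal.rpow_add_of_nonneg _ _ (by linarith [H.θ1]) H.θ0.le]; simp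
    simp only [e] at this
    unfold avB
    simp only [ENNReal.rpow_neg_one] at this
    refine this.trans ?_
    rw [hc1]
    simp only [ENNReal.rpow_neg_one]
    refine mul_le_mul' (mul_le_mul' le_rfl ?_) le_rfl
    rw [hD]
    exact ENNReal.rpow_le_rpow_of_exponent_ge hσ1 (by linarith [H.T, H.θ1])
  have p2 : ∀ k : ℕ, ∫⁻ x, Φ x * (VB (δ/2^k) ^ (-(1+θ/2)) * ∫⁻ y, kerB (δ/2^k) x y * GB θ ρ v (δ/2^k) y) ≤
      ENNReal.ofReal (δ/2^k) ^ (θ - (t1+t2+t3)) * (c2 * (X * (N ^ κ * L ^ (1-κ-θ) * W ^ θ))) := by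
    intro k
    have hs : 0 < δ/2^k := by positivity
    have hs1 : δ/2^k ≤ 1 := (div_le_self hδ.le (one_le_pow₀ (by norm_num))).trans hδ1
    refine (GN_term H (r := 1+θ/2) hρ hs hv hN hL (QB1_meas hv) (hW _ hs hs1) hΦ).trans (le_of_eq ?_)
    rw [ENNReal.mul_rpow_of_nonneg _ _ H.θ0.le, ← ENNReal.rpow_mul]
    rw [show θ - (t1+t2+t3) = (3 - 3*(1+θ/2) - (t1+t2+t3)) + 5/2*θ by ring, ENNReal.rpow_add _ _ (by simpa using hs) (by simp)]
    rw [hc2, hX]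
    ring
  unfold MB
  have hGm : ∀ k : ℕ, Measurable (GB θ ρ v (δ/2^k)) := fun k => GB_meas hv
  have hterm : ∀ k : ℕ, Measurable (fun x => VB (δ/2^k) ^ (-(1+θ/2)) * ∫⁻ y, kerB (δ/2^k) x y * GB θ ρ v (δ/2^k) y) := by
    intro k; have := hGm k; fun_prop
  calc _ = ∫⁻ x, (Φ x * avB δ (fB ρ v) x + 16 * ∑' k : ℕ, Φ x * (VB (δ/2^k) ^ (-(1+θ/2)) * ∫⁻ y, kerB (δ/2^k) x y * GB θ ρ v (δ/2^k) y)) := by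
        refine lintegral_congr fun x => ?_
        rw [ENNReal.tsum_mul_left]; ring
    _ = (∫⁻ x, Φ x * avB δ (fB ρ v) x) + 16 * ∑' k : ℕ, ∫⁻ x, Φ x * (VB (δ/2^k) ^ (-(1+θ/2)) * ∫⁻ y, kerB (δ/2^k) x y * GB θ ρ v (δ/2^k) y) := by
        have := avB_meas (s := δ) hf
        rw [lintegral_add_left (by fun_prop), lintegral_const_mul, lintegral_tsum]
        · intro k; exact (hΦ.mul (hterm k)).aemeasurable
        · exact Measurable.tsum fun k => hΦ.mul (hterm k)
    _ ≤ c1 * D * (X * (N ^ κ * L ^ (1-κ-θ) * L ^ θ)) + 16 * ∑' k : ℕ, ENNReal.ofReal (δ/2^k) ^ (θ - (t1+t2+t3)) * (c2 * (X * (N ^ κ * L ^ (1-κ-θ) * W ^ θ))) := by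
        gcongr with k
        exact p2 k
    _ ≤ c1 * D * (X * (N ^ κ * L ^ (1-κ-θ) * L ^ θ)) + 16 * (S * (c2 * (X * (N ^ κ * L ^ (1-κ-θ) * W ^ θ)))) := by
        rw [ENNReal.tsum_mul_right]
        gcongr
        exact hS' δ hδ hδ1
    _ = c1 * D * (X * (N ^ κ * L ^ (1-κ-θ) * L ^ θ)) + (16 * (c2 * S)) * 1 * (X * (N ^ κ * L ^ (1-κ-θ) * W ^ θ)) := by ring
    _ ≤ (c1 + 16 * (c2 * S)) * D * (X * (N ^ κ * L ^ (1-κ-θ) * L ^ θ)) + (c1 + 16 * (c2 * S)) * D * (X * (N ^ κ * L ^ (1-κ-θ) * W ^ θ)) := by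
        gcongr
        · exact le_self_add
        · exact le_add_self
    _ = _ := by ring

lemma rpow_absorb {Y K : ℝ≥0∞} (hY : Y ≠ ∞) (h : Y ≤ K * Y ^ (2/3:ℝ)) : Y ≤ K ^ (3:ℝ) := by
  by_cases h0 : Y = 0
  · simp [h0]
  have h1 : Y = Y ^ (1/3:ℝ) * Y ^ (2/3:ℝ) := by
    rw [← ENNReal.rpow_add_of_nonneg _ _ (by norm_num) (by norm_num)]; norm_num
  have hp0 : Y ^ (2/3:ℝ) ≠ 0 := by simp [h0]; norm_num
  have hpt : Y ^ (2/3:ℝ) ≠ ∞ := ENNReal.rpow_ne_top_of_nonneg (by norm_num) hY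
  have h2 : Y ^ (1/3:ℝ) ≤ K := by
    by_contra hc
    push Not at hc
    have : K * Y ^ (2/3:ℝ) < Y ^ (1/3:ℝ) * Y ^ (2/3:ℝ) := ENNReal.mul_lt_mul_left hp0 hpt hc
    exact absurd h (not_le.2 (by rwa [← h1] at this))
  calc Y = (Y ^ (1/3:ℝ)) ^ (3:ℝ) := by rw [← ENNReal.rpow_mul]; norm_num
    _ ≤ _ := ENNReal.rpow_le_rpow h2 (by norm_num)

lemma GN_X_aux {ρ2 : ℝ} {f M : E3 → ℝ≥0∞} (hf : Measurable f) {K : ℝ≥0∞}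
    (hfM : ∀ᵐ x, ‖x‖ < ρ2 → f x ≤ M x)
    (hM : ∀ Φ : E3 → ℝ≥0∞, Measurable Φ → ∫⁻ x, Φ x * M x ≤ K * (∫⁻ x, Φ x ^ (3/2:ℝ)) ^ (2/3:ℝ)) :
    ∫⁻ x in ball 0 ρ2, f x ^ (3:ℝ) ≤ K ^ (3:ℝ) := by
  have step : ∀ n : ℕ, ∫⁻ x in ball 0 ρ2, (min (f x) n) ^ (3:ℝ) ≤ K ^ (3:ℝ) := by
    intro n
    set g : E3 → ℝ≥0∞ := fun x => min (f x) n with hg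
    have hgm : Measurable g := by fun_prop
    set Φ : E3 → ℝ≥0∞ := (ball 0 ρ2).indicator (fun x => g x ^ (2:ℝ)) with hΦ
    have hΦm : Measurable Φ := (hgm.pow_const _).indicator measurableSet_ball
    have e1 : ∫⁻ x, Φ x ^ (3/2:ℝ) = ∫⁻ x in ball 0 ρ2, g x ^ (3:ℝ) := by
      rw [← lintegral_indicator measurableSet_ball]
      refine lintegral_congr fun x => ?_
      by_cases hx : x ∈ ball (0:E3) ρ2
      · simp only [hΦ, indicator_of_mem hx]
        rw [← ENNReal.rpow_mul]; norm_num
      · simp [hΦ, indicator_of_notMem hx]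
    refine rpow_absorb ?_ ?_
    · refine ne_of_lt (lt_of_le_of_lt (lintegral_mono (g := fun _ => (n:ℝ≥0∞) ^ (3:ℝ)) fun x => ENNReal.rpow_le_rpow (min_le_right _ _) (by norm_num)) ?_)
      rw [lintegral_const]
      refine ENNReal.mul_lt_top ?_ ?_
      · exact ENNReal.rpow_lt_top_of_nonneg (by norm_num) (by simp)
      · rw [Measure.restrict_apply MeasurableSet.univ, univ_inter]; exact measure_ball_lt_top
    · rw [← e1]
      refine le_trans ?_ (hM Φ hΦm)
      rw [e1, ← lintegral_indicator measurableSet_ball]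
      refine lintegral_mono_ae ?_
      filter_upwards [hfM] with x hx
      by_cases hxB : x ∈ ball (0:E3) ρ2
      · simp only [hΦ, indicator_of_mem hxB]
        calc g x ^ (3:ℝ) = g x ^ (2:ℝ) * g x := by
              conv_rhs => rw [← ENNReal.rpow_one (g x), ← ENNReal.rpow_mul]
              rw [← ENNReal.rpow_add_of_nonneg _ _ (by norm_num) (by norm_num)]; norm_num
          _ ≤ _ := by
              gcongr
              exact (min_le_left _ _).trans (hx (by simpa using hxB))
      · simp [indicator_of_notMem hxB]
  have hlim : Tendsto (fun n : ℕ => ∫⁻ x in ball 0 ρ2, (min (f x) n) ^ (3:ℝ)) atTop (nhds (∫⁻ x in ball 0 ρ2, f x ^ (3:ℝ))) := by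
    refine lintegral_tendsto_of_tendsto_of_monotone (fun n => by fun_prop) ?_ ?_
    · refine Eventually.of_forall fun x => ?_
      intro m n hmn
      simp only
      gcongr
    · refine Eventually.of_forall fun x => ?_
      have : Tendsto (fun n : ℕ => min (f x) n) atTop (nhds (min (f x) ∞)) :=
        tendsto_const_nhds.min ENNReal.tendsto_nat_nhds_top
      rw [min_eq_left le_top] at this
      exact (ENNReal.continuous_rpow_const.tendsto _).comp this
  exact le_of_tendsto' hlim step

end

section

lemma pd_eq {φ : E3 → ℝ → ℝ} (h : Differentiable ℝ (fun z : E3 × ℝ => φ z.1 z.2)) (j : Fin 3) (x : E3) (t : ℝ) :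
    pd j (fun y => φ y t) x = fderiv ℝ (fun z : E3 × ℝ => φ z.1 z.2) (x, t) (EuclideanSpace.single j 1, 0) := by
  unfold pd
  have h1 : HasFDerivAt (fun y : E3 => (y, t)) (ContinuousLinearMap.inl ℝ E3 ℝ) x :=
    (hasFDerivAt_id x).prodMk (hasFDerivAt_const t x)
  have h2 := (h (x, t)).hasFDerivAt.comp x h1
  have : (fun y => φ y t) = (fun z : E3 × ℝ => φ z.1 z.2) ∘ (fun y : E3 => (y, t)) := rfl
  rw [this, h2.fderiv]
  simp

lemma E3_sum (e : E3) : e = ∑ j, e j • (EuclideanSpace.single j (1:ℝ) : E3) := by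
  ext i
  simp [Finset.sum_apply, Pi.single_apply]

lemma test_shift {φ : E3 → ℝ → ℝ} (h1 : ContDiff ℝ (⊤ : ℕ∞) (fun z : E3 × ℝ => φ z.1 z.2))
    (h2 : HasCompactSupport (fun z : E3 × ℝ => φ z.1 z.2)) {e : E3}
    (h3 : tsupport (fun z : E3 × ℝ => φ z.1 z.2) ⊆ {z | z.1 ∈ ball (0:E3) 1 ∧ z.1 + e ∈ ball (0:E3) 1 ∧ z.2 ∈ Ioo (-(1^2):ℝ) 0})
    {τ : ℝ} (hτ : τ ∈ Icc (0:ℝ) 1) : IsTest 1 (fun x t => φ (x - τ • e) t) := by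
  have hc : ContDiff ℝ (⊤ : ℕ∞) (fun z : E3 × ℝ => (z.1 - τ • e, z.2)) := by fun_prop
  set Θ : E3 × ℝ ≃ₜ E3 × ℝ := Homeomorph.addRight ((-(τ • e), 0) : E3 × ℝ) with hΘ
  have hΘe : (fun z : E3 × ℝ => φ (z.1 - τ • e) z.2) = (fun z : E3 × ℝ => φ z.1 z.2) ∘ Θ := by
    ext z; simp [hΘ, sub_eq_add_neg]
  refine ⟨h1.comp hc, ?_, ?_⟩
  · rw [hΘe]
    exact h2.comp_homeomorph Θ
  · rw [hΘe, tsupport_comp_eq_preimage]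
    intro z hz
    obtain ⟨k1, k2, k3⟩ := h3 hz
    have e1 : (Θ z).1 = z.1 - τ • e := by simp [hΘ, sub_eq_add_neg]
    have e2 : (Θ z).2 = z.2 := by simp [hΘ]
    rw [e1] at k1 k2
    rw [e2] at k3
    refine ⟨?_, k3⟩
    have := (convex_ball (0:E3) 1) k1 k2 (sub_nonneg.2 hτ.2) hτ.1 (by ring)
    convert this using 1
    module

lemma diff_id {w : E3 × ℝ → ℝ} {g : Fin 3 → E3 × ℝ → ℝ} (hw : Integrable w) (hg : ∀ j, Integrable (g j))
    (hid : ∀ φ : E3 → ℝ → ℝ, IsTest 1 φ → ∀ j, ∫ z : E3 × ℝ, w z * pd j (fun y => φ y z.2) z.1 = - ∫ z : E3 × ℝ, g j z * φ z.1 z.2)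
    (e : E3) : ∀ᵐ z : E3 × ℝ, z.1 ∈ ball (0:E3) 1 → z.1 + e ∈ ball (0:E3) 1 → z.2 ∈ Ioo (-(1^2):ℝ) 0 →
      w (z.1 + e, z.2) - w z = ∫ τ in Icc (0:ℝ) 1, ∑ j, e j * g j (z.1 + τ • e, z.2) := by
  set G : E3 × ℝ → ℝ := fun z => ∑ j, e j * g j z with hG
  have hGi : Integrable G := integrable_finsetSum _ fun j _ => (hg j).const_mul _
  set U : Set (E3 × ℝ) := {z | z.1 ∈ ball (0:E3) 1 ∧ z.1 + e ∈ ball (0:E3) 1 ∧ z.2 ∈ Ioo (-(1^2):ℝ) 0} with hU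
  have hUo : IsOpen U := by
    refine IsOpen.inter (isOpen_ball.preimage continuous_fst) (IsOpen.inter (isOpen_ball.preimage (by fun_prop)) (isOpen_Ioo.preimage continuous_snd))
  -- translation
  have hvol : (volume : Measure (E3 × ℝ)) = (volume : Measure E3).prod (volume : Measure ℝ) := rfl
  let sh : ℝ → E3 × ℝ → E3 × ℝ := fun τ z => z + (τ • e, 0)
  have shmp : ∀ τ, MeasurePreserving (sh τ) volume volume := fun τ => by
    have h := (measurePreserving_add_right (volume : Measure E3) (τ • e)).prod (measurePreserving_add_right (volume : Measure ℝ) 0)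
    exact h
  have she : ∀ τ, MeasurableEmbedding (sh τ) := fun τ => measurableEmbedding_addRight _
  -- joint integrability
  have hjm : Integrable (fun q : ℝ × (E3 × ℝ) => G (sh q.1 q.2)) ((volume.restrict (Icc (0:ℝ) 1)).prod volume) := by
    have hmp : MeasurePreserving (fun q : ℝ × (E3 × ℝ) => (q.1, sh q.1 q.2)) ((volume.restrict (Icc (0:ℝ) 1)).prod volume) ((volume.restrict (Icc (0:ℝ) 1)).prod volume) := by
      refine MeasurePreserving.skew_product (f := id) (g := fun τ z => sh τ z) (MeasurePreserving.id _) ?_ ?_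
      · show Measurable (fun q : ℝ × (E3 × ℝ) => q.2 + (q.1 • e, (0:ℝ)))
        fun_prop
      · exact Eventually.of_forall fun τ => (shmp τ).map_eq
    have h2 : Integrable (fun q : ℝ × (E3 × ℝ) => G q.2) ((volume.restrict (Icc (0:ℝ) 1)).prod volume) := hGi.comp_snd _
    exact hmp.integrable_comp_of_integrable h2
  have hHi : Integrable (fun z : E3 × ℝ => w (sh 1 z) - w z - ∫ τ in Icc (0:ℝ) 1, G (sh τ z)) := by
    refine (Integrable.sub ((shmp 1).integrable_comp_of_integrable hw) hw).sub ?_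
    exact hjm.integral_prod_right
  have key := hUo.ae_eq_zero_of_integral_contDiff_smul_eq_zero (μ := volume) (f := fun z : E3 × ℝ => w (sh 1 z) - w z - ∫ τ in Icc (0:ℝ) 1, G (sh τ z)) hHi.integrableOn.locallyIntegrableOn ?_
  · filter_upwards [key] with z hz h1 h2 h3
    have := hz ⟨h1, h2, h3⟩
    have e1 : ∀ τ : ℝ, sh τ z = (z.1 + τ • e, z.2) := by intro τ; simp [sh, Prod.ext_iff]
    simp only [e1, one_smul] at this
    linarith
  · intro ψ hψ1 hψ2 hψ3
    have hψc : Continuous ψ := hψ1.continuous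
    have hDc : Continuous (fderiv ℝ ψ) := hψ1.continuous_fderiv (by simp)
    have hψ1' : ContDiff ℝ (⊤ : ℕ∞) (fun z : E3 × ℝ => (fun x t => ψ (x, t)) z.1 z.2) := hψ1
    have hψd : Differentiable ℝ ψ := hψ1.differentiable (by simp)
    obtain ⟨Cψ, hCψ⟩ := hψ2.exists_bound_of_continuous hψc
    obtain ⟨CD, hCD⟩ := (hψ2.fderiv (𝕜 := ℝ)).exists_bound_of_continuous hDc
    have shm : ∀ τ : ℝ, ∀ z : E3 × ℝ, sh (-τ) z = (z.1 - τ • e, z.2) := by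
      intro τ z; simp [sh, Prod.ext_iff, sub_eq_add_neg]
    -- weak identity for each τ
    have step1 : ∀ τ ∈ Icc (0:ℝ) 1, ∫ z, w z * fderiv ℝ ψ (sh (-τ) z) (-e, 0) = ∫ z, G z * ψ (sh (-τ) z) := by
      intro τ hτ
      have hT := test_shift (φ := fun x t => ψ (x, t)) hψ1' hψ2 (e := e) hψ3 hτ
      have hdT : Differentiable ℝ (fun z : E3 × ℝ => ψ (z.1 - τ • e, z.2)) := hT.1.differentiable (by simp)
      have hj : ∀ j, ∫ z, w z * fderiv ℝ ψ (sh (-τ) z) (EuclideanSpace.single j 1, 0) = - ∫ z, g j z * ψ (sh (-τ) z) := by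
        intro j
        have := hid _ hT j
        simp only [pd_eq (φ := fun x t => ψ (x - τ • e, t)) hdT] at this
        simp only [shm]
        rw [← this]
        refine integral_congr_ae (Eventually.of_forall fun z => ?_)
        simp only
        congr 1
        have h1 : HasFDerivAt (fun z : E3 × ℝ => (z.1 - τ • e, z.2)) (ContinuousLinearMap.id ℝ (E3 × ℝ)) z := by
          have := ((hasFDerivAt_id (𝕜 := ℝ) z).sub_const ((τ • e, 0) : E3 × ℝ))
          refine this.congr_of_eventuallyEq (Eventually.of_forall fun y => ?_)
          simp [Prod.ext_iff]
        have h2 := (hψd (z.1 - τ • e, z.2)).hasFDerivAt.comp z h1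
        have h3 : fderiv ℝ (fun z : E3 × ℝ => ψ (z.1 - τ • e, z.2)) z = fderiv ℝ ψ (z.1 - τ • e, z.2) := by
          have := h2.fderiv
          rw [ContinuousLinearMap.comp_id] at this
          exact this
        rw [h3]
      have hinteg : ∀ j, Integrable (fun z => e j * (w z * fderiv ℝ ψ (sh (-τ) z) (EuclideanSpace.single j 1, 0))) := by
        intro j
        refine Integrable.const_mul ?_ _
        refine hw.mul_bdd (c := CD * ‖((EuclideanSpace.single j 1, 0) : E3 × ℝ)‖) ?_ ?_
        · refine Continuous.aestronglyMeasurable ?_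
          have : Continuous (sh (-τ)) := by simp only [sh]; fun_prop
          fun_prop
        · refine Eventually.of_forall fun z => ?_
          exact (ContinuousLinearMap.le_opNorm _ _).trans (by gcongr; exact hCD _)
      have hinteg2 : ∀ j, Integrable (fun z => e j * (g j z * ψ (sh (-τ) z))) := by
        intro j
        refine Integrable.const_mul ?_ _
        refine (hg j).mul_bdd (c := Cψ) ?_ ?_
        · refine Continuous.aestronglyMeasurable ?_
          have : Continuous (sh (-τ)) := by simp only [sh]; fun_prop
          fun_prop
        · exact Eventually.of_forall fun z => hCψ _
      have eL : ∀ z, w z * fderiv ℝ ψ (sh (-τ) z) (-e, 0) = - ∑ j, e j * (w z * fderiv ℝ ψ (sh (-τ) z) (EuclideanSpace.single j 1, 0)) := by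
        intro z
        have : ((-e, 0) : E3 × ℝ) = - ∑ j, e j • ((EuclideanSpace.single j 1, 0) : E3 × ℝ) := by
          have := E3_sum e
          rw [Prod.ext_iff]
          constructor
          · simp only [Prod.fst_neg, Prod.fst_sum, Prod.smul_fst]; rw [← this]
          · simp [Prod.snd_sum]
        rw [this, map_neg, map_sum]
        simp only [map_smul, smul_eq_mul, mul_neg, Finset.mul_sum]
        congr 1
        refine Finset.sum_congr rfl fun j _ => by ring
      have eR : ∀ z, G z * ψ (sh (-τ) z) = ∑ j, e j * (g j z * ψ (sh (-τ) z)) := by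
        intro z
        simp only [hG, Finset.sum_mul]
        refine Finset.sum_congr rfl fun j _ => by ring
      simp_rw [eL, eR]
      rw [integral_neg, integral_finsetSum _ fun j _ => hinteg j, integral_finsetSum _ fun j _ => hinteg2 j, ← Finset.sum_neg_distrib]
      refine Finset.sum_congr rfl fun j _ => ?_
      rw [integral_const_mul, integral_const_mul, hj j]
      ring
    -- integrate in τ
    have step2 : ∫ z, w z * (ψ (sh (-1) z) - ψ z) = ∫ τ in Icc (0:ℝ) 1, ∫ z, w z * fderiv ℝ ψ (sh (-τ) z) (-e, 0) := by
      rw [integral_integral_swap]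
      · refine integral_congr_ae (Eventually.of_forall fun z => ?_)
        simp only
        rw [integral_const_mul]
        congr 1
        have hd : ∀ τ ∈ uIcc (0:ℝ) 1, HasDerivAt (fun τ : ℝ => ψ (sh (-τ) z)) (fderiv ℝ ψ (sh (-τ) z) (-e, 0)) τ := by
          intro τ _
          have h1 : HasDerivAt (fun τ : ℝ => sh (-τ) z) (-e, 0) τ := by
            have h0 : HasDerivAt (fun τ : ℝ => z.1 + (-τ) • e) (-e) τ := by
              have := ((hasDerivAt_id τ).neg.smul_const e).const_add z.1
              simpa using this
            have := h0.prodMk (hasDerivAt_const τ z.2)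
            refine this.congr_of_eventuallyEq (Eventually.of_forall fun y => ?_)
            simp [sh, Prod.ext_iff]
          exact (hψd (sh (-τ) z)).hasFDerivAt.comp_hasDerivAt τ h1
        have hcont : Continuous (fun τ : ℝ => fderiv ℝ ψ (sh (-τ) z) (-e, 0)) := by
          have : Continuous (fun τ : ℝ => sh (-τ) z) := by simp only [sh]; fun_prop
          fun_prop
        have := intervalIntegral.integral_eq_sub_of_hasDerivAt hd (hcont.intervalIntegrable 0 1)
        rw [intervalIntegral.integral_of_le zero_le_one, ← integral_Icc_eq_integral_Ioc] at this
        rw [this]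
        simp [sh]
        congr 1
        simp [Prod.ext_iff]
      · have h2 : Integrable (fun q : ℝ × (E3 × ℝ) => w q.2) ((volume.restrict (Icc (0:ℝ) 1)).prod volume) := hw.comp_snd _
        refine h2.mul_bdd (c := CD * ‖((-e, 0) : E3 × ℝ)‖) ?_ ?_
        · refine Continuous.aestronglyMeasurable ?_
          have : Continuous (fun q : ℝ × (E3 × ℝ) => sh (-q.1) q.2) := by simp only [sh]; fun_prop
          fun_prop
        · refine Eventually.of_forall fun z => ?_
          exact (ContinuousLinearMap.le_opNorm _ _).trans (by gcongr; exact hCD _)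
    have trans : ∀ τ (F : E3 × ℝ → ℝ), ∫ z, F z * ψ (sh (-τ) z) = ∫ z, ψ z * F (sh τ z) := by
      intro τ F
      rw [← (shmp τ).integral_comp (she τ)]
      refine integral_congr_ae (Eventually.of_forall fun z => ?_)
      simp only
      rw [mul_comm]
      congr 2
      simp [sh, Prod.ext_iff]
    have step3 : ∫ τ in Icc (0:ℝ) 1, ∫ z, w z * fderiv ℝ ψ (sh (-τ) z) (-e, 0) = ∫ z, ψ z * ∫ τ in Icc (0:ℝ) 1, G (sh τ z) := by
      rw [setIntegral_congr_fun measurableSet_Icc step1]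
      simp only [trans]
      rw [integral_integral_swap]
      · refine integral_congr_ae (Eventually.of_forall fun z => ?_)
        simp only
        rw [integral_const_mul]
      · exact hjm.bdd_mul (c := Cψ) (by fun_prop) (Eventually.of_forall fun z => hCψ _)
    have b1 : Integrable (fun z => ψ z * w (sh 1 z)) :=
      ((shmp 1).integrable_comp_of_integrable hw).bdd_mul (c := Cψ) (by fun_prop) (Eventually.of_forall fun z => hCψ _)
    have b2 : Integrable (fun z => ψ z * w z) := hw.bdd_mul (c := Cψ) (by fun_prop) (Eventually.of_forall fun z => hCψ _)
    have b3 : Integrable (fun z => ψ z * ∫ τ in Icc (0:ℝ) 1, G (sh τ z)) := hjm.integral_prod_right.bdd_mul (c := Cψ) (by fun_prop) (Eventually.of_forall fun z => hCψ _)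
    have b4 : Integrable (fun z => w z * ψ (sh (-1) z)) := by
      refine hw.mul_bdd (c := Cψ) ?_ (Eventually.of_forall fun z => hCψ _)
      refine Continuous.aestronglyMeasurable ?_
      have : Continuous (sh (-1)) := by simp only [sh]; fun_prop
      fun_prop
    have b5 : Integrable (fun z => w z * ψ z) := by simpa only [mul_comm] using b2
    simp only [smul_eq_mul, mul_sub]
    have q1 := integral_sub (b1.sub b2) b3
    simp only [Pi.sub_apply] at q1
    rw [q1, integral_sub b1 b2, ← step3, ← step2]
    simp only [mul_sub]
    rw [integral_sub b4 b5, trans 1 w]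
    simp only [mul_comm (w _)]
    ring

end

section

abbrev B1 : Set E3 := ball (0:E3) 1
abbrev T1 : Set ℝ := Ioo (-(1^2):ℝ) 0
abbrev Q1 : Set (E3 × ℝ) := B1 ×ˢ T1
def Gr (g : Fin 3 → Fin 3 → ℝ) : ℝ≥0∞ := ENNReal.ofReal (∑ i : Fin 3, ∑ j : Fin 3, (g i j) ^ 2)

lemma Q1_meas : MeasurableSet Q1 := measurableSet_ball.prod measurableSet_Ioo

lemma Q1_vol : (volume : Measure (E3 × ℝ)).restrict Q1 = (volume.restrict B1).prod (volume.restrict T1) :=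
  (Measure.prod_restrict _ _).symm

instance : IsFiniteMeasure (volume.restrict B1 : Measure E3) := ⟨by
  simp⟩
instance : IsFiniteMeasure (volume.restrict T1 : Measure ℝ) := ⟨by simp⟩
instance : IsFiniteMeasure ((volume : Measure (E3 × ℝ)).restrict Q1) := by rw [Q1_vol]; infer_instance

lemma lint_iterQ {F : E3 × ℝ → ℝ≥0∞} (hF : Measurable F) :
    ∫⁻ t in T1, ∫⁻ x in B1, F (x, t) = ∫⁻ z in Q1, F z := by
  rw [Q1_vol, lintegral_prod_symm _ hF.aemeasurable]

lemma iterQ' {F : E3 × ℝ → ℝ} (hF : Integrable F (volume.restrict Q1)) :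
    ∫ t in T1, ∫ x in B1, F (x, t) = ∫ z in Q1, F z := by
  rw [Q1_vol] at hF ⊢
  rw [integral_prod_symm _ hF]

lemma iterQ {F : E3 × ℝ → ℝ} (hF : Integrable F (volume.restrict Q1)) :
    ∫ t in T1, ∫ x in B1, F (x, t) = ∫ z, Q1.indicator F z := by
  rw [iterQ' hF, integral_indicator Q1_meas]

lemma intQ {F : E3 × ℝ → ℝ} {r : ℝ} (hF : Measurable F) (hr : 1 ≤ r) (h : ∫⁻ z in Q1, ‖F z‖ₑ ^ r < ∞) :
    Integrable F (volume.restrict Q1) := by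
  have : MemLp F (ENNReal.ofReal r) (volume.restrict Q1) := by
    refine ⟨hF.aestronglyMeasurable, ?_⟩
    rw [eLpNorm_lt_top_iff_lintegral_rpow_enorm_lt_top (by simp; linarith) (by simp)]
    rwa [ENNReal.toReal_ofReal (by linarith)]
  exact this.integrable (by simpa using hr)

lemma ae_swap {p : E3 → ℝ → Prop} (h : ∀ᵐ z : E3 × ℝ, p z.1 z.2) : ∀ᵐ t : ℝ, ∀ᵐ x : E3, p x t := by
  have h2 : ∀ᵐ z : ℝ × E3, p z.2 z.1 := by
    have : Measure.QuasiMeasurePreserving (Prod.swap : ℝ × E3 → E3 × ℝ) (volume.prod volume) (volume.prod volume) :=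
      (Measure.measurePreserving_swap).quasiMeasurePreserving
    exact this.ae h
  exact Measure.ae_ae_of_ae_prod h2

lemma enorm_coord_le (v : E3) (i : Fin 3) : ‖v i‖ₑ ≤ ‖v‖ₑ := by
  rw [← ofReal_norm, ← ofReal_norm]
  exact ENNReal.ofReal_le_ofReal (PiLp.norm_apply_le v i)

lemma sq_le_Gr (g : Fin 3 → Fin 3 → ℝ) (i j : Fin 3) : ‖g i j‖ₑ ^ (2:ℝ) ≤ Gr g := by
  unfold Gr
  rw [← ofReal_norm, ENNReal.ofReal_rpow_of_nonneg (by positivity) (by norm_num)]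
  refine ENNReal.ofReal_le_ofReal ?_
  have h1 : ∑ j, g i j ^ 2 ≤ ∑ i, ∑ j, g i j ^ 2 :=
    Finset.single_le_sum (f := fun i => ∑ j, g i j ^ 2) (fun i _ => by positivity) (Finset.mem_univ i)
  have h2 : g i j ^ 2 ≤ ∑ j, g i j ^ 2 :=
    Finset.single_le_sum (f := fun j => g i j ^ 2) (fun i _ => by positivity) (Finset.mem_univ j)
  have : ‖g i j‖ ^ (2:ℝ) = g i j ^ 2 := by
    rw [Real.rpow_two, Real.norm_eq_abs, sq_abs]
  linarith

section sol
variable {u : E3 → ℝ → E3} {P : E3 → ℝ → ℝ}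

lemma u_meas (sol : SuitableWeakSolution 1 u P) : Measurable (fun z : E3 × ℝ => u z.1 z.2) := sol.meas_u
lemma gu_meas (sol : SuitableWeakSolution 1 u P) : Measurable (fun z : E3 × ℝ => sol.gu z.1 z.2) := sol.meas_gu
lemma P_meas (sol : SuitableWeakSolution 1 u P) : Measurable (fun z : E3 × ℝ => P z.1 z.2) := sol.meas_press
lemma coord_meas (i : Fin 3) : Measurable (fun v : E3 => v i) := by fun_prop
lemma ui_meas (sol : SuitableWeakSolution 1 u P) (i : Fin 3) : Measurable (fun z : E3 × ℝ => u z.1 z.2 i) := (coord_meas i).comp (u_meas sol)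
lemma gij_meas (sol : SuitableWeakSolution 1 u P) (i j : Fin 3) : Measurable (fun z : E3 × ℝ => sol.gu z.1 z.2 i j) :=
  (measurable_pi_apply j).comp ((measurable_pi_apply i).comp (gu_meas sol))
lemma Gr_meas : Measurable Gr := by unfold Gr; fun_prop

lemma u_L2 (sol : SuitableWeakSolution 1 u P) : ∫⁻ z in Q1, ‖u z.1 z.2‖ₑ ^ (2:ℝ) < ∞ := by
  have hu := u_meas sol
  rw [← lint_iterQ (F := fun z => ‖u z.1 z.2‖ₑ ^ (2:ℝ)) (by fun_prop)]
  have h := sol.bdd_L2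
  have h2 : ∀ᵐ t ∂(volume.restrict T1), ∫⁻ x in B1, ‖u x t‖ₑ ^ (2:ℝ) ≤ essSup (fun t => ∫⁻ x in ball (0 : E3) 1, ((‖u x t‖₊ : ℝ≥0∞)) ^ 2)
      (volume.restrict (Ioo (-(1^2)) 0)) := by
    filter_upwards [ENNReal.ae_le_essSup (fun t => ∫⁻ x in ball (0 : E3) 1, ((‖u x t‖₊ : ℝ≥0∞)) ^ 2) (μ := volume.restrict (Ioo (-(1^2):ℝ) 0))] with t ht
    refine le_trans (le_of_eq ?_) ht
    simp only [ENNReal.rpow_two]; rfl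
  refine lt_of_le_of_lt (lintegral_mono_ae h2) ?_
  rw [lintegral_const]
  exact ENNReal.mul_lt_top h (measure_lt_top _ _)

lemma ui_int (sol : SuitableWeakSolution 1 u P) (i : Fin 3) : Integrable (fun z : E3 × ℝ => u z.1 z.2 i) (volume.restrict Q1) := by
  refine intQ (ui_meas sol i) (r := 2) (by norm_num) (lt_of_le_of_lt (lintegral_mono fun z => ?_) (u_L2 sol))
  exact ENNReal.rpow_le_rpow (enorm_coord_le _ _) (by norm_num)

lemma uij_int (sol : SuitableWeakSolution 1 u P) (i j : Fin 3) : Integrable (fun z : E3 × ℝ => u z.1 z.2 i * u z.1 z.2 j) (volume.restrict Q1) := by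
  refine intQ ((ui_meas sol i).mul (ui_meas sol j)) (r := 1) (by norm_num) (lt_of_le_of_lt (lintegral_mono fun z => ?_) (u_L2 sol))
  rw [ENNReal.rpow_one, ENNReal.rpow_two, sq, enorm_mul]
  exact mul_le_mul' (enorm_coord_le _ _) (enorm_coord_le _ _)

lemma g_L2 (sol : SuitableWeakSolution 1 u P) : ∫⁻ z in Q1, Gr (sol.gu z.1 z.2) < ∞ := by
  have := gu_meas sol
  rw [← lint_iterQ (F := fun z => Gr (sol.gu z.1 z.2)) (Gr_meas.comp this)]
  exact sol.grad_L2

lemma gij_int (sol : SuitableWeakSolution 1 u P) (i j : Fin 3) : Integrable (fun z : E3 × ℝ => sol.gu z.1 z.2 i j) (volume.restrict Q1) := by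
  refine intQ (gij_meas sol i j) (r := 2) (by norm_num) (lt_of_le_of_lt (lintegral_mono fun z => sq_le_Gr _ i j) (g_L2 sol))

lemma P_L32 (sol : SuitableWeakSolution 1 u P) : ∫⁻ z in Q1, ‖P z.1 z.2‖ₑ ^ (3/2:ℝ) < ∞ := by
  have hu := P_meas sol
  rw [← lint_iterQ (F := fun z => ‖P z.1 z.2‖ₑ ^ (3/2:ℝ)) (by fun_prop)]
  have := sol.press_L32
  simpa only [← ofReal_norm, Real.norm_eq_abs] using this

lemma P_int (sol : SuitableWeakSolution 1 u P) : Integrable (fun z : E3 × ℝ => P z.1 z.2) (volume.restrict Q1) :=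
  intQ (P_meas sol) (r := 3/2) (by norm_num) (P_L32 sol)

lemma test_bdd {f : E3 × ℝ → ℝ} (h : Continuous f) (hc : HasCompactSupport f) {F : E3 × ℝ → ℝ}
    (hF : Integrable F (volume.restrict Q1)) : Integrable (fun z => F z * f z) (volume.restrict Q1) := by
  obtain ⟨C, hC⟩ := hc.exists_bound_of_continuous h
  exact hF.mul_bdd (c := C) h.aestronglyMeasurable (Eventually.of_forall hC)

lemma pd_fun {φ : E3 → ℝ → ℝ} (h : ContDiff ℝ (⊤ : ℕ∞) (fun z : E3 × ℝ => φ z.1 z.2)) (j : Fin 3) :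
    (fun z : E3 × ℝ => pd j (fun y => φ y z.2) z.1) = fun z => fderiv ℝ (fun z : E3 × ℝ => φ z.1 z.2) z (EuclideanSpace.single j 1, 0) := by
  ext z
  exact pd_eq (h.differentiable (by simp)) j z.1 z.2

lemma diff_u (sol : SuitableWeakSolution 1 u P) (i : Fin 3) (e : E3) :
    ∀ᵐ z : E3 × ℝ, z.1 ∈ B1 → z.1 + e ∈ B1 → z.2 ∈ T1 →
      u (z.1 + e) z.2 i - u z.1 z.2 i = ∫ τ in Icc (0:ℝ) 1, ∑ j, e j * Q1.indicator (fun z => sol.gu z.1 z.2 i j) (z.1 + τ • e, z.2) := by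
  have := diff_id (w := Q1.indicator (fun z => u z.1 z.2 i)) (g := fun j => Q1.indicator (fun z => sol.gu z.1 z.2 i j))
    ((integrable_indicator_iff Q1_meas).2 (ui_int sol i)) (fun j => (integrable_indicator_iff Q1_meas).2 (gij_int sol i j)) ?_ e
  · filter_upwards [this] with z hz h1 h2 h3
    rw [← hz h1 h2 h3, indicator_of_mem (show (z.1 + e, z.2) ∈ Q1 from ⟨h2, h3⟩), indicator_of_mem (show z ∈ Q1 from ⟨h1, h3⟩)]
  · intro φ hφ j
    have h := sol.is_grad φ hφ i j
    have h1 := hφ.1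
    have c1 : Continuous (fun z : E3 × ℝ => pd j (fun y => φ y z.2) z.1) := by
      rw [pd_fun h1]
      have := h1.continuous_fderiv (by simp)
      fun_prop
    have c2 : HasCompactSupport (fun z : E3 × ℝ => pd j (fun y => φ y z.2) z.1) := by
      rw [pd_fun h1]
      exact hφ.2.1.fderiv_apply (𝕜 := ℝ) _
    have e1 := iterQ (test_bdd c1 c2 (ui_int sol i))
    have e2 := iterQ (test_bdd h1.continuous hφ.2.1 (gij_int sol i j))
    simp only at e1 e2
    rw [e1, e2] at h
    simp only [indicator_mul_left] at h
    exact h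
end sol

end

section

lemma sq_lint_le {F : ℝ → ℝ≥0∞} (hF : Measurable F) :
    (∫⁻ τ in Icc (0:ℝ) 1, F τ) ^ (2:ℝ) ≤ ∫⁻ τ in Icc (0:ℝ) 1, F τ ^ (2:ℝ) := by
  have h := ENNReal.lintegral_mul_le_Lp_mul_Lq (volume.restrict (Icc (0:ℝ) 1)) (p := 2) (q := 2) (by constructor <;> norm_num) hF.aemeasurable (aemeasurable_const (b := (1:ℝ≥0∞)))
  simp only [Pi.mul_apply, mul_one, ENNReal.one_rpow, lintegral_const, one_mul, Measure.restrict_apply MeasurableSet.univ, univ_inter, Real.volume_Icc, sub_zero, ENNReal.ofReal_one] at h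
  calc _ ≤ ((∫⁻ τ in Icc (0:ℝ) 1, F τ ^ (2:ℝ)) ^ (1/2:ℝ)) ^ (2:ℝ) := ENNReal.rpow_le_rpow h (by norm_num)
    _ = _ := by rw [← ENNReal.rpow_mul]; norm_num

lemma enorm_sq_E3 (v : E3) : ‖v‖ₑ ^ (2:ℝ) = ENNReal.ofReal (∑ i, v i ^ 2) := by
  rw [← ofReal_norm, ENNReal.ofReal_rpow_of_nonneg (by positivity) (by norm_num), Real.rpow_two, EuclideanSpace.norm_sq_eq]
  simp

lemma cs_Gr (e : E3) (g : Fin 3 → Fin 3 → ℝ) : ∑ i, ‖∑ j, e j * g i j‖ₑ ^ (2:ℝ) ≤ ‖e‖ₑ ^ (2:ℝ) * Gr g := by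
  rw [enorm_sq_E3, Gr, ← ENNReal.ofReal_mul (by positivity)]
  have : ∀ i, ‖∑ j, e j * g i j‖ₑ ^ (2:ℝ) = ENNReal.ofReal ((∑ j, e j * g i j) ^ 2) := by
    intro i
    rw [← ofReal_norm, ENNReal.ofReal_rpow_of_nonneg (by positivity) (by norm_num), Real.rpow_two, Real.norm_eq_abs, sq_abs]
  simp only [this]
  rw [← ENNReal.ofReal_sum_of_nonneg (fun i _ => by positivity)]
  refine ENNReal.ofReal_le_ofReal ?_
  rw [Finset.mul_sum]
  exact Finset.sum_le_sum fun i _ => Finset.sum_mul_sq_le_sq_mul_sq _ _ _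

variable {u : E3 → ℝ → E3} {P : E3 → ℝ → ℝ}

def GrI (sol : SuitableWeakSolution 1 u P) (x : E3) (t : ℝ) : ℝ≥0∞ := Q1.indicator (fun z => Gr (sol.gu z.1 z.2)) (x, t)

lemma GrI_meas (sol : SuitableWeakSolution 1 u P) : Measurable (fun z : E3 × ℝ => GrI sol z.1 z.2) :=
  Measurable.indicator (Gr_meas.comp (gu_meas sol)) Q1_meas

attribute [irreducible] GrI

lemma GrI_comp (sol : SuitableWeakSolution 1 u P) {X : Type*} [MeasurableSpace X] {a : X → E3} {b : X → ℝ} (ha : Measurable a) (hb : Measurable b) :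
    Measurable (fun x => GrI sol (a x) (b x)) :=
  Measurable.comp (g := fun z : E3 × ℝ => GrI sol z.1 z.2) (f := fun x => (a x, b x)) (GrI_meas sol) (ha.prodMk hb)
lemma u_comp (sol : SuitableWeakSolution 1 u P) {X : Type*} [MeasurableSpace X] {a : X → E3} {b : X → ℝ} (ha : Measurable a) (hb : Measurable b) :
    Measurable (fun x => u (a x) (b x)) := (u_meas sol).comp (ha.prodMk hb)

lemma diff_u2 (sol : SuitableWeakSolution 1 u P) (e : E3) :
    ∀ᵐ z : E3 × ℝ, z.1 ∈ B1 → z.1 + e ∈ B1 → z.2 ∈ T1 →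
      ‖u (z.1 + e) z.2 - u z.1 z.2‖ₑ ^ (2:ℝ) ≤ ‖e‖ₑ ^ (2:ℝ) * ∫⁻ τ in Icc (0:ℝ) 1, GrI sol (z.1 + τ • e) z.2 := by
  have h := ae_all_iff.2 fun i => diff_u sol i e
  filter_upwards [h] with z hz h1 h2 h3
  have hgm : ∀ i j, Measurable (fun τ : ℝ => Q1.indicator (fun z => sol.gu z.1 z.2 i j) (z.1 + τ • e, z.2)) := by
    intro i j
    exact (Measurable.indicator (gij_meas sol i j) Q1_meas).comp (by fun_prop)
  calc ‖u (z.1 + e) z.2 - u z.1 z.2‖ₑ ^ (2:ℝ) = ∑ i, ‖u (z.1 + e) z.2 i - u z.1 z.2 i‖ₑ ^ (2:ℝ) := by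
        rw [enorm_sq_E3, ENNReal.ofReal_sum_of_nonneg (fun i _ => by positivity)]
        refine Finset.sum_congr rfl fun i _ => ?_
        rw [← ofReal_norm, ENNReal.ofReal_rpow_of_nonneg (by positivity) (by norm_num), Real.rpow_two, Real.norm_eq_abs, sq_abs]
        simp
    _ ≤ ∑ i, ∫⁻ τ in Icc (0:ℝ) 1, ‖∑ j, e j * Q1.indicator (fun z => sol.gu z.1 z.2 i j) (z.1 + τ • e, z.2)‖ₑ ^ (2:ℝ) := by
        refine Finset.sum_le_sum fun i _ => ?_
        rw [hz i h1 h2 h3]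
        refine le_trans (ENNReal.rpow_le_rpow (enorm_integral_le_lintegral_enorm _) (by norm_num)) (sq_lint_le ?_)
        refine Measurable.enorm (Finset.measurable_fun_sum _ fun j _ => (hgm i j).const_mul _)
    _ = ∫⁻ τ in Icc (0:ℝ) 1, ∑ i, ‖∑ j, e j * Q1.indicator (fun z => sol.gu z.1 z.2 i j) (z.1 + τ • e, z.2)‖ₑ ^ (2:ℝ) := by
        rw [lintegral_finsetSum]
        intro i _
        refine Measurable.pow_const (Measurable.enorm (Finset.measurable_fun_sum _ fun j _ => (hgm i j).const_mul _)) _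
    _ ≤ ∫⁻ τ in Icc (0:ℝ) 1, ‖e‖ₑ ^ (2:ℝ) * GrI sol (z.1 + τ • e) z.2 := by
        refine lintegral_mono fun τ => ?_
        unfold GrI
        by_cases hq : (z.1 + τ • e, z.2) ∈ Q1
        · simp only [indicator_of_mem hq]
          exact cs_Gr e _
        · simp [indicator_of_notMem hq]
    _ = _ := by
        rw [lintegral_const_mul]
        exact GrI_comp sol (by fun_prop) (by fun_prop)

lemma diff_u3 (sol : SuitableWeakSolution 1 u P) :
    ∀ᵐ t : ℝ, t ∈ T1 → ∀ᵐ e : E3, ∀ᵐ x : E3, x ∈ B1 → x + e ∈ B1 →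
      ‖u (x + e) t - u x t‖ₑ ^ (2:ℝ) ≤ ‖e‖ₑ ^ (2:ℝ) * ∫⁻ τ in Icc (0:ℝ) 1, GrI sol (x + τ • e) t := by
  have h : ∀ᵐ e : E3, ∀ᵐ t : ℝ, t ∈ T1 → ∀ᵐ x : E3, x ∈ B1 → x + e ∈ B1 →
      ‖u (x + e) t - u x t‖ₑ ^ (2:ℝ) ≤ ‖e‖ₑ ^ (2:ℝ) * ∫⁻ τ in Icc (0:ℝ) 1, GrI sol (x + τ • e) t := by
    refine Eventually.of_forall fun e => ?_
    have := ae_swap (p := fun x t => x ∈ B1 → x + e ∈ B1 → t ∈ T1 →  ‖u (x + e) t - u x t‖ₑ ^ (2:ℝ) ≤ ‖e‖ₑ ^ (2:ℝ) * ∫⁻ τ in Icc (0:ℝ) 1, GrI sol (x + τ • e) t) (diff_u2 sol e)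
    filter_upwards [this] with t ht h1
    filter_upwards [ht] with x hx h2 h3 using hx h2 h3 h1
  -- bad set
  let F : (E3 × ℝ) × E3 → ℝ≥0∞ := fun q => B1.indicator 1 q.2 * B1.indicator 1 (q.2 + q.1.1) * T1.indicator 1 q.1.2 *
    (‖u (q.2 + q.1.1) q.1.2 - u q.2 q.1.2‖ₑ ^ (2:ℝ) - ‖q.1.1‖ₑ ^ (2:ℝ) * ∫⁻ τ in Icc (0:ℝ) 1, GrI sol (q.2 + τ • q.1.1) q.1.2)
  have hFm : Measurable F := by
    have m1 : Measurable (B1.indicator (1 : E3 → ℝ≥0∞)) := measurable_one.indicator measurableSet_ball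
    have m2 : Measurable (T1.indicator (1 : ℝ → ℝ≥0∞)) := measurable_one.indicator measurableSet_Ioo
    have m3 : Measurable (fun q : (E3 × ℝ) × E3 => ∫⁻ τ in Icc (0:ℝ) 1, GrI sol (q.2 + τ • q.1.1) q.1.2) := by
      refine Measurable.lintegral_prod_right' (f := fun r : ((E3 × ℝ) × E3) × ℝ => GrI sol (r.1.2 + r.2 • r.1.1.1) r.1.1.2) ?_
      exact GrI_comp sol (by fun_prop) (by fun_prop)
    have m4 : Measurable (fun q : (E3 × ℝ) × E3 => u (q.2 + q.1.1) q.1.2) :=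
u_comp sol (by fun_prop) (by fun_prop)
    have m5 : Measurable (fun q : (E3 × ℝ) × E3 => u q.2 q.1.2) :=
u_comp sol (by fun_prop) (by fun_prop)
    simp only [F]
    have m6 : Measurable (fun q : (E3 × ℝ) × E3 => T1.indicator (1 : ℝ → ℝ≥0∞) q.1.2) := m2.comp (by fun_prop)
    have m7 : Measurable (fun q : (E3 × ℝ) × E3 => ‖u (q.2 + q.1.1) q.1.2 - u q.2 q.1.2‖ₑ ^ (2:ℝ)) := ((m4.sub m5).enorm).pow_const _
    have m8 : Measurable (fun q : (E3 × ℝ) × E3 => B1.indicator (1 : E3 → ℝ≥0∞) q.2) := m1.comp (by fun_prop)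
    have m9 : Measurable (fun q : (E3 × ℝ) × E3 => B1.indicator (1 : E3 → ℝ≥0∞) (q.2 + q.1.1)) := m1.comp (by fun_prop)
    have m10 : Measurable (fun q : (E3 × ℝ) × E3 => ‖q.1.1‖ₑ ^ (2:ℝ)) := by fun_prop
    exact ((m8.mul m9).mul m6).mul (m7.sub (m10.mul m3))
  let H : E3 × ℝ → ℝ≥0∞ := fun q => ∫⁻ x, F (q, x)
  have hHm : Measurable H := hFm.lintegral_prod_right'
  have key : ∀ e t, H (e, t) = 0 ↔ (t ∈ T1 → ∀ᵐ x : E3, x ∈ B1 → x + e ∈ B1 →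
      ‖u (x + e) t - u x t‖ₑ ^ (2:ℝ) ≤ ‖e‖ₑ ^ (2:ℝ) * ∫⁻ τ in Icc (0:ℝ) 1, GrI sol (x + τ • e) t) := by
    intro e t
    simp only [H]
    rw [lintegral_eq_zero_iff (show Measurable (fun x => F ((e,t),x)) from hFm.comp measurable_prodMk_left)]
    by_cases ht : t ∈ T1
    · simp only [ht, true_imp_iff]
      refine Filter.eventually_congr (Eventually.of_forall fun x => ?_)
      simp only [F, Function.comp, indicator_of_mem ht, Pi.zero_apply]
      by_cases h1 : x ∈ B1 <;> by_cases h2 : x + e ∈ B1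
      · simp only [indicator_of_mem h1, indicator_of_mem h2, Pi.one_apply, one_mul, h1, h2, true_imp_iff]
        exact tsub_eq_zero_iff_le
      all_goals simp only [indicator_of_notMem, h1, h2, false_imp_iff, imp_true_iff, not_false_eq_true, zero_mul, mul_zero]
    · simp only [ht, false_imp_iff, iff_true]
      refine Eventually.of_forall fun x => ?_
      simp [F, indicator_of_notMem ht]
  have h' : ∀ᵐ e : E3, ∀ᵐ t : ℝ, H (e, t) = 0 := by
    filter_upwards [h] with e he
    filter_upwards [he] with t ht
    exact (key e t).2 ht
  have h2 : ∀ᵐ t : ℝ, ∀ᵐ e : E3, H (e, t) = 0 := by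
    rw [Measure.ae_ae_comm (p := fun t e => H (e, t) = 0)]
    · exact h'
    · exact (hHm.comp measurable_swap) (measurableSet_singleton 0)
  filter_upwards [h2] with t ht h1
  filter_upwards [ht] with e he
  exact (key e t).1 he h1

/-- (D) -/
lemma D_slice (sol : SuitableWeakSolution 1 u P) :
    ∀ᵐ t : ℝ, t ∈ T1 → ∀ ρ s : ℝ, ρ ≤ 1 → 0 < s →
      ∫⁻ x, QB1 ρ (fun x => u x t) s x ^ (2:ℝ) ≤ ENNReal.ofReal (2*s) ^ (2:ℝ) * (VB (2*s) * ∫⁻ x in ball 0 ρ, Gr (sol.gu x t)) := by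
  filter_upwards [diff_u3 sol] with t ht h1 ρ s hρ hs
  specialize ht h1
  have hv : Measurable (fun x => u x t) := u_comp sol (by fun_prop) (by fun_prop)
  have hGt : Measurable (fun x => GrI sol x t) := GrI_comp sol (by fun_prop) (by fun_prop)
  have mb : Measurable ((ball (0:E3) ρ).indicator (1 : E3 → ℝ≥0∞)) := measurable_one.indicator measurableSet_ball
  set A : E3 → ℝ≥0∞ := (ball (0:E3) ρ).indicator (1 : E3 → ℝ≥0∞) with hA
  have hsub : ball (0:E3) ρ ⊆ B1 := ball_subset_ball hρ
  calc ∫⁻ x, QB1 ρ (fun x => u x t) s x ^ (2:ℝ)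
      = ∫⁻ y, ∫⁻ z, A y * (A z * (kerB (2*s) y z * ‖u y t - u z t‖ₑ ^ (2:ℝ))) := by
        refine lintegral_congr fun y => ?_
        rw [QB1, ← ENNReal.rpow_mul]
        rw [show (1/2:ℝ) * 2 = 1 by norm_num, ENNReal.rpow_one]
        rw [QB, ← lintegral_const_mul]
        have m5 : Measurable (fun q : E3 => ‖u y t - u q t‖ₑ ^ (2:ℝ)) := ((measurable_const.sub hv).enorm).pow_const _
        exact mb.mul (((kerB_meas (2*s)).comp measurable_prodMk_left).mul m5)
    _ = ∫⁻ y, ∫⁻ e, A y * (A (y + e) * (kerB (2*s) y (y + e) * ‖u y t - u (y + e) t‖ₑ ^ (2:ℝ))) := by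
        refine lintegral_congr fun y => ?_
        exact (lintegral_add_left_eq_self (fun z => A y * (A z * (kerB (2*s) y z * ‖u y t - u z t‖ₑ ^ (2:ℝ)))) y).symm
    _ = ∫⁻ e, ∫⁻ y, A y * (A (y + e) * (kerB (2*s) y (y + e) * ‖u y t - u (y + e) t‖ₑ ^ (2:ℝ))) := by
        rw [lintegral_lintegral_swap]
        refine Measurable.aemeasurable ?_
        have m4 : Measurable (fun q : E3 × E3 => u (q.1 + q.2) t) := u_comp sol (by fun_prop) (by fun_prop)
        have m5 : Measurable (fun q : E3 × E3 => u q.1 t) := u_comp sol (by fun_prop) (by fun_prop)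
        simp only [Function.uncurry_def]
        fun_prop
    _ ≤ ∫⁻ e, (ball (0:E3) (2*s)).indicator 1 e * (ENNReal.ofReal (2*s) ^ (2:ℝ) * ∫⁻ x in ball 0 ρ, Gr (sol.gu x t)) := by
        refine lintegral_mono_ae ?_
        filter_upwards [ht] with e he
        by_cases hes : e ∈ ball (0:E3) (2*s)
        swap
        · refine le_trans (le_of_eq ?_) (zero_le)
          have : ∀ y : E3, kerB (2*s) y (y + e) = 0 := by
            intro y
            simp only [kerB, dist_self_add_right]
            rw [if_neg]
            simpa using hes
          simp [this]
        rw [indicator_of_mem hes, Pi.one_apply, one_mul]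
        have hes' : ‖e‖ₑ ^ (2:ℝ) ≤ ENNReal.ofReal (2*s) ^ (2:ℝ) := by
          refine ENNReal.rpow_le_rpow ?_ (by norm_num)
          rw [← ofReal_norm]
          refine ENNReal.ofReal_le_ofReal ?_
          simp at hes; exact hes.le
        calc ∫⁻ y, A y * (A (y + e) * (kerB (2*s) y (y + e) * ‖u y t - u (y + e) t‖ₑ ^ (2:ℝ)))
            ≤ ∫⁻ y, ‖e‖ₑ ^ (2:ℝ) * ∫⁻ τ in Icc (0:ℝ) 1, A (y + τ • e) * GrI sol (y + τ • e) t := by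
              refine lintegral_mono_ae ?_
              filter_upwards [he] with y hy
              by_cases k1 : y ∈ ball (0:E3) ρ
              swap
              · simp [hA, k1]
              by_cases k2 : y + e ∈ ball (0:E3) ρ
              swap
              · simp only [hA, indicator_of_notMem k2]; simp
              rw [hA, indicator_of_mem k1, indicator_of_mem k2, ← hA]
              have kb : kerB (2*s) y (y+e) ≤ 1 := by unfold kerB; split_ifs <;> simp
              simp only [Pi.one_apply, one_mul]
              refine (mul_le_of_le_one_left (zero_le) kb).trans ?_
              rw [← enorm_neg, neg_sub]
              refine (hy (hsub k1) (hsub k2)).trans ?_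
              refine mul_le_mul' le_rfl ?_
              refine setLIntegral_mono' measurableSet_Icc fun τ hτ => ?_
              have : y + τ • e ∈ ball (0:E3) ρ := by
                have := (convex_ball (0:E3) ρ) k1 k2 (sub_nonneg.2 hτ.2) hτ.1 (by ring)
                convert this using 1
                module
              rw [hA, indicator_of_mem this]
              simp
          _ = ‖e‖ₑ ^ (2:ℝ) * ∫⁻ τ in Icc (0:ℝ) 1, ∫⁻ y, A (y + τ • e) * GrI sol (y + τ • e) t := by
              have mm : Measurable (fun q : E3 × ℝ => A (q.1 + q.2 • e) * GrI sol (q.1 + q.2 • e) t) := by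
                have m4 : Measurable (fun q : E3 × ℝ => GrI sol (q.1 + q.2 • e) t) := GrI_comp sol (by fun_prop) (by fun_prop)
                fun_prop
              rw [lintegral_const_mul _ mm.lintegral_prod_right', lintegral_lintegral_swap mm.aemeasurable]
          _ = ‖e‖ₑ ^ (2:ℝ) * ∫⁻ y, A y * GrI sol y t := by
              congr 1
              have : ∀ τ : ℝ, ∫⁻ y, A (y + τ • e) * GrI sol (y + τ • e) t = ∫⁻ y, A y * GrI sol y t := fun τ =>
                lintegral_add_right_eq_self (fun y => A y * GrI sol y t) (τ • e)
              simp [this]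
          _ ≤ _ := by
              refine mul_le_mul' hes' ?_
              rw [← lintegral_indicator measurableSet_ball]
              refine lintegral_mono fun y => ?_
              by_cases k : y ∈ ball (0:E3) ρ
              · simp only [hA, indicator_of_mem k, Pi.one_apply, one_mul, GrI]
                exact indicator_le_self _ _ _
              · simp [hA, k]
    _ = _ := by
        rw [lintegral_mul_const _ (measurable_one.indicator measurableSet_ball), lintegral_indicator_one measurableSet_ball, VB]
        ring

end

section

/-- smooth functions compactly supported in the unit ball -/
def TF (φ : E3 → ℝ) : Prop := ContDiff ℝ (⊤ : ℕ∞) φ ∧ HasCompactSupport φ ∧ tsupport φ ⊆ B1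

lemma pd_smooth {f : E3 → ℝ} (h : ContDiff ℝ (⊤ : ℕ∞) f) (i : Fin 3) : ContDiff ℝ (⊤ : ℕ∞) (pd i f) := by
  have : ContDiff ℝ (⊤ : ℕ∞) (fderiv ℝ f) := h.fderiv_right (by simp)
  exact this.clm_apply contDiff_const

lemma TF_pd {φ : E3 → ℝ} (h : TF φ) (i : Fin 3) : TF (pd i φ) :=
  ⟨pd_smooth h.1 i, h.2.1.fderiv_apply (𝕜 := ℝ) _, (tsupport_fderiv_apply_subset ℝ _).trans h.2.2⟩

lemma TF_add {f g : E3 → ℝ} (hf : TF f) (hg : TF g) : TF (fun x => f x + g x) :=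
  ⟨hf.1.add hg.1, hf.2.1.add hg.2.1, (tsupport_add f g).trans (union_subset hf.2.2 hg.2.2)⟩

lemma lap_eq3 (f : E3 → ℝ) : lap f = fun x => (pd 0 (pd 0 f) x + pd 1 (pd 1 f) x) + pd 2 (pd 2 f) x := by
  ext x
  simp [lap, Fin.sum_univ_three]

lemma TF_lap {φ : E3 → ℝ} (h : TF φ) : TF (lap φ) := by
  rw [lap_eq3]
  exact TF_add (TF_add (TF_pd (TF_pd h 0) 0) (TF_pd (TF_pd h 1) 1)) (TF_pd (TF_pd h 2) 2)

lemma pd_comm {f : E3 → ℝ} (h : ContDiff ℝ (⊤ : ℕ∞) f) (i j : Fin 3) (x : E3) : pd i (pd j f) x = pd j (pd i f) x := by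
  have h2 : ContDiff ℝ (⊤ : ℕ∞) (fderiv ℝ f) := h.fderiv_right (by simp)
  have hd : DifferentiableAt ℝ (fderiv ℝ f) x := h2.differentiable (by simp) x
  have hs : IsSymmSndFDerivAt ℝ f x := h.contDiffAt.isSymmSndFDerivAt (by
    simp only [minSmoothness_of_isRCLikeNormedField]
    exact (WithTop.coe_le_coe.2 le_top : ((2:ℕ∞) : WithTop ℕ∞) ≤ ((⊤:ℕ∞) : WithTop ℕ∞)))
  have key : ∀ a b : E3, fderiv ℝ (fun y => fderiv ℝ f y b) x a = fderiv ℝ (fderiv ℝ f) x a b := by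
    intro a b
    rw [fderiv_clm_apply hd (differentiableAt_const b)]
    simp
  show fderiv ℝ (fun y => fderiv ℝ f y _) x _ = fderiv ℝ (fun y => fderiv ℝ f y _) x _
  rw [key, key]
  exact hs _ _

lemma pd_add {f g : E3 → ℝ} (hf : ContDiff ℝ (⊤ : ℕ∞) f) (hg : ContDiff ℝ (⊤ : ℕ∞) g) (i : Fin 3) (x : E3) :
    pd i (fun y => f y + g y) x = pd i f x + pd i g x := by
  unfold pd
  rw [fderiv_fun_add (hf.differentiable (by simp) x) (hg.differentiable (by simp) x)]
  simp

lemma lap_pd {φ : E3 → ℝ} (h : ContDiff ℝ (⊤ : ℕ∞) φ) (i : Fin 3) (x : E3) : lap (pd i φ) x = pd i (lap φ) x := by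
  have s1 := fun k => pd_smooth h k
  have s2 := fun k l => pd_smooth (s1 k) l
  rw [lap_eq3, lap_eq3, pd_add ((s2 0 0).add (s2 1 1)) (s2 2 2), pd_add (s2 0 0) (s2 1 1)]
  have : ∀ k, pd k (pd k (pd i φ)) x = pd i (pd k (pd k φ)) x := by
    intro k
    have e : pd k (pd i φ) = pd i (pd k φ) := by ext y; exact pd_comm h k i y
    rw [e, pd_comm (s1 k)]
  simp only [this]

lemma pd_const_mul {f : E3 → ℝ} (hf : ContDiff ℝ (⊤ : ℕ∞) f) (c : ℝ) (i : Fin 3) (x : E3) :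
    pd i (fun y => c * f y) x = c * pd i f x := by
  unfold pd
  rw [fderiv_const_mul (hf.differentiable (by simp) x)]
  simp

lemma lap_const_mul {f : E3 → ℝ} (hf : ContDiff ℝ (⊤ : ℕ∞) f) (c : ℝ) (x : E3) :
    lap (fun y => c * f y) x = c * lap f x := by
  unfold lap
  rw [Finset.mul_sum]
  refine Finset.sum_congr rfl fun i _ => ?_
  have : (fun y => pd i (fun y => c * f y) y) = fun y => c * pd i f y := by
    ext y; exact pd_const_mul hf c i y
  rw [this, pd_const_mul (pd_smooth hf i)]

/-- time test functions -/
def TT (θ : ℝ → ℝ) : Prop := ContDiff ℝ (⊤ : ℕ∞) θ ∧ HasCompactSupport θ ∧ tsupport θ ⊆ T1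

lemma prod_test_aux {φ : E3 → ℝ} {θ : ℝ → ℝ} (h : TF φ) (k : TT θ) :
    ContDiff ℝ (⊤ : ℕ∞) (fun z : E3 × ℝ => θ z.2 * φ z.1) ∧ tsupport (fun z : E3 × ℝ => θ z.2 * φ z.1) ⊆ tsupport φ ×ˢ tsupport θ := by
  refine ⟨(k.1.comp contDiff_snd).mul (h.1.comp contDiff_fst), ?_⟩
  refine closure_minimal ?_ ((isClosed_tsupport _).prod (isClosed_tsupport _))
  intro z hz
  simp only [Function.mem_support, ne_eq, mul_eq_zero, not_or] at hz
  exact ⟨subset_tsupport _ hz.2, subset_tsupport _ hz.1⟩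

lemma prod_test {φ : E3 → ℝ} {θ : ℝ → ℝ} (h : TF φ) (k : TT θ) : IsTest 1 (fun x t => θ t * φ x) := by
  obtain ⟨h1, h2⟩ := prod_test_aux h k
  refine ⟨h1, ?_, h2.trans (prod_mono h.2.2 k.2.2)⟩
  exact IsCompact.of_isClosed_subset (h.2.1.isCompact.prod k.2.1.isCompact) (isClosed_tsupport _) h2

lemma prod_testV {φ : Fin 3 → E3 → ℝ} {θ : ℝ → ℝ} (h : ∀ i, TF (φ i)) (k : TT θ) :
    IsTestV 1 (fun x t => WithLp.toLp 2 (fun i => θ t * φ i x)) := by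
  have hz : ∀ z : E3 × ℝ, (∀ i, θ z.2 * φ i z.1 = 0) → (WithLp.toLp 2 (fun i => θ z.2 * φ i z.1) : E3) = 0 := by
    intro z hz; ext i; simpa using hz i
  have hs : tsupport (fun z : E3 × ℝ => (WithLp.toLp 2 (fun i => θ z.2 * φ i z.1) : E3)) ⊆ (⋃ i, tsupport (φ i)) ×ˢ tsupport θ := by
    refine closure_minimal ?_ ((isClosed_iUnion_of_finite fun i => isClosed_tsupport _).prod (isClosed_tsupport _))
    intro z hz'
    by_contra hcon
    refine hz' (hz z fun i => ?_)
    by_contra h2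
    have h3 := mul_ne_zero_iff.1 h2
    exact hcon ⟨mem_iUnion.2 ⟨i, subset_tsupport _ h3.2⟩, subset_tsupport _ h3.1⟩
  refine ⟨?_, ?_, hs.trans (prod_mono (iUnion_subset fun i => (h i).2.2) k.2.2)⟩
  · rw [contDiff_euclidean]
    intro i
    exact (prod_test_aux (h i) k).1
  · exact IsCompact.of_isClosed_subset ((isCompact_iUnion fun i => (h i).2.1.isCompact).prod k.2.1.isCompact) (isClosed_tsupport _) hs

lemma slice_ext {h : E3 × ℝ → ℝ} (hi : Integrable h (volume.restrict Q1))
    (hz : ∀ θ, TT θ → ∫ t in T1, θ t * ∫ x in B1, h (x, t) = 0) :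
    ∀ᵐ t : ℝ, t ∈ T1 → ∫ x in B1, h (x, t) = 0 := by
  rw [Q1_vol] at hi
  have h1 : Integrable (fun t => ∫ x in B1, h (x, t)) (volume.restrict T1) := hi.integral_prod_right
  refine isOpen_Ioo.ae_eq_zero_of_integral_contDiff_smul_eq_zero (IntegrableOn.locallyIntegrableOn h1) ?_
  intro g g1 g2 g3
  have := hz g ⟨g1, g2, g3⟩
  rw [setIntegral_eq_integral_of_forall_compl_eq_zero] at this
  · exact this
  · intro t ht
    rw [image_eq_zero_of_notMem_tsupport (fun hh => ht (g3 hh)), zero_mul]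

variable {u : E3 → ℝ → E3} {P : E3 → ℝ → ℝ}

lemma TF_bdd {φ : E3 → ℝ} (h : TF φ) {F : E3 × ℝ → ℝ} (hF : Integrable F (volume.restrict Q1)) :
    Integrable (fun z => F z * φ z.1) (volume.restrict Q1) := by
  obtain ⟨C, hC⟩ := h.2.1.exists_bound_of_continuous h.1.continuous
  exact hF.mul_bdd (c := C) (h.1.continuous.comp continuous_fst).aestronglyMeasurable (Eventually.of_forall fun z => hC _)

lemma S2_slice (sol : SuitableWeakSolution 1 u P) {φ : E3 → ℝ} (h : TF φ) :
    ∀ᵐ t : ℝ, t ∈ T1 → ∫ x in B1, ∑ i, u x t i * pd i φ x = 0 := by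
  refine slice_ext (h := fun z => ∑ i, u z.1 z.2 i * pd i φ z.1) ?_ ?_
  · exact integrable_finsetSum _ fun i _ => TF_bdd (TF_pd h i) (ui_int sol i)
  · intro θ hθ
    have := sol.weak_div _ (prod_test h hθ)
    rw [← this]
    refine integral_congr_ae (Eventually.of_forall fun t => ?_)
    simp only
    rw [← integral_const_mul]
    refine integral_congr_ae (Eventually.of_forall fun x => ?_)
    simp only [pd_const_mul h.1]
    rw [Finset.mul_sum]
    refine Finset.sum_congr rfl fun i _ => by ring

lemma S3_slice (sol : SuitableWeakSolution 1 u P) {φ : E3 → ℝ} (h : TF φ) :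
    ∀ᵐ t : ℝ, t ∈ T1 → ∫ x in B1, ((∑ i, ∑ j, u x t i * u x t j * pd i (pd j φ) x) + P x t * lap φ x) = 0 := by
  have iC : Integrable (fun z : E3 × ℝ => (∑ i, ∑ j, u z.1 z.2 i * u z.1 z.2 j * pd i (pd j φ) z.1) + P z.1 z.2 * lap φ z.1) (volume.restrict Q1) := by
    refine Integrable.add ?_ (TF_bdd (TF_lap h) (P_int sol))
    exact integrable_finsetSum _ fun i _ => integrable_finsetSum _ fun j _ => TF_bdd (TF_pd (TF_pd h j) i) (uij_int sol i j)
  refine slice_ext (h := fun z => (∑ i, ∑ j, u z.1 z.2 i * u z.1 z.2 j * pd i (pd j φ) z.1) + P z.1 z.2 * lap φ z.1) iC ?_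
  intro θ hθ
  have hw := sol.weak_NS _ (prod_testV (fun i => TF_pd h i) hθ)
  have iA : Integrable (fun z : E3 × ℝ => ∑ i, u z.1 z.2 i * pd i φ z.1) (volume.restrict Q1) :=
    integrable_finsetSum _ fun i _ => TF_bdd (TF_pd h i) (ui_int sol i)
  have iB : Integrable (fun z : E3 × ℝ => ∑ i, u z.1 z.2 i * pd i (lap φ) z.1) (volume.restrict Q1) :=
    integrable_finsetSum _ fun i _ => TF_bdd (TF_pd (TF_lap h) i) (ui_int sol i)
  rw [Q1_vol] at iA iB iC
  have jA := iA.prod_left_ae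
  have jB := iB.prod_left_ae
  have jC := iC.prod_left_ae
  rw [← neg_eq_zero, ← hw, ← integral_neg]
  refine integral_congr_ae ?_
  filter_upwards [jA, jB, jC, (ae_restrict_iff' measurableSet_Ioo).2 (S2_slice sol h), (ae_restrict_iff' measurableSet_Ioo).2 (S2_slice sol (TF_lap h))] with t kA kB kC zA zB
  have e : ∀ x, (-(∑ i : Fin 3, u x t i * deriv (fun s => (WithLp.toLp 2 (fun i => θ s * pd i φ x) : E3) i) t)
          - (∑ i : Fin 3, u x t i * lap (fun y => (WithLp.toLp 2 (fun i => θ t * pd i φ y) : E3) i) x)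
          - (∑ i : Fin 3, ∑ j : Fin 3, u x t i * u x t j * pd i (fun y => (WithLp.toLp 2 (fun i => θ t * pd i φ y) : E3) j) x)
          - P x t * (∑ j : Fin 3, pd j (fun y => (WithLp.toLp 2 (fun i => θ t * pd i φ y) : E3) j) x))
      = (-(deriv θ t)) * (∑ i, u x t i * pd i φ x) + (-(θ t)) * (∑ i, u x t i * pd i (lap φ) x)
        + (-(θ t)) * ((∑ i, ∑ j, u x t i * u x t j * pd i (pd j φ) x) + P x t * lap φ x) := by
    intro x
    have d1 : ∀ i, deriv (fun s => θ s * pd i φ x) t = deriv θ t * pd i φ x := fun i => by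
      rw [deriv_mul_const (hθ.1.differentiable (by simp) t)]
    have l0 : lap φ x = ∑ i, pd i (pd i φ) x := rfl
    simp only [d1, lap_const_mul (pd_smooth h.1 _), pd_const_mul (pd_smooth h.1 _), lap_pd h.1]
    rw [l0]
    simp only [Fin.sum_univ_three]
    ring
  simp only [e]
  have q1 := integral_add ((kA.const_mul (-(deriv θ t))).add (kB.const_mul (-(θ t)))) (kC.const_mul (-(θ t)))
  have q2 := integral_add (kA.const_mul (-(deriv θ t))) (kB.const_mul (-(θ t)))
  simp only [Pi.add_apply] at q1
  rw [q1, q2, integral_const_mul, integral_const_mul, integral_const_mul, zA, zB]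
  ring

end

section

def kβ (r : ℝ) : ℝ := Real.smoothTransition ((r - 1/4) * (4/3))
def km (r : ℝ) : ℝ := -(1/2) * (kβ r * r ^ (-(3/2) : ℝ))

lemma kβ_smooth : ContDiff ℝ (⊤ : ℕ∞) kβ := Real.smoothTransition.contDiff.comp (by fun_prop)
lemma kβ_zero {r : ℝ} (h : r ≤ 1/4) : kβ r = 0 := Real.smoothTransition.zero_of_nonpos (by linarith)
lemma kβ_one {r : ℝ} (h : 1 ≤ r) : kβ r = 1 := Real.smoothTransition.one_of_one_le (by linarith)
lemma kβ_mono : Monotone kβ := fun a b h => Real.smoothTransition.monotone (by linarith)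
lemma km_zero {r : ℝ} (h : r ≤ 1/4) : km r = 0 := by simp [km, kβ_zero h]

lemma km_smooth : ContDiff ℝ (⊤ : ℕ∞) km := by
  rw [contDiff_iff_contDiffAt]
  intro r
  rcases lt_or_ge r (1/4) with h | h
  · have : km =ᶠ[nhds r] fun _ => 0 := by
      filter_upwards [Iio_mem_nhds h] with s hs using km_zero (le_of_lt hs)
    exact contDiffAt_const.congr_of_eventuallyEq this
  · have hr : r ≠ 0 := by intro h0; rw [h0] at h; norm_num at h
    exact contDiffAt_const.mul (kβ_smooth.contDiffAt.mul (Real.contDiffAt_rpow_const_of_ne hr))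

def kW (r : ℝ) : ℝ := -(6 * km r + 4 * r * deriv km r)

lemma kW_cont : Continuous kW := by
  have h1 := km_smooth.continuous
  have h2 : Continuous (deriv km) := km_smooth.continuous_deriv (by simp)
  unfold kW; fun_prop

lemma kW_eq {r : ℝ} (h : 0 < r) : kW r = 2 * deriv kβ r * r ^ (-(1/2) : ℝ) := by
  have h1 : HasDerivAt kβ (deriv kβ r) r := (kβ_smooth.differentiable (by simp) r).hasDerivAt
  have h2 := Real.hasDerivAt_rpow_const (x := r) (p := -(3/2)) (Or.inl h.ne')
  have h3 : HasDerivAt km _ r := (h1.mul h2).const_mul (-(1/2))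
  rw [kW, h3.deriv, km]
  have e1 : r ^ (-(3/2) : ℝ) = r ^ (-(3/2) - 1 : ℝ) * r := by
    rw [← Real.rpow_add_one h.ne']; norm_num
  have e2 : r ^ (-(1/2) : ℝ) = r ^ (-(3/2) - 1 : ℝ) * r * r := by
    rw [← Real.rpow_add_one h.ne', ← Real.rpow_add_one h.ne']; norm_num
  rw [e2, e1]
  ring

lemma kW_zero {r : ℝ} (h : r < 1/4) : kW r = 0 := by
  have : km =ᶠ[nhds r] fun _ => 0 := by
    filter_upwards [Iio_mem_nhds h] with s hs using km_zero (le_of_lt hs)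
  rw [kW, this.deriv_eq, km_zero h.le]
  simp

lemma kW_nonneg (r : ℝ) : 0 ≤ kW r := by
  rcases lt_or_ge r (1/4) with h | h
  · rw [kW_zero h]
  · have hr : 0 < r := by linarith
    rw [kW_eq hr]
    have := kβ_mono.deriv_nonneg (x := r)
    positivity

lemma kW_zero' {r : ℝ} (h : 1 ≤ r) : kW r = 0 := by
  rw [kW_eq (by linarith)]
  have : IsLocalMax kβ r := by
    refine Eventually.of_forall fun s => ?_
    rw [kβ_one h]
    exact Real.smoothTransition.le_one _
  rw [this.deriv_eq_zero]
  ring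

lemma kW_ne : ∃ r, 0 < r ∧ kW r ≠ 0 := by
  by_contra! hc
  obtain ⟨c, hc1, hc2⟩ := exists_deriv_eq_slope kβ (show (1/4:ℝ) < 1 by norm_num) kβ_smooth.continuous.continuousOn
    (kβ_smooth.differentiable (by simp)).differentiableOn
  rw [kβ_one le_rfl, kβ_zero le_rfl] at hc2
  have h0 : 0 < c := by linarith [hc1.1]
  have := hc c h0
  rw [kW_eq h0, hc2] at this
  have h2 := Real.rpow_pos_of_pos h0 (-(1/2))
  norm_num at this
  exact absurd this h2.ne'

def kK (r : ℝ) : ℝ := km r - 8 * km (4 * r)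
def kk (r : ℝ) : ℝ := ∫ s in (1:ℝ)..r, kK s

lemma kK_smooth : ContDiff ℝ (⊤ : ℕ∞) kK :=
  km_smooth.sub (contDiff_const.mul (km_smooth.comp (by fun_prop)))

lemma kk_deriv (r : ℝ) : HasDerivAt kk (kK r) r :=
  intervalIntegral.integral_hasDerivAt_right (kK_smooth.continuous.intervalIntegrable _ _)
    (kK_smooth.continuous.stronglyMeasurableAtFilter _ _) kK_smooth.continuous.continuousAt

lemma kk_smooth : ContDiff ℝ (⊤ : ℕ∞) kk := by
  rw [contDiff_infty_iff_deriv]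
  refine ⟨fun r => (kk_deriv r).differentiableAt, ?_⟩
  have : deriv kk = kK := by ext r; exact (kk_deriv r).deriv
  rw [this]; exact kK_smooth

lemma kK_zero {r : ℝ} (h : 1 ≤ r) : kK r = 0 := by
  have hr : 0 < r := by linarith
  rw [kK, km, km, kβ_one h, kβ_one (by linarith : (1:ℝ) ≤ 4 * r), Real.mul_rpow (by norm_num) hr.le]
  have : (4:ℝ) ^ (-(3/2) : ℝ) = 1/8 := by
    rw [show (4:ℝ) = 2 ^ (2:ℝ) by norm_num, ← Real.rpow_mul (by norm_num)]
    norm_num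
  rw [this]; ring

lemma kk_zero {r : ℝ} (h : 1 ≤ r) : kk r = 0 := by
  unfold kk
  rw [intervalIntegral.integral_congr (g := fun _ => 0)]
  · simp
  · intro s hs
    rw [uIcc_of_le h] at hs
    exact kK_zero hs.1

lemma kK_deriv (r : ℝ) : deriv kK r = deriv km r - 32 * deriv km (4 * r) := by
  have hd := km_smooth.differentiable (by simp)
  have h1 := (hd r).hasDerivAt
  have h2 := (hd (4*r)).hasDerivAt
  have h3 : HasDerivAt (fun r : ℝ => 4 * r) 4 r := by simpa using (hasDerivAt_id r).const_mul 4
  have h4 := h2.comp r h3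
  have h5 : HasDerivAt kK _ r := h1.sub (h4.const_mul 8)
  rw [h5.deriv]
  ring

lemma pd_radial {f f' : ℝ → ℝ} (hf : ∀ r, HasDerivAt f (f' r) r) (i : Fin 3) (x : E3) :
    HasFDerivAt (fun x : E3 => f (‖x‖^2)) (f' (‖x‖^2) • (2 • innerSL ℝ x)) x :=
  (hf _).comp_hasFDerivAt x (hasStrictFDerivAt_norm_sq x).hasFDerivAt

lemma pd_radial' {f f' : ℝ → ℝ} (hf : ∀ r, HasDerivAt f (f' r) r) (i : Fin 3) (x : E3) :
    pd i (fun x : E3 => f (‖x‖^2)) x = 2 * f' (‖x‖^2) * x i := by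
  rw [pd, (pd_radial hf i x).fderiv]
  simp [EuclideanSpace.inner_single_right]
  ring

lemma lap_radial (x : E3) : lap (fun x : E3 => kk (‖x‖^2)) x = 6 * kK (‖x‖^2) + 4 * ‖x‖^2 * deriv kK (‖x‖^2) := by
  have h1 : ∀ i : Fin 3, pd i (fun y => pd i (fun x : E3 => kk (‖x‖^2)) y) x = 2 * kK (‖x‖^2) + 4 * deriv kK (‖x‖^2) * x i ^ 2 := by
    intro i
    have : (fun y => pd i (fun x : E3 => kk (‖x‖^2)) y) = fun y => 2 * kK (‖y‖^2) * y i := by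
      ext y; exact pd_radial' kk_deriv i y
    rw [this]
    have hK : ∀ r, HasDerivAt kK (deriv kK r) r := fun r => (kK_smooth.differentiable (by simp) r).hasDerivAt
    have h2 := (pd_radial hK i x).const_mul 2
    have h3 : HasFDerivAt (fun y : E3 => y i) (EuclideanSpace.proj i : E3 →L[ℝ] ℝ) x := (EuclideanSpace.proj i : E3 →L[ℝ] ℝ).hasFDerivAt
    have h4 := h2.mul h3
    rw [pd]
    erw [h4.fderiv]
    simp [EuclideanSpace.inner_single_right]
    ring
  unfold lap
  simp only [h1]
  rw [Finset.sum_add_distrib, ← Finset.mul_sum, EuclideanSpace.norm_sq_eq]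
  simp only [Real.norm_eq_abs, sq_abs, Finset.sum_const, Finset.card_univ, Fintype.card_fin, nsmul_eq_mul, Finset.mul_sum, Finset.sum_mul]
  congr 1
  · push_cast; ring
  · refine Finset.sum_congr rfl fun i _ => by ring

lemma kernel_exists : ∃ ω ρ : E3 → ℝ, Continuous ω ∧ ContDiff ℝ (⊤ : ℕ∞) ρ ∧ (∀ x, 0 ≤ ω x) ∧ (∀ x, 1 ≤ ‖x‖ → ω x = 0) ∧
    (∀ x, 1 ≤ ‖x‖ → ρ x = 0) ∧ 0 < ∫ x, ω x ∧ ∀ x, lap ρ x = 8 * ω ((2:ℝ) • x) - ω x := by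
  have hc : Continuous (fun x : E3 => kW (‖x‖^2)) := kW_cont.comp (by fun_prop)
  have hz : ∀ x : E3, 1 ≤ ‖x‖ → kW (‖x‖^2) = 0 := fun x hx => kW_zero' (by nlinarith)
  refine ⟨fun x => kW (‖x‖^2), fun x => kk (‖x‖^2), hc, kk_smooth.comp (contDiff_norm_sq ℝ), fun x => kW_nonneg _, hz,
    fun x hx => kk_zero (by nlinarith), ?_, ?_⟩
  · refine Continuous.integral_pos_of_hasCompactSupport_nonneg_nonzero (x := (EuclideanSpace.single 0 (Real.sqrt kW_ne.choose) : E3)) hc ?_ (fun x => kW_nonneg _) ?_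
    · refine HasCompactSupport.of_support_subset_isCompact (isCompact_closedBall (0:E3) 1) ?_
      intro x hx
      by_contra h
      simp at h
      exact hx (hz x h.le)
    · simp only [EuclideanSpace.norm_single, Real.norm_eq_abs, sq_abs, Real.sq_sqrt kW_ne.choose_spec.1.le]
      exact kW_ne.choose_spec.2
  · intro x
    rw [lap_radial]
    simp only
    rw [norm_smul]
    have : (‖(2:ℝ)‖ * ‖x‖)^2 = 4 * ‖x‖^2 := by rw [mul_pow]; norm_num
    rw [this, kW, kW, kK_deriv, kK]
    ring

end

section

def scl (f : E3 → ℝ) (s : ℝ) (y x : E3) : ℝ := f (s⁻¹ • (x - y))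

lemma scl_smooth {f : E3 → ℝ} (h : ContDiff ℝ (⊤ : ℕ∞) f) (s : ℝ) (y : E3) : ContDiff ℝ (⊤ : ℕ∞) (scl f s y) :=
  h.comp (by fun_prop)

lemma pd_scl {f : E3 → ℝ} (h : ContDiff ℝ (⊤ : ℕ∞) f) (s : ℝ) (y : E3) (i : Fin 3) (x : E3) :
    pd i (scl f s y) x = s⁻¹ * scl (pd i f) s y x := by
  have h1 : HasFDerivAt (fun x : E3 => s⁻¹ • (x - y)) (s⁻¹ • ContinuousLinearMap.id ℝ E3) x :=
    ((hasFDerivAt_id x).sub_const y).const_smul s⁻¹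
  have h2 := (h.differentiable (by simp) (s⁻¹ • (x - y))).hasFDerivAt.comp x h1
  rw [pd, show scl f s y = f ∘ (fun x : E3 => s⁻¹ • (x - y)) from rfl, h2.fderiv]
  simp [scl, pd]

lemma pd2_scl {f : E3 → ℝ} (h : ContDiff ℝ (⊤ : ℕ∞) f) (s : ℝ) (y : E3) (i j : Fin 3) (x : E3) :
    pd i (pd j (scl f s y)) x = s⁻¹ ^ 2 * scl (pd i (pd j f)) s y x := by
  have : pd j (scl f s y) = fun x => s⁻¹ * scl (pd j f) s y x := by ext x; exact pd_scl h s y j x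
  rw [this, pd_const_mul (scl_smooth (pd_smooth h j) s y), pd_scl (pd_smooth h j)]
  ring

lemma lap_scl {f : E3 → ℝ} (h : ContDiff ℝ (⊤ : ℕ∞) f) (s : ℝ) (y x : E3) :
    lap (scl f s y) x = s⁻¹ ^ 2 * scl (lap f) s y x := by
  rw [lap_eq3, lap_eq3]
  simp only [pd2_scl h]
  simp only [scl]
  ring

lemma TF_scl {f : E3 → ℝ} (h : ContDiff ℝ (⊤ : ℕ∞) f) (hz : ∀ x, 1 ≤ ‖x‖ → f x = 0) {s : ℝ} (hs : 0 < s) {y : E3} (hy : ‖y‖ + s < 1) :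
    TF (scl f s y) := by
  have hsub : tsupport (scl f s y) ⊆ closedBall y s := by
    refine closure_minimal ?_ isClosed_closedBall
    intro x hx
    by_contra hc
    refine hx (hz _ ?_)
    rw [mem_closedBall, dist_eq_norm, not_le] at hc
    rw [norm_smul, Real.norm_of_nonneg (by positivity), ← div_eq_inv_mul, le_div_iff₀ hs]
    linarith
  refine ⟨scl_smooth h s y, IsCompact.of_isClosed_subset (isCompact_closedBall y s) (isClosed_tsupport _) hsub, hsub.trans ?_⟩
  intro x hx
  rw [mem_closedBall, dist_eq_norm] at hx
  rw [mem_ball_zero_iff]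
  have := norm_le_norm_sub_add x y
  linarith

lemma pd_zero_out {f : E3 → ℝ} (hz : ∀ x, 1 < ‖x‖ → f x = 0) (i : Fin 3) (x : E3) (hx : 1 < ‖x‖) : pd i f x = 0 := by
  have : f =ᶠ[nhds x] fun _ => 0 := by
    filter_upwards [(isOpen_lt continuous_const continuous_norm).mem_nhds hx] with z hz' using hz z hz'
  rw [pd, this.fderiv_eq]
  simp

lemma cont_bdd {f : E3 → ℝ} (hc : Continuous f) (hz : ∀ x, 1 < ‖x‖ → f x = 0) : ∃ C, ∀ x, |f x| ≤ C := by
  have : HasCompactSupport f := by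
    refine HasCompactSupport.of_support_subset_isCompact (isCompact_closedBall (0:E3) 1) ?_
    intro x hx
    by_contra h
    simp at h
    exact hx (hz x h)
  exact this.exists_bound_of_continuous hc

variable {u : E3 → ℝ → E3} {P : E3 → ℝ → ℝ}

lemma P_comp (sol : SuitableWeakSolution 1 u P) {X : Type*} [MeasurableSpace X] {a : X → E3} {b : X → ℝ} (ha : Measurable a) (hb : Measurable b) :
    Measurable (fun x => P (a x) (b x)) := (P_meas sol).comp (ha.prodMk hb)

lemma K_pt (sol : SuitableWeakSolution 1 u P) {ρ : E3 → ℝ} (h : ContDiff ℝ (⊤ : ℕ∞) ρ) (hz : ∀ x, 1 ≤ ‖x‖ → ρ x = 0)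
    {M : ℝ} (hM : ∀ i j x, |pd i (pd j ρ) x| ≤ M)
    {s : ℝ} (hs : 0 < s) {y : E3} (hy : ‖y‖ + s < 1) :
    ∀ᵐ t : ℝ, t ∈ T1 → ‖∫ x in B1, P x t * scl (lap ρ) s y x‖ₑ ≤ ENNReal.ofReal (9 * M) *
      ∫⁻ x in B1, kerB (2*s) y x * (‖u x t‖ₑ * ‖u x t - u y t‖ₑ) := by
  have hT := TF_scl h hz hs hy
  have hM0 : 0 ≤ M := (abs_nonneg _).trans (hM 0 0 0)
  have h2 := ae_all_iff.2 fun j => S2_slice sol (TF_pd hT j)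
  have iA : ∀ i j : Fin 3, Integrable (fun z : E3 × ℝ => u z.1 z.2 i * pd i (pd j (scl ρ s y)) z.1) (volume.restrict Q1) :=
    fun i j => TF_bdd (TF_pd (TF_pd hT j) i) (ui_int sol i)
  have iC : ∀ i j : Fin 3, Integrable (fun z : E3 × ℝ => u z.1 z.2 i * u z.1 z.2 j * pd i (pd j (scl ρ s y)) z.1) (volume.restrict Q1) :=
    fun i j => TF_bdd (TF_pd (TF_pd hT j) i) (uij_int sol i j)
  have iP : Integrable (fun z : E3 × ℝ => P z.1 z.2 * lap (scl ρ s y) z.1) (volume.restrict Q1) := TF_bdd (TF_lap hT) (P_int sol)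
  simp only [Q1_vol] at iA iC iP
  have jA : ∀ᵐ t : ℝ, t ∈ T1 → ∀ i j : Fin 3, Integrable (fun x => u x t i * pd i (pd j (scl ρ s y)) x) (volume.restrict B1) := by
    have := ae_all_iff.2 fun i => ae_all_iff.2 fun j => (iA i j).prod_left_ae
    exact (ae_restrict_iff' measurableSet_Ioo).1 this
  have jC : ∀ᵐ t : ℝ, t ∈ T1 → ∀ i j : Fin 3, Integrable (fun x => u x t i * u x t j * pd i (pd j (scl ρ s y)) x) (volume.restrict B1) := by
    have := ae_all_iff.2 fun i => ae_all_iff.2 fun j => (iC i j).prod_left_ae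
    exact (ae_restrict_iff' measurableSet_Ioo).1 this
  have jP : ∀ᵐ t : ℝ, t ∈ T1 → Integrable (fun x => P x t * lap (scl ρ s y) x) (volume.restrict B1) :=
    (ae_restrict_iff' measurableSet_Ioo).1 iP.prod_left_ae
  filter_upwards [S3_slice sol hT, h2, jA, jC, jP] with t k3 k2 kA kC kP ht
  replace k3 := k3 ht
  replace kA := kA ht
  replace kC := kC ht
  replace kP := kP ht
  have kC' : Integrable (fun x => ∑ i, ∑ j, u x t i * u x t j * pd i (pd j (scl ρ s y)) x) (volume.restrict B1) :=
    integrable_finsetSum _ fun i _ => integrable_finsetSum _ fun j _ => kC i j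
  have kA' : ∀ j, Integrable (fun x => ∑ i, u x t i * pd i (pd j (scl ρ s y)) x) (volume.restrict B1) := fun j =>
    integrable_finsetSum _ fun i _ => kA i j
  have kA'' : Integrable (fun x => ∑ j, u y t j * ∑ i, u x t i * pd i (pd j (scl ρ s y)) x) (volume.restrict B1) :=
    integrable_finsetSum _ fun j _ => (kA' j).const_mul _
  have zA : ∫ x in B1, ∑ j, u y t j * ∑ i, u x t i * pd i (pd j (scl ρ s y)) x = 0 := by
    rw [integral_finsetSum _ fun j _ => (kA' j).const_mul _]
    refine Finset.sum_eq_zero fun j _ => ?_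
    rw [integral_const_mul, k2 j ht, mul_zero]
  rw [integral_add kC' kP] at k3
  have e1 : ∫ x in B1, P x t * lap (scl ρ s y) x = - ∫ x in B1, ∑ i, ∑ j, u x t i * (u x t j - u y t j) * pd i (pd j (scl ρ s y)) x := by
    have : ∫ x in B1, ∑ i, ∑ j, u x t i * (u x t j - u y t j) * pd i (pd j (scl ρ s y)) x
        = (∫ x in B1, ∑ i, ∑ j, u x t i * u x t j * pd i (pd j (scl ρ s y)) x) - ∫ x in B1, ∑ j, u y t j * ∑ i, u x t i * pd i (pd j (scl ρ s y)) x := by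
      rw [← integral_sub kC' kA'']
      refine integral_congr_ae (Eventually.of_forall fun x => ?_)
      simp only [Fin.sum_univ_three]
      ring
    rw [this, zA]
    linarith
  simp only [lap_scl h, pd2_scl h] at e1
  have e2 : ∫ x in B1, P x t * scl (lap ρ) s y x = - ∫ x in B1, ∑ i, ∑ j, u x t i * (u x t j - u y t j) * scl (pd i (pd j ρ)) s y x := by
    have hs2 : s⁻¹ ^ 2 ≠ 0 := by positivity
    apply mul_left_cancel₀ hs2
    rw [mul_neg, ← integral_const_mul, ← integral_const_mul]
    have a1 : ∫ x in B1, P x t * (s⁻¹ ^ 2 * scl (lap ρ) s y x) = ∫ x in B1, s⁻¹ ^ 2 * (P x t * scl (lap ρ) s y x) :=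
      integral_congr_ae (Eventually.of_forall fun x => by simp only; ring)
    have a2 : ∫ x in B1, ∑ i, ∑ j, u x t i * (u x t j - u y t j) * (s⁻¹ ^ 2 * scl (pd i (pd j ρ)) s y x)
        = ∫ x in B1, s⁻¹ ^ 2 * ∑ i, ∑ j, u x t i * (u x t j - u y t j) * scl (pd i (pd j ρ)) s y x := by
      refine integral_congr_ae (Eventually.of_forall fun x => ?_)
      simp only [Finset.mul_sum]
      refine Finset.sum_congr rfl fun i _ => Finset.sum_congr rfl fun j _ => by ring
    rw [a1, a2] at e1
    exact e1
  rw [e2, enorm_neg]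
  refine (enorm_integral_le_lintegral_enorm _).trans ?_
  rw [← lintegral_const_mul' _ _ ENNReal.ofReal_ne_top]
  refine lintegral_mono fun x => ?_
  simp only [kerB]
  split_ifs with hd
  · rw [one_mul, ← ofReal_norm, ← ofReal_norm, ← ofReal_norm, ← ENNReal.ofReal_mul (norm_nonneg _), ← ENNReal.ofReal_mul (by positivity)]
    refine ENNReal.ofReal_le_ofReal ?_
    have hb : ∀ i j, |u x t i * (u x t j - u y t j) * scl (pd i (pd j ρ)) s y x| ≤ M * (‖u x t‖ * ‖u x t - u y t‖) := by
      intro i j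
      rw [abs_mul, abs_mul]
      have b1 : |u x t i| ≤ ‖u x t‖ := PiLp.norm_apply_le (u x t) i
      have b2 : |u x t j - u y t j| ≤ ‖u x t - u y t‖ := PiLp.norm_apply_le (u x t - u y t) j
      have b3 := hM i j (s⁻¹ • (x - y))
      rw [mul_comm M]
      exact mul_le_mul (mul_le_mul b1 b2 (abs_nonneg _) (norm_nonneg _)) b3 (abs_nonneg _) (by positivity)
    rw [Real.norm_eq_abs]
    calc _ ≤ ∑ i : Fin 3, ∑ j : Fin 3, M * (‖u x t‖ * ‖u x t - u y t‖) :=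
          (Finset.abs_sum_le_sum_abs _ _).trans (Finset.sum_le_sum fun i _ => (Finset.abs_sum_le_sum_abs _ _).trans (Finset.sum_le_sum fun j _ => hb i j))
      _ = _ := by simp; ring
  · have : ∀ i j, scl (pd i (pd j ρ)) s y x = 0 := by
      intro i j
      refine pd_zero_out (fun z hz' => pd_zero_out (fun z hz' => hz z hz'.le) j z hz') i _ ?_
      rw [norm_smul, Real.norm_of_nonneg (by positivity), ← div_eq_inv_mul, lt_div_iff₀ hs, ← dist_eq_norm, dist_comm]
      linarith
    simp [this]

lemma K_slice (sol : SuitableWeakSolution 1 u P) {ρ : E3 → ℝ} (h : ContDiff ℝ (⊤ : ℕ∞) ρ) (hz : ∀ x, 1 ≤ ‖x‖ → ρ x = 0)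
    {M : ℝ} (hM : ∀ i j x, |pd i (pd j ρ) x| ≤ M) {s : ℝ} (hs : 0 < s) :
    ∀ᵐ t : ℝ, t ∈ T1 → ∀ᵐ y : E3, ‖y‖ + s < 1 → ‖∫ x in B1, P x t * scl (lap ρ) s y x‖ₑ ≤ ENNReal.ofReal (9 * M) *
      ∫⁻ x in B1, kerB (2*s) y x * (‖u x t‖ₑ * ‖u x t - u y t‖ₑ) := by
  have hY : MeasurableSet {y : E3 | ‖y‖ + s < 1} := measurableSet_lt (by fun_prop) measurable_const
  have h1 : ∀ᵐ y ∂(volume.restrict {y : E3 | ‖y‖ + s < 1}), ∀ᵐ t ∂(volume.restrict T1), ‖∫ x in B1, P x t * scl (lap ρ) s y x‖ₑ ≤ ENNReal.ofReal (9 * M) *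
      ∫⁻ x in B1, kerB (2*s) y x * (‖u x t‖ₑ * ‖u x t - u y t‖ₑ) := by
    rw [ae_restrict_iff' hY]
    refine Eventually.of_forall fun y hy => ?_
    rw [ae_restrict_iff' measurableSet_Ioo]
    exact K_pt sol h hz hM hs hy
  rw [Measure.ae_ae_comm] at h1
  · rw [ae_restrict_iff' measurableSet_Ioo] at h1
    filter_upwards [h1] with t ht k
    exact (ae_restrict_iff' hY).1 (ht k)
  · refine measurableSet_le ?_ ?_
    · refine Measurable.enorm ?_
      have hl : Continuous (lap ρ) := by
        rw [lap_eq3]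
        exact (((pd_smooth (pd_smooth h 0) 0).continuous.add (pd_smooth (pd_smooth h 1) 1).continuous).add (pd_smooth (pd_smooth h 2) 2).continuous)
      have m1 : Measurable (fun q : (E3 × ℝ) × E3 => P q.2 q.1.2 * scl (lap ρ) s q.1.1 q.2) := by
        refine (P_comp sol (by fun_prop) (by fun_prop)).mul ?_
        have : Continuous (fun q : (E3 × ℝ) × E3 => scl (lap ρ) s q.1.1 q.2) := by unfold scl; fun_prop
        exact this.measurable
      exact (m1.stronglyMeasurable.integral_prod_right' (ν := volume.restrict B1)).measurable
    · refine Measurable.const_mul ?_ _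
      refine Measurable.lintegral_prod_right' (ν := volume.restrict B1) (f := fun q : (E3 × ℝ) × E3 => kerB (2*s) q.1.1 q.2 * (‖u q.2 q.1.2‖ₑ * ‖u q.2 q.1.2 - u q.1.1 q.1.2‖ₑ)) ?_
      have m1 : Measurable (fun q : (E3 × ℝ) × E3 => u q.2 q.1.2) := u_comp sol (by fun_prop) (by fun_prop)
      have m2 : Measurable (fun q : (E3 × ℝ) × E3 => u q.1.1 q.1.2) := u_comp sol (by fun_prop) (by fun_prop)
      have m3 : Measurable (fun q : (E3 × ℝ) × E3 => kerB (2*s) q.1.1 q.2) := 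
        Measurable.comp (g := fun z : E3 × E3 => kerB (2*s) z.1 z.2) (f := fun q : (E3 × ℝ) × E3 => (q.1.1, q.2)) (kerB_meas (2*s)) (by fun_prop)
      exact m3.mul (m1.enorm.mul (m1.sub m2).enorm)

end

section

lemma lp2 {F : E3 × E3 → ℝ≥0∞} (hF : Measurable F) : ∫⁻ z, F z = ∫⁻ y, ∫⁻ x, F (y, x) :=
  lintegral_prod (μ := (volume : Measure E3)) (ν := (volume : Measure E3)) _ hF.aemeasurable
lemma lp2' {F : E3 × E3 → ℝ≥0∞} (hF : Measurable F) : ∫⁻ z, F z = ∫⁻ x, ∫⁻ y, F (y, x) :=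
  lintegral_prod_symm (μ := (volume : Measure E3)) (ν := (volume : Measure E3)) _ hF.aemeasurable

lemma T_bound {ρ s ε : ℝ} (h0 : 0 < ε) (h1 : ε < 1) {v : E3 → E3} (hv : Measurable v) :
    ∫⁻ y, ∫⁻ x, kerB (2*s) y x * (fB ρ v y * (fB ρ v x * ‖v x - v y‖ₑ)) ≤
      2 * ((∫⁻ x, fB ρ v x ^ (3:ℝ)) ^ (1 - ε/3) * VB (2*s) ^ (1 - 2*ε/3) * (∫⁻ x, QB1 ρ v s x ^ (2:ℝ)) ^ (ε/2)) := by
  have hf := fB_meas (ρ := ρ) hv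
  have hn : Measurable (fun z : E3 × E3 => ‖v z.1 - v z.2‖ₑ) := by fun_prop
  set f := fB ρ v with hfd
  set I : E3 → ℝ≥0∞ := (ball (0:E3) ρ).indicator 1 with hI
  have hk := kerB_meas (2*s)
  have hIm : Measurable I := ind1_meas
  let d : E3 × E3 → ℝ≥0∞ := fun z => I z.1 * (I z.2 * (kerB (2*s) z.1 z.2 * ‖v z.1 - v z.2‖ₑ ^ (2:ℝ)))
  have hd : Measurable d := by
    refine (hIm.comp measurable_fst).mul ((hIm.comp measurable_snd).mul (hk.mul (hn.pow_const _)))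
  have key := ENNReal.lintegral_prod_norm_pow_le (μ := (volume : Measure (E3 × E3))) (Finset.univ : Finset (Fin 4))
    (f := ![fun z => f z.1 ^ (3:ℝ) * kerB (2*s) z.1 z.2, fun z => f z.2 ^ (3:ℝ) * kerB (2*s) z.1 z.2, fun z => f z.1 ^ (3:ℝ) * f z.2 ^ (3:ℝ), d])
    (p := ![2/3-ε/2, 1/3-ε/6, ε/6, ε/2])
    (by
      have a1 : Measurable (fun z : E3 × E3 => f z.1 ^ (3:ℝ)) := (hf.comp measurable_fst).pow_const _
      have a2 : Measurable (fun z : E3 × E3 => f z.2 ^ (3:ℝ)) := (hf.comp measurable_snd).pow_const _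
      intro i _
      fin_cases i
      · exact (a1.mul hk).aemeasurable
      · exact (a2.mul hk).aemeasurable
      · exact (a1.mul a2).aemeasurable
      · exact hd.aemeasurable)
    (by simp [Fin.sum_univ_four]; ring)
    (by intro i _; fin_cases i <;> simp <;> linarith)
  simp only [Fin.prod_univ_four, Fin.isValue, Matrix.cons_val_zero, Matrix.cons_val_one, Matrix.cons_val] at key
  have a1 : Measurable (fun z : E3 × E3 => f z.1 ^ (3:ℝ)) := (hf.comp measurable_fst).pow_const _
  have a2 : Measurable (fun z : E3 × E3 => f z.2 ^ (3:ℝ)) := (hf.comp measurable_snd).pow_const _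
  have hkx : ∀ y, Measurable (fun x => kerB (2*s) y x) := fun y => by fun_prop
  have hky : ∀ x, Measurable (fun y => kerB (2*s) y x) := fun y => by fun_prop
  have i1 : ∫⁻ z : E3 × E3, f z.1 ^ (3:ℝ) * kerB (2*s) z.1 z.2 = (∫⁻ x, f x ^ (3:ℝ)) * VB (2*s) := by
    rw [lp2 (F := fun z : E3 × E3 => f z.1 ^ (3:ℝ) * kerB (2*s) z.1 z.2) (a1.mul hk)]
    simp only [lintegral_const_mul _ (hkx _), kerB_int]
    rw [lintegral_mul_const _ (hf.pow_const _)]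
  have i2 : ∫⁻ z : E3 × E3, f z.2 ^ (3:ℝ) * kerB (2*s) z.1 z.2 = (∫⁻ x, f x ^ (3:ℝ)) * VB (2*s) := by
    rw [lp2' (F := fun z : E3 × E3 => f z.2 ^ (3:ℝ) * kerB (2*s) z.1 z.2) (a2.mul hk)]
    have : ∀ x, ∫⁻ y, f x ^ (3:ℝ) * kerB (2*s) y x = f x ^ (3:ℝ) * VB (2*s) := fun x => by
      rw [lintegral_const_mul _ (hky x), ← kerB_int (s := 2*s) x]
      congr 1; exact lintegral_congr fun y => kerB_symm _ _ _
    simp only [this]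
    rw [lintegral_mul_const _ (hf.pow_const _)]
  have i3 : ∫⁻ z : E3 × E3, f z.1 ^ (3:ℝ) * f z.2 ^ (3:ℝ) = (∫⁻ x, f x ^ (3:ℝ)) * (∫⁻ x, f x ^ (3:ℝ)) := by
    rw [lp2 (F := fun z : E3 × E3 => f z.1 ^ (3:ℝ) * f z.2 ^ (3:ℝ)) (a1.mul a2)]
    have : ∀ y, ∫⁻ x, f y ^ (3:ℝ) * f x ^ (3:ℝ) = f y ^ (3:ℝ) * ∫⁻ x, f x ^ (3:ℝ) := fun y =>
      lintegral_const_mul _ (hf.pow_const _)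
    simp only [this]
    rw [lintegral_mul_const _ (hf.pow_const _)]
  have i4 : ∫⁻ z, d z = ∫⁻ x, QB1 ρ v s x ^ (2:ℝ) := by
    rw [lp2 hd]
    refine lintegral_congr fun y => ?_
    unfold QB1
    rw [← ENNReal.rpow_mul]
    norm_num
    unfold QB
    rw [← lintegral_const_mul]
    exact (hIm.mul ((hkx y).mul (by fun_prop)))
  rw [i1, i2, i3, i4] at key
  set X := ∫⁻ x, f x ^ (3:ℝ)
  set V := VB (2*s)
  set D := ∫⁻ x, QB1 ρ v s x ^ (2:ℝ)
  have e1 : (X * V) ^ (2/3-ε/2) * (X * V) ^ (1/3-ε/6) * (X * X) ^ (ε/6) * D ^ (ε/2) = X ^ (1-ε/3) * V ^ (1-2*ε/3) * D ^ (ε/2) := by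
    rw [← ENNReal.rpow_add_of_nonneg _ _ (by linarith) (by linarith), ENNReal.mul_rpow_of_nonneg _ _ (by linarith), ENNReal.mul_rpow_of_nonneg _ _ (by linarith)]
    have : X ^ (1-ε/3) = X ^ (2/3-ε/2 + (1/3-ε/6)) * (X ^ (ε/6) * X ^ (ε/6)) := by
      rw [← ENNReal.rpow_add_of_nonneg _ _ (by linarith) (by linarith), ← ENNReal.rpow_add_of_nonneg _ _ (by linarith) (by linarith)]
      congr 1; ring
    rw [this, show 2/3-ε/2 + (1/3-ε/6) = 1-2*ε/3 by ring]
    ring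
  rw [e1] at key
  let A : E3 × E3 → ℝ≥0∞ := fun z => kerB (2*s) z.1 z.2 * (f z.1 ^ (2-ε) * (f z.2 * (I z.1 * I z.2 * ‖v z.1 - v z.2‖ₑ ^ ε)))
  have hA : Measurable A := by
    have b1 : Measurable (fun z : E3 × E3 => f z.1 ^ (2-ε)) := (hf.comp measurable_fst).pow_const _
    exact hk.mul (b1.mul ((hf.comp measurable_snd).mul (((hIm.comp measurable_fst).mul (hIm.comp measurable_snd)).mul (hn.pow_const _))))
  have hIp : ∀ x {t : ℝ}, 0 < t → I x ^ t = I x := by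
    intro x t ht
    simp only [hI, indicator]; split_ifs <;> simp [ht]
  have hAle : ∫⁻ z, A z ≤ X ^ (1-ε/3) * V ^ (1-2*ε/3) * D ^ (ε/2) := by
    refine le_trans (le_of_eq ?_) key
    refine lintegral_congr fun z => ?_
    simp only [A, d]
    rw [ENNReal.mul_rpow_of_nonneg _ _ (by linarith), ENNReal.mul_rpow_of_nonneg _ _ (by linarith), ENNReal.mul_rpow_of_nonneg _ _ (by linarith), ENNReal.mul_rpow_of_nonneg _ _ (by linarith), ENNReal.mul_rpow_of_nonneg _ _ (by linarith), ENNReal.mul_rpow_of_nonneg _ _ (by linarith),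
      kerB_rpow (by linarith), kerB_rpow (by linarith), kerB_rpow (by linarith), hIp _ (by linarith), hIp _ (by linarith)]
    simp only [← ENNReal.rpow_mul]
    rw [show 2*(ε/2) = ε by ring]
    have c1 : f z.1 ^ (2-ε) = f z.1 ^ (3*(2/3-ε/2)) * f z.1 ^ (3*(ε/6)) := by
      rw [← ENNReal.rpow_add_of_nonneg _ _ (by linarith) (by linarith)]; congr 1; ring
    have c2 : f z.2 = f z.2 ^ (3*(1/3-ε/6)) * f z.2 ^ (3*(ε/6)) := by
      rw [← ENNReal.rpow_add_of_nonneg _ _ (by linarith) (by linarith), show 3*(1/3-ε/6) + 3*(ε/6) = 1 by ring, ENNReal.rpow_one]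
    have c3 : kerB (2*s) z.1 z.2 = kerB (2*s) z.1 z.2 * kerB (2*s) z.1 z.2 := by
      unfold kerB; split_ifs <;> simp
    rw [c1]
    have c4 : kerB (2*s) z.1 z.2 = kerB (2*s) z.1 z.2 * kerB (2*s) z.1 z.2 * kerB (2*s) z.1 z.2 := by
      unfold kerB; split_ifs <;> simp
    calc _ = (kerB (2*s) z.1 z.2 * kerB (2*s) z.1 z.2 * kerB (2*s) z.1 z.2) * (f z.1 ^ (3*(2/3-ε/2)) * f z.1 ^ (3*(ε/6)) * ((f z.2 ^ (3*(1/3-ε/6)) * f z.2 ^ (3*(ε/6))) * (I z.1 * I z.2 * ‖v z.1 - v z.2‖ₑ ^ ε))) := by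
          rw [← c2, ← c4]
      _ = _ := by ring
  have hpt : ∀ y x, kerB (2*s) y x * (f y * (f x * ‖v x - v y‖ₑ)) ≤ A (y, x) + A (x, y) := by
    intro y x
    simp only [A]
    by_cases hy : y ∈ ball (0:E3) ρ
    swap
    · have : f y = 0 := by rw [hfd]; exact indicator_of_notMem hy _
      simp [this]
    by_cases hx : x ∈ ball (0:E3) ρ
    swap
    · have : f x = 0 := by rw [hfd]; exact indicator_of_notMem hx _
      simp [this]
    have y1 : I y = 1 := indicator_of_mem hy _
    have x1 : I x = 1 := indicator_of_mem hx _
    have fy : f y = ‖v y‖ₑ := indicator_of_mem hy _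
    have fx : f x = ‖v x‖ₑ := indicator_of_mem hx _
    rw [y1, x1, kerB_symm (2*s) x y, ← mul_add]
    gcongr
    rw [show ‖v y - v x‖ₑ = ‖v x - v y‖ₑ by rw [← neg_sub, enorm_neg]]
    have d1 : ‖v x - v y‖ₑ ≤ f x + f y := by rw [fx, fy]; exact enorm_sub_le
    have d2 : ‖v x - v y‖ₑ ≤ (f x ^ (1-ε) + f y ^ (1-ε)) * ‖v x - v y‖ₑ ^ ε := by
      calc ‖v x - v y‖ₑ = ‖v x - v y‖ₑ ^ (1-ε) * ‖v x - v y‖ₑ ^ ε := by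
            rw [← ENNReal.rpow_add_of_nonneg _ _ (by linarith) (by linarith)]; simp
        _ ≤ _ := by
            gcongr
            exact (ENNReal.rpow_le_rpow d1 (by linarith)).trans (ENNReal.rpow_add_le_add_rpow _ _ (by linarith) (by linarith))
    have d3 : ∀ a : ℝ≥0∞, a ^ (2-ε) = a * a ^ (1-ε) := by
      intro a
      conv_rhs => enter [1]; rw [← ENNReal.rpow_one a]
      rw [← ENNReal.rpow_add_of_nonneg _ _ (by linarith) (by linarith)]; congr 1; ring
    rw [d3, d3]
    calc f y * (f x * ‖v x - v y‖ₑ) ≤ f y * (f x * ((f x ^ (1-ε) + f y ^ (1-ε)) * ‖v x - v y‖ₑ ^ ε)) := by gcongr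
      _ = _ := by ring
  have hAy : ∀ y, Measurable fun x => A (y, x) := fun y => hA.comp measurable_prodMk_left
  calc _ ≤ ∫⁻ y, ∫⁻ x, (A (y,x) + A (x,y)) := lintegral_mono fun y => lintegral_mono fun x => hpt y x
    _ = (∫⁻ y, ∫⁻ x, A (y,x)) + ∫⁻ y, ∫⁻ x, A (x,y) := by
        simp only [lintegral_add_left (hAy _)]
        rw [lintegral_add_left]
        exact hA.lintegral_prod_right'
    _ = 2 * ∫⁻ z, A z := by rw [← lp2 hA, ← lp2' hA]; ring
    _ ≤ _ := by gcongr

end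

section

lemma scl_int (ω : E3 → ℝ) {s : ℝ} (hs : 0 < s) (y : E3) : ∫ x, scl ω s y x = s ^ 3 * ∫ x, ω x := by
  unfold scl
  rw [integral_sub_right_eq_self (fun x => ω (s⁻¹ • x)) y, Measure.integral_comp_inv_smul]
  simp [abs_of_pos hs]

lemma press_leb {π : E3 → ℝ} (hi : Integrable π (volume.restrict B1)) {ω : E3 → ℝ} (hω : Continuous ω)
    (hz : ∀ x, 1 ≤ ‖x‖ → ω x = 0) {M : ℝ} (hM : ∀ x, |ω x| ≤ M) {δ : ℝ} (hδ : 0 < δ) :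
    ∀ᵐ y : E3, ‖y‖ < 1 → Tendsto (fun k : ℕ => ((δ/2^k)^3)⁻¹ * ∫ x in B1, π x * scl ω (δ/2^k) y x) atTop (nhds ((∫ x, ω x) * π y)) := by
  have hFi : Integrable (B1.indicator π) := (integrable_indicator_iff measurableSet_ball).2 hi
  have hlim : Tendsto (fun k : ℕ => δ/2^k) atTop (nhds 0) := by
    have := (tendsto_pow_atTop_nhds_zero_of_lt_one (r := (1/2:ℝ)) (by norm_num) (by norm_num)).const_mul δ
    simpa [div_eq_mul_inv] using this
  have hM0 : 0 ≤ M := (abs_nonneg _).trans (hM 0)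
  filter_upwards [IsUnifLocDoublingMeasure.ae_tendsto_average_norm_sub (μ := (volume : Measure E3)) hFi.locallyIntegrable 1] with y hy hy1
  have h1 := hy (fun _ : ℕ => y) (fun k : ℕ => δ/2^k) (by
      rw [tendsto_nhdsWithin_iff]
      exact ⟨hlim, Eventually.of_forall fun k => by simp; positivity⟩) (Eventually.of_forall fun k => by simp; positivity)
  have hFy : B1.indicator π y = π y := indicator_of_mem (by simpa using hy1) _
  rw [hFy] at h1
  set F := B1.indicator π with hF
  rw [tendsto_iff_norm_sub_tendsto_zero]
  have h2 := h1.const_mul (M * (volume (closedBall (0:E3) 1)).toReal)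
  rw [mul_zero] at h2
  refine squeeze_zero (fun _ => norm_nonneg _) (fun k => ?_) h2
  set s := δ/2^k with hs'
  have hs : 0 < s := by positivity
  have hsc : Continuous (scl ω s y) := by unfold scl; fun_prop
  have hout : ∀ x, x ∉ closedBall y s → scl ω s y x = 0 := by
    intro x hx
    apply hz
    rw [norm_smul, Real.norm_of_nonneg (by positivity), ← div_eq_inv_mul, le_div_iff₀ hs, one_mul, ← dist_eq_norm]
    simp at hx; exact hx.le
  have hsi : Integrable (scl ω s y) := hsc.integrable_of_hasCompactSupport (HasCompactSupport.intro (isCompact_closedBall y s) hout)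
  have e1 : ∫ x in B1, π x * scl ω s y x = ∫ x, F x * scl ω s y x := by
    rw [← integral_indicator measurableSet_ball]
    refine integral_congr_ae (Eventually.of_forall fun x => ?_)
    simp only [hF, indicator]; split_ifs <;> simp
  have hFs : Integrable (fun x => F x * scl ω s y x) := hFi.mul_bdd (c := M) hsc.aestronglyMeasurable (Eventually.of_forall fun x => hM _)
  have e2 : (s^3)⁻¹ * (∫ x, F x * scl ω s y x) - (∫ x, ω x) * π y = (s^3)⁻¹ * ∫ x, (F x - π y) * scl ω s y x := by
    have : ∫ x, (F x - π y) * scl ω s y x = (∫ x, F x * scl ω s y x) - ∫ x, π y * scl ω s y x := by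
      rw [← integral_sub hFs (hsi.const_mul _)]
      refine integral_congr_ae (Eventually.of_forall fun x => ?_)
      simp only; ring
    rw [this, integral_const_mul, scl_int ω hs]
    field_simp
  rw [e1, e2, norm_mul, Real.norm_of_nonneg (by positivity)]
  have hFc : IntegrableOn (fun x => ‖F x - π y‖) (closedBall y s) :=
    (hFi.integrableOn.sub (integrableOn_const measure_closedBall_lt_top.ne)).norm
  have e3 : ‖∫ x, (F x - π y) * scl ω s y x‖ ≤ M * ∫ x in closedBall y s, ‖F x - π y‖ := by
    rw [← integral_const_mul, ← integral_indicator measurableSet_closedBall]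
    refine norm_integral_le_of_norm_le ((integrable_indicator_iff measurableSet_closedBall).2 (hFc.const_mul M)) (Eventually.of_forall fun x => ?_)
    by_cases hx : x ∈ closedBall y s
    · rw [indicator_of_mem hx, norm_mul, mul_comm]
      exact mul_le_mul_of_nonneg_right (hM _) (norm_nonneg _)
    · rw [indicator_of_notMem hx, hout x hx]; simp
  have e4 : ∫ x in closedBall y s, ‖F x - π y‖ = s^3 * (volume (closedBall (0:E3) 1)).toReal * ⨍ x in closedBall y s, ‖F x - π y‖ := by
    rw [setAverage_eq]
    have : volume.real (closedBall y s) = s^3 * (volume (closedBall (0:E3) 1)).toReal := by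
      rw [Measure.real, Measure.addHaar_closedBall' _ _ hs.le]
      simp [hs.le]
    rw [this, smul_eq_mul, ← mul_assoc, mul_inv_cancel₀, one_mul]
    have : 0 < (volume (closedBall (0:E3) 1)).toReal := ENNReal.toReal_pos (measure_closedBall_pos _ _ one_pos).ne' measure_closedBall_lt_top.ne
    positivity
  rw [e4] at e3
  calc _ ≤ (s^3)⁻¹ * (M * (s^3 * (volume (closedBall (0:E3) 1)).toReal * ⨍ x in closedBall y s, ‖F x - π y‖)) := by gcongr
    _ = _ := by field_simp

end

section
section p5c
variable {u : E3 → ℝ → E3} {P : E3 → ℝ → ℝ}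

lemma enorm_seq_le (h : ℕ → ℝ) (n : ℕ) : ‖h n‖ₑ ≤ ‖h 0‖ₑ + ∑' k, ‖h (k+1) - h k‖ₑ := by
  have : ‖h n‖ₑ ≤ ‖h 0‖ₑ + ∑ k ∈ Finset.range n, ‖h (k+1) - h k‖ₑ := by
    induction n with
    | zero => simp
    | succ n ih =>
      rw [Finset.sum_range_succ, ← add_assoc]
      calc ‖h (n+1)‖ₑ = ‖h n + (h (n+1) - h n)‖ₑ := by congr 1; ring
        _ ≤ ‖h n‖ₑ + ‖h (n+1) - h n‖ₑ := enorm_add_le _ _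
        _ ≤ _ := by gcongr
  refine this.trans ?_
  gcongr
  exact ENNReal.sum_le_tsum _

def pker (u : E3 → ℝ → E3) (δ : ℝ) (k : ℕ) (y : E3) (t : ℝ) : ℝ≥0∞ :=
  ENNReal.ofReal (δ/2^k) ^ (-3:ℝ) * ∫⁻ x in B1, kerB (2*(δ/2^k)) y x * (‖u x t‖ₑ * ‖u x t - u y t‖ₑ)

lemma ofReal_inv3 {s : ℝ} (hs : 0 < s) : ‖(s^3)⁻¹‖ₑ = ENNReal.ofReal s ^ (-3:ℝ) := by
  rw [← ofReal_norm, Real.norm_of_nonneg (by positivity), ENNReal.ofReal_rpow_of_pos hs, Real.rpow_neg hs.le]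
  norm_cast

lemma press_pt : ∃ C : ℝ≥0∞, C ≠ ∞ ∧ ∀ (u : E3 → ℝ → E3) (P : E3 → ℝ → ℝ) (_ : SuitableWeakSolution 1 u P) (δ : ℝ), 0 < δ →
    ∀ᵐ t : ℝ, t ∈ T1 → ∀ᵐ y : E3, ‖y‖ + δ < 1 → ‖P y t‖ₑ ≤ C * (ENNReal.ofReal δ ^ (-3:ℝ) * (∫⁻ x in B1, ‖P x t‖ₑ) + ∑' k, pker u δ k y t) := by
  obtain ⟨ω, ρ, hω, hρ, hω0, hωz, hρz, hωi, hlap⟩ := kernel_exists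
  obtain ⟨M0, hM0⟩ := cont_bdd hω (fun x hx => hωz x hx.le)
  have hM' : ∀ i j, ∃ C, ∀ x, |pd i (pd j ρ) x| ≤ C := fun i j =>
    cont_bdd (pd_smooth (pd_smooth hρ j) i).continuous (pd_zero_out (pd_zero_out (fun z hz => hρz z hz.le) j) i)
  choose Mij hMij using hM'
  set M : ℝ := ∑ i, ∑ j, |Mij i j| with hMd
  have hM : ∀ i j x, |pd i (pd j ρ) x| ≤ M := by
    intro i j x
    refine (hMij i j x).trans ((le_abs_self _).trans ?_)
    refine (Finset.single_le_sum (f := fun j => |Mij i j|) (fun j _ => abs_nonneg _) (Finset.mem_univ j)).trans ?_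
    exact Finset.single_le_sum (f := fun i => ∑ j, |Mij i j|) (fun i _ => Finset.sum_nonneg fun j _ => abs_nonneg _) (Finset.mem_univ i)
  set c0 := ∫ x, ω x with hc0
  refine ⟨ENNReal.ofReal c0⁻¹ * (ENNReal.ofReal M0 + ENNReal.ofReal (9*M)), ENNReal.mul_ne_top ENNReal.ofReal_ne_top (ENNReal.add_ne_top.2 ⟨ENNReal.ofReal_ne_top, ENNReal.ofReal_ne_top⟩), ?_⟩
  intro u P sol δ hδ
  have hK : ∀ᵐ t : ℝ, ∀ k : ℕ, t ∈ T1 → ∀ᵐ y : E3, ‖y‖ + δ/2^k < 1 → ‖∫ x in B1, P x t * scl (lap ρ) (δ/2^k) y x‖ₑ ≤ ENNReal.ofReal (9 * M) *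
      ∫⁻ x in B1, kerB (2*(δ/2^k)) y x * (‖u x t‖ₑ * ‖u x t - u y t‖ₑ) :=
    ae_all_iff.2 fun k => K_slice sol hρ hρz hM (by positivity)
  have hPi : ∀ᵐ t : ℝ, t ∈ T1 → Integrable (fun x => P x t) (volume.restrict B1) := by
    have := P_int sol
    rw [Q1_vol] at this
    exact (ae_restrict_iff' measurableSet_Ioo).1 this.prod_left_ae
  filter_upwards [hK, hPi] with t hK hPi ht
  have hπ := hPi ht
  have hK2 : ∀ᵐ y : E3, ∀ k : ℕ, ‖y‖ + δ/2^k < 1 → ‖∫ x in B1, P x t * scl (lap ρ) (δ/2^k) y x‖ₑ ≤ ENNReal.ofReal (9 * M) *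
      ∫⁻ x in B1, kerB (2*(δ/2^k)) y x * (‖u x t‖ₑ * ‖u x t - u y t‖ₑ) := ae_all_iff.2 fun k => hK k ht
  filter_upwards [hK2, press_leb hπ hω hωz hM0 hδ] with y hK3 hlim hy
  have hlim := hlim (by linarith)
  set h : ℕ → ℝ := fun k => ((δ/2^k)^3)⁻¹ * ∫ x in B1, P x t * scl ω (δ/2^k) y x with hh
  have hinteg : ∀ k : ℕ, Integrable (fun x => P x t * scl ω (δ/2^k) y x) (volume.restrict B1) := by
    intro k
    have hsc : Continuous (scl ω (δ/2^k) y) := by unfold scl; fun_prop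
    exact hπ.mul_bdd (c := M0) hsc.aestronglyMeasurable (Eventually.of_forall fun x => hM0 _)
  have hdiff : ∀ k, h (k+1) - h k = ((δ/2^k)^3)⁻¹ * ∫ x in B1, P x t * scl (lap ρ) (δ/2^k) y x := by
    intro k
    set s := δ/2^k with hs
    have hs1 : δ/2^(k+1) = s/2 := by rw [hs, pow_succ]; field_simp
    have hs0 : 0 < s := by positivity
    have i1 := hinteg (k+1)
    have i2 := hinteg k
    simp only [hh, hs1]
    rw [hs1] at i1
    rw [← hs] at i2 ⊢
    rw [← integral_const_mul, ← integral_const_mul, ← integral_const_mul, ← integral_sub (i1.const_mul _) (i2.const_mul _)]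
    refine integral_congr_ae (Eventually.of_forall fun x => ?_)
    simp only [scl]
    rw [hlap, show (s/2)⁻¹ • (x - y) = (2:ℝ) • s⁻¹ • (x - y) by rw [smul_smul]; congr 1; field_simp]
    field_simp
    ring
  have hle : ∀ k, ‖h (k+1) - h k‖ₑ ≤ ENNReal.ofReal (9*M) * pker u δ k y t := by
    intro k
    rw [hdiff, enorm_mul, ofReal_inv3 (by positivity)]
    unfold pker
    rw [mul_left_comm]
    gcongr
    refine hK3 k (lt_of_le_of_lt ?_ hy)
    have : δ/2^k ≤ δ := div_le_self hδ.le (one_le_pow₀ (by norm_num))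
    linarith
  have h00 : ‖h 0‖ₑ ≤ ENNReal.ofReal M0 * (ENNReal.ofReal δ ^ (-3:ℝ) * ∫⁻ x in B1, ‖P x t‖ₑ) := by
    simp only [hh, pow_zero, div_one]
    rw [enorm_mul, ofReal_inv3 hδ, mul_left_comm]
    gcongr
    refine (enorm_integral_le_lintegral_enorm _).trans ?_
    rw [← lintegral_const_mul' _ _ ENNReal.ofReal_ne_top]
    refine lintegral_mono fun x => ?_
    rw [enorm_mul, mul_comm]
    gcongr
    rw [← ofReal_norm]
    exact ENNReal.ofReal_le_ofReal (hM0 _)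
  have hfin : ‖c0 * P y t‖ₑ ≤ ENNReal.ofReal M0 * (ENNReal.ofReal δ ^ (-3:ℝ) * ∫⁻ x in B1, ‖P x t‖ₑ) + ENNReal.ofReal (9*M) * ∑' k, pker u δ k y t := by
    refine le_of_tendsto ((continuous_enorm.tendsto _).comp hlim) (Eventually.of_forall fun n => ?_)
    refine (enorm_seq_le h n).trans ?_
    gcongr
    rw [← ENNReal.tsum_mul_left]
    exact ENNReal.tsum_le_tsum hle
  calc ‖P y t‖ₑ = ENNReal.ofReal c0⁻¹ * ‖c0 * P y t‖ₑ := by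
        rw [enorm_mul, ← mul_assoc, ← ofReal_norm c0, Real.norm_of_nonneg hωi.le, ← ENNReal.ofReal_mul (by positivity), inv_mul_cancel₀ hωi.ne']
        simp
    _ ≤ ENNReal.ofReal c0⁻¹ * (ENNReal.ofReal M0 * (ENNReal.ofReal δ ^ (-3:ℝ) * ∫⁻ x in B1, ‖P x t‖ₑ) + ENNReal.ofReal (9*M) * ∑' k, pker u δ k y t) := by gcongr
    _ ≤ _ := by
        rw [mul_assoc]
        gcongr
        rw [mul_add]
        gcongr
        · exact le_self_add
        · exact le_add_self
end p5c

end

section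
section p5d

lemma scal2 {σ V : ℝ≥0∞} (h0 : σ ≠ 0) (h1 : σ ≠ ∞) (hV0 : V ≠ 0) (hV1 : V ≠ ∞) {ε : ℝ} (he : 0 < ε) (he1 : ε < 1) :
    σ ^ (-3:ℝ) * (((2*σ) ^ (3:ℝ) * V) ^ (1-2*ε/3) * ((2*σ) ^ (2:ℝ) * ((2*σ) ^ (3:ℝ) * V)) ^ (ε/2)) = 2 ^ (3+ε/2) * V ^ (1-ε/6) * σ ^ (ε/2) := by
  have t0 : (2*σ) ≠ 0 := by simp [h0]
  have t1 : (2*σ) ≠ ∞ := ENNReal.mul_ne_top (by norm_num) h1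
  rw [ENNReal.mul_rpow_of_nonneg ((2*σ) ^ (3:ℝ)) V (by linarith : (0:ℝ) ≤ 1-2*ε/3), ENNReal.mul_rpow_of_nonneg ((2*σ) ^ (2:ℝ)) _ (by linarith), ENNReal.mul_rpow_of_nonneg ((2*σ) ^ (3:ℝ)) V (by linarith : (0:ℝ) ≤ ε/2)]
  simp only [← ENNReal.rpow_mul]
  have e1 : V ^ (1-ε/6) = V ^ (1-2*ε/3) * V ^ (ε/2) := by
    rw [← ENNReal.rpow_add _ _ hV0 hV1]; congr 1; ring
  have e2 : (2*σ) ^ (3*(1-2*ε/3)) * (2*σ) ^ (2*(ε/2)) * (2*σ) ^ (3*(ε/2)) = 2 ^ (3+ε/2) * σ ^ (3+ε/2) := by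
    rw [← ENNReal.rpow_add _ _ t0 t1, ← ENNReal.rpow_add _ _ t0 t1, ← ENNReal.mul_rpow_of_nonneg _ _ (by linarith)]
    congr 1; ring
  have e3 : σ ^ (-3:ℝ) * σ ^ (3+ε/2) = σ ^ (ε/2) := by
    rw [← ENNReal.rpow_add _ _ h0 h1]; congr 1; ring
  rw [e1, ← e3]
  calc _ = σ ^ (-3:ℝ) * (V ^ (1-2*ε/3) * V ^ (ε/2)) * ((2*σ) ^ (3*(1-2*ε/3)) * (2*σ) ^ (2*(ε/2)) * (2*σ) ^ (3*(ε/2))) := by ring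
    _ = _ := by rw [e2]; ring

lemma press_slice {ε : ℝ} (he : 0 < ε) (he1 : ε < 1) : ∃ C : ℝ≥0∞, C ≠ ∞ ∧ ∀ (u : E3 → ℝ → E3) (P : E3 → ℝ → ℝ) (sol : SuitableWeakSolution 1 u P) (δ ρ1 ρ2 : ℝ),
    0 < δ → δ ≤ 1 → ρ1 + 2*δ ≤ ρ2 → ρ2 ≤ 1 → 
    ∀ᵐ t : ℝ, t ∈ T1 → ∫⁻ y in ball 0 ρ1, ‖P y t‖ₑ * ‖u y t‖ₑ ≤ C * (ENNReal.ofReal δ ^ (-3:ℝ) * ((∫⁻ x in B1, ‖P x t‖ₑ) * ∫⁻ x in ball 0 ρ1, ‖u x t‖ₑ)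
      + (∫⁻ x in ball 0 ρ2, ‖u x t‖ₑ ^ (3:ℝ)) ^ (1-ε/3) * (∫⁻ x in ball 0 ρ2, Gr (sol.gu x t)) ^ (ε/2)) := by
  obtain ⟨C, hC, H⟩ := press_pt
  obtain ⟨S, hS, hS'⟩ := geo_sum (β := ε/2) (by linarith)
  have hV : VB 1 ^ (1-ε/6) ≠ ∞ := ENNReal.rpow_ne_top_of_ne_zero (VB_pos one_pos) VB_fin
  have h2 : (2:ℝ≥0∞) ^ (3+ε/2) ≠ ∞ := ENNReal.rpow_ne_top_of_ne_zero (by norm_num) (by norm_num)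
  set c := 2 * (2 ^ (3+ε/2) * VB 1 ^ (1-ε/6)) * S with hc
  refine ⟨C * (1 + c), ENNReal.mul_ne_top hC (ENNReal.add_ne_top.2 ⟨by norm_num, ENNReal.mul_ne_top (ENNReal.mul_ne_top (by norm_num) (ENNReal.mul_ne_top h2 hV)) hS⟩), ?_⟩
  intro u P sol δ ρ1 ρ2 hδ hδ1 hρ hρ2
  filter_upwards [H u P sol δ hδ, D_slice sol] with t hP hD ht
  have hP := hP ht
  have hD := hD ht
  set v : E3 → E3 := fun x => u x t with hv'
  have hv : Measurable v := u_comp sol measurable_id measurable_const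
  set X := ∫⁻ x in ball 0 ρ2, ‖u x t‖ₑ ^ (3:ℝ) with hX
  set G := ∫⁻ x in ball 0 ρ2, Gr (sol.gu x t) with hG
  have hX' : ∫⁻ x, fB ρ2 v x ^ (3:ℝ) = X := by
    rw [hX, ← lintegral_indicator measurableSet_ball]
    refine lintegral_congr fun x => ?_
    simp only [fB, indicator]; split_ifs <;> simp [hv']
  have hkm : ∀ k, Measurable fun y => pker u δ k y t := by
    intro k
    unfold pker
    refine Measurable.const_mul ?_ _
    refine Measurable.lintegral_prod_right' (ν := volume.restrict B1) (f := fun q : E3 × E3 => kerB (2*(δ/2^k)) q.1 q.2 * (‖v q.2‖ₑ * ‖v q.2 - v q.1‖ₑ)) ?_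
    exact (kerB_meas _).mul ((hv.comp measurable_snd).enorm.mul ((hv.comp measurable_snd).sub (hv.comp measurable_fst)).enorm)
  have hterm : ∀ k : ℕ, ∫⁻ y in ball 0 ρ1, pker u δ k y t * ‖u y t‖ₑ ≤ 2 * (2 ^ (3+ε/2) * VB 1 ^ (1-ε/6)) * ENNReal.ofReal (δ/2^k) ^ (ε/2) * (X ^ (1-ε/3) * G ^ (ε/2)) := by
    intro k
    have hsδ : δ/2^k ≤ δ := div_le_self hδ.le (one_le_pow₀ (by norm_num))
    set s := δ/2^k with hs
    have hs0 : 0 < s := by positivity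
    have b1 : ∫⁻ y in ball 0 ρ1, pker u δ k y t * ‖u y t‖ₑ ≤ ENNReal.ofReal s ^ (-3:ℝ) * ∫⁻ y, ∫⁻ x, kerB (2*s) y x * (fB ρ2 v y * (fB ρ2 v x * ‖v x - v y‖ₑ)) := by
      rw [← lintegral_const_mul' _ _ (ENNReal.rpow_ne_top_of_ne_zero (by simp [hs0]) (by simp)), ← lintegral_indicator measurableSet_ball]
      refine lintegral_mono fun y => ?_
      by_cases hy : y ∈ ball (0:E3) ρ1
      swap
      · rw [indicator_of_notMem hy]; exact zero_le
      rw [indicator_of_mem hy]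
      have hy2 : ‖y‖ < ρ1 := by simpa using hy
      unfold pker
      rw [← hs, mul_assoc, ← lintegral_mul_const', ← lintegral_indicator measurableSet_ball]
      swap
      · simp
      gcongr with x
      by_cases hx : x ∈ B1
      swap
      · rw [indicator_of_notMem hx]; exact zero_le
      rw [indicator_of_mem hx]
      by_cases hxy : dist y x < 2*s
      · have f1 : fB ρ2 v y = ‖u y t‖ₑ := indicator_of_mem (by simp; linarith) _
        have f2 : fB ρ2 v x = ‖u x t‖ₑ := indicator_of_mem (inB (by linarith) hy2 hxy) _
        rw [f1, f2]
        apply le_of_eq; simp only [hv']; ring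
      · simp [kerB, hxy]
    refine b1.trans ?_
    have b2 := T_bound (ρ := ρ2) (s := s) he he1 hv
    rw [hX'] at b2
    have b3 := hD ρ2 s hρ2 hs0
    have e1 : ENNReal.ofReal (2*s) = 2 * ENNReal.ofReal s := by rw [ENNReal.ofReal_mul (by norm_num)]; simp
    rw [VB_eq (s := 2*s) (by positivity), e1] at b2 b3
    set σ := ENNReal.ofReal s with hσ
    calc _ ≤ σ ^ (-3:ℝ) * (2 * (X ^ (1-ε/3) * ((2*σ) ^ (3:ℝ) * VB 1) ^ (1-2*ε/3) * ((2*σ) ^ (2:ℝ) * ((2*σ) ^ (3:ℝ) * VB 1 * G)) ^ (ε/2))) := by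
          gcongr
          refine b2.trans ?_
          gcongr
      _ = 2 * (σ ^ (-3:ℝ) * (((2*σ) ^ (3:ℝ) * VB 1) ^ (1-2*ε/3) * ((2*σ) ^ (2:ℝ) * ((2*σ) ^ (3:ℝ) * VB 1)) ^ (ε/2))) * (X ^ (1-ε/3) * G ^ (ε/2)) := by
          rw [show (2*σ) ^ (2:ℝ) * ((2*σ) ^ (3:ℝ) * VB 1 * G) = ((2*σ) ^ (2:ℝ) * ((2*σ) ^ (3:ℝ) * VB 1)) * G by ring, ENNReal.mul_rpow_of_nonneg _ G (by linarith)]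
          ring
      _ = _ := by
          rw [scal2 (by simp [hσ, hs0]) (by simp [hσ]) (VB_pos one_pos) VB_fin he he1]
          ring
  have hsum : ∫⁻ y in ball 0 ρ1, (∑' k, pker u δ k y t) * ‖u y t‖ₑ ≤ c * (X ^ (1-ε/3) * G ^ (ε/2)) := by
    simp only [← ENNReal.tsum_mul_right]
    rw [lintegral_tsum (f := fun k y => pker u δ k y t * ‖u y t‖ₑ) fun k => ((hkm k).mul hv.enorm).aemeasurable]
    calc _ ≤ ∑' k : ℕ, 2 * (2 ^ (3+ε/2) * VB 1 ^ (1-ε/6)) * ENNReal.ofReal (δ/2^k) ^ (ε/2) * (X ^ (1-ε/3) * G ^ (ε/2)) := ENNReal.tsum_le_tsum hterm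
      _ ≤ _ := by
        rw [ENNReal.tsum_mul_right, ENNReal.tsum_mul_left, hc]
        gcongr
        exact hS' δ hδ hδ1
  calc ∫⁻ y in ball 0 ρ1, ‖P y t‖ₑ * ‖u y t‖ₑ ≤ ∫⁻ y in ball 0 ρ1, C * (ENNReal.ofReal δ ^ (-3:ℝ) * (∫⁻ x in B1, ‖P x t‖ₑ) * ‖u y t‖ₑ + (∑' k, pker u δ k y t) * ‖u y t‖ₑ) := by
        refine lintegral_mono_ae ?_
        rw [ae_restrict_iff' measurableSet_ball]
        filter_upwards [hP] with y hP hy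
        rw [← add_mul, ← mul_assoc]
        gcongr
        refine hP ?_
        have : ‖y‖ < ρ1 := by simpa using hy
        linarith
    _ = C * (ENNReal.ofReal δ ^ (-3:ℝ) * ((∫⁻ x in B1, ‖P x t‖ₑ) * ∫⁻ x in ball 0 ρ1, ‖u x t‖ₑ) + ∫⁻ y in ball 0 ρ1, (∑' k, pker u δ k y t) * ‖u y t‖ₑ) := by
        rw [lintegral_const_mul' _ _ hC, lintegral_add_left (hv.enorm.const_mul _), lintegral_const_mul _ hv.enorm, mul_assoc]
    _ ≤ C * (ENNReal.ofReal δ ^ (-3:ℝ) * ((∫⁻ x in B1, ‖P x t‖ₑ) * ∫⁻ x in ball 0 ρ1, ‖u x t‖ₑ) + c * (X ^ (1-ε/3) * G ^ (ε/2))) := by gcongr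
    _ ≤ _ := by
        clear_value c
        rw [mul_assoc C (1+c), add_mul, one_mul, mul_add c]
        gcongr C * ?_
        set a := ENNReal.ofReal δ ^ (-3:ℝ) * ((∫⁻ x in B1, ‖P x t‖ₑ) * ∫⁻ x in ball 0 ρ1, ‖u x t‖ₑ)
        set b := X ^ (1-ε/3) * G ^ (ε/2)
        calc a + c * b ≤ (a + c * b) + (b + c * a) := le_self_add
          _ = _ := by ring
end p5d

end

section

section cut

lemma st_smooth : ContDiff ℝ (⊤:ℕ∞) Real.smoothTransition := Real.smoothTransition.contDiff

lemma st_d_smooth : ContDiff ℝ (⊤:ℕ∞) (deriv Real.smoothTransition) := by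
  have := st_smooth
  exact (contDiff_infty_iff_deriv.1 this).2

lemma st_d_zero {x : ℝ} (h : x < 0) : deriv Real.smoothTransition x = 0 := by
  have : Real.smoothTransition =ᶠ[nhds x] fun _ => 0 := by
    filter_upwards [Iio_mem_nhds h] with y hy using Real.smoothTransition.zero_of_nonpos (le_of_lt hy)
  rw [this.deriv_eq]; simp

lemma st_d_one {x : ℝ} (h : 1 < x) : deriv Real.smoothTransition x = 0 := by
  have : Real.smoothTransition =ᶠ[nhds x] fun _ => 1 := by
    filter_upwards [Ioi_mem_nhds h] with y hy using Real.smoothTransition.one_of_one_le (le_of_lt hy)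
  rw [this.deriv_eq]; simp

lemma st_dd_zero {x : ℝ} (h : x < 0) : deriv (deriv Real.smoothTransition) x = 0 := by
  have : deriv Real.smoothTransition =ᶠ[nhds x] fun _ => 0 := by
    filter_upwards [Iio_mem_nhds h] with y hy using st_d_zero hy
  rw [this.deriv_eq]; simp

lemma st_bdd : ∃ S : ℝ, 1 ≤ S ∧ ∀ x, |deriv Real.smoothTransition x| ≤ S ∧ |deriv (deriv Real.smoothTransition) x| ≤ S := by
  have hc : HasCompactSupport (deriv Real.smoothTransition) := by
    refine HasCompactSupport.intro (K := Icc (0:ℝ) 1) isCompact_Icc fun x hx => ?_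
    rw [mem_Icc, not_and_or, not_le, not_le] at hx
    rcases hx with h | h
    · exact st_d_zero h
    · exact st_d_one h
  obtain ⟨A, hA⟩ := hc.exists_bound_of_continuous st_d_smooth.continuous
  obtain ⟨B, hB⟩ := hc.deriv.exists_bound_of_continuous (st_d_smooth.continuous_deriv (by simp))
  refine ⟨max 1 (max A B), le_max_left _ _, fun x => ⟨?_, ?_⟩⟩
  · exact (hA x).trans ((le_max_left _ _).trans (le_max_right _ _))
  · exact (hB x).trans ((le_max_right _ _).trans (le_max_right _ _))

def sf (b c : ℝ) (x : E3) : ℝ := b * (c - ‖x‖^2)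

def dq (b : ℝ) (x : E3) : E3 →L[ℝ] ℝ := (-2*b) • (innerSL ℝ x)

lemma sf_hasF (b c : ℝ) (x : E3) : HasFDerivAt (sf b c) (dq b x) x := by
  unfold sf
  have h := (hasStrictFDerivAt_norm_sq x).hasFDerivAt
  have h2 := (h.const_sub c).const_mul b
  have e : dq b x = b • -(2 • (innerSL ℝ x : E3 →L[ℝ] ℝ)) := by
    apply ContinuousLinearMap.ext
    intro y
    simp [dq]
    ring
  rw [e]
  exact h2

lemma sf_pd {h : ℝ → ℝ} {b c : ℝ} {x : E3} (hd : DifferentiableAt ℝ h (sf b c x)) (i : Fin 3) :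
    HasFDerivAt (fun y => h (sf b c y)) ((deriv h (sf b c x)) • (dq b x)) x :=
  hd.hasDerivAt.comp_hasFDerivAt x (sf_hasF b c x)

lemma sf_app (b : ℝ) (x : E3) (i : Fin 3) : (dq b x) (EuclideanSpace.single i (1:ℝ)) = -2*b * x i := by
  simp [dq, EuclideanSpace.inner_single_right]

lemma psi_pd (b c : ℝ) (i : Fin 3) : pd i (fun y => Real.smoothTransition (sf b c y)) = fun x => deriv Real.smoothTransition (sf b c x) * (-2*b* x i) := by
  ext x
  unfold pd
  rw [(sf_pd (h := Real.smoothTransition) (st_smooth.differentiable (by simp) _) i).fderiv, ContinuousLinearMap.smul_apply, sf_app]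
  rfl

lemma psi_pdd (b c : ℝ) (i : Fin 3) (x : E3) : pd i (pd i (fun y => Real.smoothTransition (sf b c y))) x
    = deriv (deriv Real.smoothTransition) (sf b c x) * (-2*b* x i) * (-2*b*x i) + deriv Real.smoothTransition (sf b c x) * (-2*b) := by
  rw [psi_pd]
  unfold pd
  have h1 := sf_pd (h := deriv Real.smoothTransition) (b := b) (c := c) (x := x) (st_d_smooth.differentiable (by simp) _) i
  have h2 : HasFDerivAt (fun y : E3 => -2*b* y i) ((-2*b) • (EuclideanSpace.proj i : E3 →L[ℝ] ℝ)) x :=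
    ((EuclideanSpace.proj i : E3 →L[ℝ] ℝ).hasFDerivAt (x := x)).const_mul (-2*b)
  have h3 : HasFDerivAt (fun y : E3 => deriv Real.smoothTransition (sf b c y) * (-2*b* y i)) _ x := h1.mul h2
  rw [h3.fderiv]
  simp only [ContinuousLinearMap.add_apply, ContinuousLinearMap.smul_apply, smul_eq_mul]
  have e := sf_app b x i
  rw [e]
  simp
  ring

lemma psi_pd' (b c : ℝ) (i : Fin 3) (x : E3) : pd i (fun y => Real.smoothTransition (sf b c y)) x = deriv Real.smoothTransition (sf b c x) * (-2*b* x i) := by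
  rw [psi_pd]

lemma lap_pt (f : E3 → ℝ) (x : E3) : lap f x = (pd 0 (pd 0 f) x + pd 1 (pd 1 f) x) + pd 2 (pd 2 f) x := by
  rw [lap_eq3]

lemma cutoff_space : ∃ S : ℝ, 1 ≤ S ∧ ∀ r ρ : ℝ, 1/2 ≤ r → r < ρ → ρ ≤ 1 → ∃ ψ : E3 → ℝ, TF ψ ∧ (∀ x, 0 ≤ ψ x ∧ ψ x ≤ 1) ∧
    (∀ x, ‖x‖ ≤ r → ψ x = 1) ∧ (∀ x, ρ ≤ ‖x‖ → ψ x = 0 ∧ (∀ i, pd i ψ x = 0) ∧ lap ψ x = 0) ∧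
    (∀ x i, |pd i ψ x| ≤ S/(ρ-r)) ∧ (∀ x, |lap ψ x| ≤ S/(ρ-r)^2) := by
  obtain ⟨S, hS, hb⟩ := st_bdd
  refine ⟨60*S, by linarith, fun r ρ hr hrρ hρ => ?_⟩
  have hh : 0 < ρ - r := by linarith
  have hh1 : ρ - r ≤ 1 := by linarith
  obtain ⟨ρ1, e1⟩ : ∃ ρ1, ρ1 = (r+ρ)/2 := ⟨_, rfl⟩
  have hd : 0 < ρ1^2 - r^2 := by nlinarith
  obtain ⟨b, eb⟩ : ∃ b, b = 1/(ρ1^2-r^2) := ⟨_, rfl⟩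
  have b0 : 0 < b := by rw [eb]; positivity
  have bb : b ≤ 2/(ρ-r) := by
    rw [eb, div_le_div_iff₀ hd hh]; nlinarith
  have out : ∀ x : E3, ρ1 < ‖x‖ → sf b (ρ1^2) x < 0 := fun x hx => by
    unfold sf
    exact mul_neg_of_pos_of_neg b0 (by nlinarith)
  have Hpd : ∀ x : E3, ρ1 < ‖x‖ → ∀ i, pd i (fun y => Real.smoothTransition (sf b (ρ1^2) y)) x = 0 := fun x hx i => by
    rw [psi_pd', st_d_zero (out x hx), zero_mul]
  have Hpdd : ∀ x : E3, ρ1 < ‖x‖ → ∀ i, pd i (pd i (fun y => Real.smoothTransition (sf b (ρ1^2) y))) x = 0 := fun x hx i => by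
    rw [psi_pdd, st_d_zero (out x hx), st_dd_zero (out x hx)]; ring
  have Hlap : ∀ x : E3, ρ1 < ‖x‖ → lap (fun y => Real.smoothTransition (sf b (ρ1^2) y)) x = 0 := fun x hx => by
    rw [lap_pt, Hpdd x hx, Hpdd x hx, Hpdd x hx]; simp
  have xi : ∀ x : E3, ¬ ρ1 < ‖x‖ → ∀ i, |x i| ≤ 1 := fun x hx i => by
    have := PiLp.norm_apply_le x i
    rw [Real.norm_eq_abs] at this
    linarith
  have ts : tsupport (fun y => Real.smoothTransition (sf b (ρ1^2) y)) ⊆ closedBall (0:E3) ρ1 := by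
    refine closure_minimal ?_ isClosed_closedBall
    intro x hx
    rw [mem_closedBall_zero_iff]
    by_contra hc
    rw [not_le] at hc
    exact hx (Real.smoothTransition.zero_of_nonpos (out x hc).le)
  refine ⟨fun y => Real.smoothTransition (sf b (ρ1^2) y), ⟨?_, ?_, ?_⟩, fun x => ⟨Real.smoothTransition.nonneg _, Real.smoothTransition.le_one _⟩, fun x hx => ?_, fun x hx => ⟨?_, ?_, ?_⟩, fun x i => ?_, fun x => ?_⟩
  · refine st_smooth.comp ?_
    unfold sf
    exact contDiff_const.mul (contDiff_const.sub (contDiff_norm_sq ℝ))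
  · exact IsCompact.of_isClosed_subset (isCompact_closedBall (0:E3) ρ1) (isClosed_tsupport _) ts
  · exact ts.trans (closedBall_subset_ball (by linarith))
  · refine Real.smoothTransition.one_of_one_le ?_
    unfold sf
    rw [eb, div_mul_eq_mul_div, le_div_iff₀ hd]
    nlinarith [norm_nonneg x]
  · exact Real.smoothTransition.zero_of_nonpos (out x (by linarith)).le
  · exact Hpd x (by linarith)
  · exact Hlap x (by linarith)
  · by_cases hx : ρ1 < ‖x‖
    · rw [Hpd x hx]; simp; positivity
    rw [psi_pd', abs_mul, abs_mul, abs_mul, abs_of_pos b0]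
    have := (hb (sf b (ρ1^2) x)).1
    have := xi x hx i
    calc _ ≤ S * (|(-2:ℝ)| * (2/(ρ-r)) * 1) := by gcongr
      _ ≤ _ := by
        have e4 : S * (|(-2:ℝ)| * (2/(ρ-r)) * 1) = 4*S/(ρ-r) := by norm_num; ring
        rw [e4]; gcongr; linarith
  · by_cases hx : ρ1 < ‖x‖
    · rw [Hlap x hx]; simp; positivity
    have key : ∀ i, |pd i (pd i (fun y => Real.smoothTransition (sf b (ρ1^2) y))) x| ≤ 20 * S/(ρ-r)^2 := fun i => by
      rw [psi_pdd]
      obtain ⟨h1, h2⟩ := hb (sf b (ρ1^2) x)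
      have h3 := xi x hx i
      refine (abs_add_le _ _).trans ?_
      rw [abs_mul, abs_mul, abs_mul _ (x i), abs_mul (-2) b, abs_mul _ (-2*b), abs_mul (-2) b, abs_of_pos b0]
      calc _ ≤ S * (|(-2:ℝ)| * (2/(ρ-r)) * 1) * (|(-2:ℝ)| * (2/(ρ-r)) * 1) + S * (|(-2:ℝ)| * (2/(ρ-r))) := by gcongr
        _ = (16 * S + 4 * S * (ρ - r))/(ρ-r)^2 := by norm_num; field_simp; ring
        _ ≤ _ := by gcongr; nlinarith
    rw [lap_pt]
    have k0 := key 0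
    have k1 := key 1
    have k2 := key 2
    refine (abs_add_le _ _).trans ((add_le_add (abs_add_le _ _) le_rfl).trans ?_)
    have : 60*S/(ρ-r)^2 = 20 * S/(ρ-r)^2 + 20 * S/(ρ-r)^2 + 20 * S/(ρ-r)^2 := by ring
    linarith

lemma cutoff_time : ∃ S : ℝ, 1 ≤ S ∧ ∀ r ρ : ℝ, 1/2 ≤ r → r < ρ → ρ ≤ 1 → ∀ n : ℕ, ∃ χ : ℝ → ℝ, TT χ ∧ (∀ t, 0 ≤ χ t ∧ χ t ≤ 1) ∧
    (∀ t : ℝ, -r^2 ≤ t → t ≤ -(2/((n:ℝ)+1)) → χ t = 1) ∧ (∀ t : ℝ, t ≤ -ρ^2 → χ t = 0 ∧ deriv χ t = 0) ∧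
    (∀ t : ℝ, t < -(2/((n:ℝ)+1)) → |deriv χ t| ≤ S/(ρ-r)) := by
  obtain ⟨S, hS, hb⟩ := st_bdd
  refine ⟨2*S, by linarith, fun r ρ hr hrρ hρ n => ?_⟩
  have hh : 0 < ρ - r := by linarith
  obtain ⟨ρ1, e1⟩ : ∃ ρ1, ρ1 = (r+ρ)/2 := ⟨_, rfl⟩
  have hd : 0 < ρ1^2 - r^2 := by nlinarith
  obtain ⟨b, eb⟩ : ∃ b, b = 1/(ρ1^2-r^2) := ⟨_, rfl⟩
  have b0 : 0 < b := by rw [eb]; positivity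
  have bb : b ≤ 2/(ρ-r) := by
    rw [eb, div_le_div_iff₀ hd hh]; nlinarith
  have n0 : (0:ℝ) < n + 1 := by positivity
  set χ : ℝ → ℝ := fun t => Real.smoothTransition (b*(t+ρ1^2)) * Real.smoothTransition (-(n+1)*t-1) with hχ
  have z1 : ∀ t, t ≤ -ρ1^2 → χ t = 0 := fun t ht => by
    simp only [hχ]
    rw [Real.smoothTransition.zero_of_nonpos (mul_nonpos_of_nonneg_of_nonpos b0.le (by linarith)), zero_mul]
  have e2 : ∀ t : ℝ, t ≤ -(2/((n:ℝ)+1)) → Real.smoothTransition (-(n+1)*t-1) = 1 := fun t ht => by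
    refine Real.smoothTransition.one_of_one_le ?_
    have : (n+1) * (2/(n+1:ℝ)) = 2 := by field_simp
    nlinarith
  have ts : tsupport χ ⊆ Icc (-ρ1^2) (-(1/(n+1))) := by
    refine closure_minimal ?_ isClosed_Icc
    intro x hx
    rw [mem_Icc]
    constructor
    · by_contra hc
      exact hx (z1 x (by linarith))
    · by_contra hc
      rw [not_le] at hc
      refine hx ?_
      simp only [hχ]
      rw [Real.smoothTransition.zero_of_nonpos (x := -(n+1)*x-1), mul_zero]
      have : (n+1) * (1/(n+1:ℝ)) = 1 := by field_simp
      nlinarith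
  refine ⟨χ, ⟨?_, ?_, ?_⟩, fun t => ⟨?_, ?_⟩, fun t ht ht2 => ?_, fun t ht => ⟨z1 t (by nlinarith), ?_⟩, fun t ht => ?_⟩
  · refine (st_smooth.comp ?_).mul (st_smooth.comp ?_) <;> fun_prop
  · exact IsCompact.of_isClosed_subset isCompact_Icc (isClosed_tsupport _) ts
  · refine ts.trans ?_
    intro x hx
    have : 0 < 1/((n:ℝ)+1) := by positivity
    constructor
    · nlinarith [hx.1]
    · linarith [hx.2]
  · exact mul_nonneg (Real.smoothTransition.nonneg _) (Real.smoothTransition.nonneg _)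
  · exact mul_le_one₀ (Real.smoothTransition.le_one _) (Real.smoothTransition.nonneg _) (Real.smoothTransition.le_one _)
  · simp only [hχ]
    rw [e2 t ht2, mul_one]
    refine Real.smoothTransition.one_of_one_le ?_
    rw [eb, div_mul_eq_mul_div, le_div_iff₀ hd]
    nlinarith
  · have : χ =ᶠ[nhds t] fun _ => 0 := by
      filter_upwards [Iio_mem_nhds (show t < -ρ1^2 by nlinarith)] with y hy using z1 y (le_of_lt hy)
    rw [this.deriv_eq]; simp
  · have : χ =ᶠ[nhds t] fun t => Real.smoothTransition (b*(t+ρ1^2)) := by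
      filter_upwards [Iio_mem_nhds ht] with y hy
      simp only [hχ]
      rw [e2 y (le_of_lt hy), mul_one]
    rw [this.deriv_eq]
    have hd1 : HasDerivAt (fun t => b*(t+ρ1^2)) (b*1) t := ((hasDerivAt_id t).add_const _).const_mul b
    have hd2 : HasDerivAt (fun t => Real.smoothTransition (b*(t+ρ1^2))) (deriv Real.smoothTransition (b*(t+ρ1^2)) * (b*1)) t :=
      HasDerivAt.comp t (st_smooth.differentiable (by simp) _).hasDerivAt hd1
    rw [hd2.deriv, abs_mul, mul_one, abs_of_pos b0]
    calc _ ≤ S * (2/(ρ-r)) := by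
            have := (hb (b*(t+ρ1^2))).1
            gcongr
      _ = _ := by ring
end cut

end

section

section energy
variable {u : E3 → ℝ → E3} {P : E3 → ℝ → ℝ}

lemma lintReal {F : E3 × ℝ → ℝ} (hF : Integrable F (volume.restrict Q1)) (hm : Measurable F) (h0 : ∀ z, 0 ≤ F z) {t : ℝ} (ht : t ∈ T1) :
    ENNReal.ofReal (∫ s in Ioo (-(1^2):ℝ) t, ∫ x in B1, F (x, s)) = ∫⁻ s in Ioo (-(1^2):ℝ) t, ∫⁻ x in B1, ENNReal.ofReal (F (x,s)) := by
  have hI : Integrable F ((volume.restrict B1).prod (volume.restrict (Ioo (-(1^2):ℝ) t))) := by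
    rw [Measure.prod_restrict]
    refine hF.mono_measure (Measure.restrict_mono (prod_mono le_rfl (Ioo_subset_Ioo le_rfl ht.2.le)) le_rfl)
  rw [← integral_prod_symm _ hI, ofReal_integral_eq_lintegral_ofReal hI (Eventually.of_forall h0),
    lintegral_prod_symm _ (by fun_prop)]

lemma lint_loc {G H : E3 → ℝ → ℝ≥0∞} {ρ t : ℝ} (ht : t ≤ 0) (h1 : ∀ s x, s < t → -ρ^2 < s → ‖x‖ < ρ → G x s ≤ H x s)
    (h2 : ∀ s x, ρ ≤ ‖x‖ → G x s = 0) (h3 : ∀ s x, s ≤ -ρ^2 → G x s = 0) :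
    ∫⁻ s in Ioo (-(1^2):ℝ) t, ∫⁻ x in B1, G x s ≤ ∫⁻ s in Ioo (-(ρ^2)) 0, ∫⁻ x in ball (0:E3) ρ, H x s := by
  rw [← lintegral_indicator measurableSet_Ioo, ← lintegral_indicator measurableSet_Ioo]
  refine lintegral_mono fun s => ?_
  by_cases hs : s ∈ Ioo (-(1^2):ℝ) t
  swap
  · rw [indicator_of_notMem hs]; exact zero_le
  rw [indicator_of_mem hs]
  by_cases hs2 : s ≤ -ρ^2
  · simp [h3 s _ hs2]
  rw [not_le] at hs2
  rw [indicator_of_mem (show s ∈ Ioo (-(ρ^2)) 0 from ⟨by simpa using hs2, lt_of_lt_of_le hs.2 ht⟩)]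
  rw [← lintegral_indicator measurableSet_ball, ← lintegral_indicator measurableSet_ball]
  refine lintegral_mono fun x => ?_
  by_cases hx : x ∈ B1
  swap
  · rw [indicator_of_notMem hx]; exact zero_le
  rw [indicator_of_mem hx]
  by_cases hx2 : x ∈ ball (0:E3) ρ
  · rw [indicator_of_mem hx2]
    exact h1 s x hs.2 hs2 (by simpa using hx2)
  · rw [h2 s x (by simpa using hx2)]; exact zero_le

/-- the right-hand density -/
def Dn (u : E3 → ℝ → E3) (P : E3 → ℝ → ℝ) (x : E3) (s : ℝ) : ℝ≥0∞ := ‖u x s‖ₑ^(2:ℝ) + ‖u x s‖ₑ^(3:ℝ) + ‖P x s‖ₑ * ‖u x s‖ₑ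

lemma Dn_eq (x : E3) (s : ℝ) : Dn u P x s = ENNReal.ofReal (‖u x s‖^2 + ‖u x s‖^3 + |P x s| * ‖u x s‖) := by
  unfold Dn
  rw [← ofReal_norm, ← ofReal_norm (P x s), ENNReal.ofReal_rpow_of_nonneg (norm_nonneg _) (by norm_num),
    ENNReal.ofReal_rpow_of_nonneg (norm_nonneg _) (by norm_num), ← ENNReal.ofReal_mul (norm_nonneg _),
    ← ENNReal.ofReal_add (by positivity) (by positivity), ← ENNReal.ofReal_add (by positivity) (by positivity)]
  norm_num

lemma en2 (g : ℝ → E3 → ℝ) (t : ℝ) : ‖∫ s in Ioo (-(1^2):ℝ) t, ∫ x in B1, g s x‖ₑ ≤ ∫⁻ s in Ioo (-(1^2):ℝ) t, ∫⁻ x in B1, ‖g s x‖ₑ :=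
  (enorm_integral_le_lintegral_enorm _).trans (lintegral_mono fun s => enorm_integral_le_lintegral_enorm _)

lemma energy_aux : ∃ C : ℝ, 0 ≤ C ∧ ∀ (u : E3 → ℝ → E3) (P : E3 → ℝ → ℝ) (sol : SuitableWeakSolution 1 u P) (r ρ : ℝ), 1/2 ≤ r → r < ρ → ρ ≤ 1 →
    ∀ n : ℕ, ∀ᵐ t, t ∈ T1 → -r^2 < t → t < -(2/((n:ℝ)+1)) →
      ∫⁻ x in ball (0:E3) r, ‖u x t‖ₑ^(2:ℝ) ≤ ENNReal.ofReal (C/(ρ-r)^2) * ∫⁻ s in Ioo (-(ρ^2)) 0, ∫⁻ x in ball (0:E3) ρ, Dn u P x s ∧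
      ∫⁻ s in Ioo (-(r^2)) t, ∫⁻ x in ball (0:E3) r, Gr (sol.gu x s) ≤ ENNReal.ofReal (C/(ρ-r)^2) * ∫⁻ s in Ioo (-(ρ^2)) 0, ∫⁻ x in ball (0:E3) ρ, Dn u P x s := by
  obtain ⟨S, S1, hS⟩ := cutoff_space
  obtain ⟨S', S1', hS'⟩ := cutoff_time
  refine ⟨7*S+S', by positivity, fun u P sol r ρ hr hrρ hρ n => ?_⟩
  obtain ⟨ψ, tψ, b01, one, zer, bpd, blap⟩ := hS r ρ hr hrρ hρ
  obtain ⟨χ, tχ, c01, cone, czer, cd⟩ := hS' r ρ hr hrρ hρ n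
  have hh : 0 < ρ - r := by linarith
  have hh1 : ρ - r ≤ 1 := by linarith
  have hh2 : 1/(ρ-r) ≤ 1/(ρ-r)^2 := by
    rw [div_le_div_iff₀ hh (by positivity)]; nlinarith
  have hE := sol.local_energy _ (prod_test tψ tχ) (fun x t => mul_nonneg (c01 t).1 (b01 x).1)
  rw [ae_restrict_iff' measurableSet_Ioo] at hE
  -- integrability
  have um := u_meas sol
  have iu : Integrable (fun z : E3 × ℝ => ‖u z.1 z.2‖^2 * (χ z.2 * ψ z.1)) (volume.restrict Q1) := by
    have h1 : Integrable (fun z : E3 × ℝ => ‖u z.1 z.2‖^2) (volume.restrict Q1) := by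
      refine intQ (by fun_prop) (r := 1) (by norm_num) (lt_of_le_of_lt (lintegral_mono fun z => le_of_eq ?_) (u_L2 sol))
      rw [ENNReal.rpow_one, enorm_pow, enorm_norm]; norm_cast
    exact test_bdd (prod_test tψ tχ).1.continuous (prod_test tψ tχ).2.1 h1
  have mg : Measurable (fun z : E3 × ℝ => ∑ i : Fin 3, ∑ j : Fin 3, (sol.gu z.1 z.2 i j)^2) :=
    Finset.measurable_sum _ fun i _ => Finset.measurable_sum _ fun j _ => (gij_meas sol i j).pow_const 2
  have mt : Measurable (fun z : E3 × ℝ => χ z.2 * ψ z.1) := (prod_test tψ tχ).1.continuous.measurable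
  have g0 : ∀ x s, 0 ≤ ∑ i : Fin 3, ∑ j : Fin 3, (sol.gu x s i j)^2 := fun x s => by positivity
  have ig : Integrable (fun z : E3 × ℝ => (∑ i : Fin 3, ∑ j : Fin 3, (sol.gu z.1 z.2 i j)^2) * (χ z.2 * ψ z.1)) (volume.restrict Q1) := by
    have h1 : Integrable (fun z : E3 × ℝ => ∑ i : Fin 3, ∑ j : Fin 3, (sol.gu z.1 z.2 i j)^2) (volume.restrict Q1) := by
      refine intQ mg (r := 1) (by norm_num) (lt_of_le_of_lt (lintegral_mono fun z => le_of_eq ?_) (g_L2 sol))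
      rw [ENNReal.rpow_one, Real.enorm_eq_ofReal (g0 _ _)]; rfl
    exact test_bdd (prod_test tψ tχ).1.continuous (prod_test tψ tχ).2.1 h1
  have isl : ∀ᵐ t, t ∈ T1 → Integrable (fun x => ‖u x t‖^2 * (χ t * ψ x)) (volume.restrict B1) := by
    have h := iu
    rw [Q1_vol] at h
    rw [← ae_restrict_iff' measurableSet_Ioo]
    exact h.prod_left_ae
  filter_upwards [hE, isl] with t hE isl tT tr tn
  specialize hE tT
  specialize isl tT
  set A := ∫⁻ s in Ioo (-(ρ^2)) 0, ∫⁻ x in ball (0:E3) ρ, Dn u P x s with hA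
  -- RHS bounds
  have pull : ∀ K : ℝ, ∫⁻ s in Ioo (-(ρ^2)) 0, ∫⁻ x in ball (0:E3) ρ, ENNReal.ofReal K * Dn u P x s = ENNReal.ofReal K * A := fun K => by
    have : ∀ s, ∫⁻ x in ball (0:E3) ρ, ENNReal.ofReal K * Dn u P x s = ENNReal.ofReal K * ∫⁻ x in ball (0:E3) ρ, Dn u P x s :=
      fun s => lintegral_const_mul' _ _ ENNReal.ofReal_ne_top
    simp only [this]
    rw [lintegral_const_mul' _ _ ENNReal.ofReal_ne_top]
  have pdm : ∀ i s x, pd i (fun y => χ s * ψ y) x = χ s * pd i ψ x := fun i s x => pd_const_mul tψ.1 _ _ _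
  have lpm : ∀ s x, lap (fun y => χ s * ψ y) x = χ s * lap ψ x := fun s x => lap_const_mul tψ.1 _ _
  have dm : ∀ s x, deriv (fun τ => χ τ * ψ x) s = deriv χ s * ψ x := fun s x =>
    deriv_mul_const (tχ.1.differentiable (by simp) s) _
  simp only [pdm, lpm, dm] at hE
  have hc : ‖∫ s in Ioo (-(1^2):ℝ) t, ∫ x in B1, ‖u x s‖ ^ 2 * (deriv χ s * ψ x + χ s * lap ψ x)‖ₑ ≤ ENNReal.ofReal ((S+S')/(ρ-r)^2) * A := by
    refine (en2 _ _).trans ?_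
    rw [← pull]
    refine lint_loc (G := fun x s => ‖‖u x s‖ ^ 2 * (deriv χ s * ψ x + χ s * lap ψ x)‖ₑ) tT.2.le (fun s x hs hs2 hx => ?_) (fun s x hx => ?_) (fun s x hs => ?_)
    · rw [Dn_eq, ← ENNReal.ofReal_mul (by positivity), ← ofReal_norm]
      refine ENNReal.ofReal_le_ofReal ?_
      rw [norm_mul, norm_pow, norm_norm]
      have k1 : ‖deriv χ s * ψ x + χ s * lap ψ x‖ ≤ (S+S')/(ρ-r)^2 := by
        refine (norm_add_le _ _).trans ?_
        rw [norm_mul, norm_mul, Real.norm_of_nonneg (b01 x).1, Real.norm_of_nonneg (c01 s).1, Real.norm_eq_abs, Real.norm_eq_abs]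
        have a1 := cd s (by linarith)
        have a2 := blap x
        have a3 : S'/(ρ-r) ≤ S'/(ρ-r)^2 := by
          rw [div_eq_mul_one_div, div_eq_mul_one_div S' ((ρ-r)^2)]
          exact mul_le_mul_of_nonneg_left hh2 (by linarith)
        calc _ ≤ |deriv χ s| * 1 + 1 * |lap ψ x| := by
              have := (b01 x).2
              have := (c01 s).2
              gcongr
          _ ≤ S'/(ρ-r)^2 + S/(ρ-r)^2 := by linarith
          _ = _ := by ring
      rw [mul_comm]
      refine mul_le_mul k1 ?_ (by positivity) (by positivity)
      have : 0 ≤ ‖u x s‖^3 + |P x s| * ‖u x s‖ := by positivity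
      linarith
    · obtain ⟨z1, z2, z3⟩ := zer x hx
      simp [z1, z3]
    · obtain ⟨z1, z2⟩ := czer s hs
      simp [z1, z2]
  have hd : ‖∫ s in Ioo (-(1^2):ℝ) t, ∫ x in B1, (∑ i : Fin 3, u x s i * (χ s * pd i ψ x)) * (‖u x s‖ ^ 2 + 2 * P x s)‖ₑ ≤ ENNReal.ofReal ((6*S)/(ρ-r)^2) * A := by
    refine (en2 _ _).trans ?_
    rw [← pull]
    refine lint_loc (G := fun x s => ‖(∑ i : Fin 3, u x s i * (χ s * pd i ψ x)) * (‖u x s‖ ^ 2 + 2 * P x s)‖ₑ) tT.2.le (fun s x hs hs2 hx => ?_) (fun s x hx => ?_) (fun s x hs => ?_)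
    · rw [Dn_eq, ← ENNReal.ofReal_mul (by positivity), ← ofReal_norm]
      refine ENNReal.ofReal_le_ofReal ?_
      rw [norm_mul]
      have k1 : ‖∑ i : Fin 3, u x s i * (χ s * pd i ψ x)‖ ≤ 3 * (‖u x s‖ * (S/(ρ-r)^2)) := by
        refine (norm_sum_le _ _).trans ?_
        have : ∀ i ∈ (Finset.univ : Finset (Fin 3)), ‖u x s i * (χ s * pd i ψ x)‖ ≤ ‖u x s‖ * (S/(ρ-r)^2) := fun i _ => by
          rw [norm_mul, norm_mul, Real.norm_of_nonneg (c01 s).1, Real.norm_eq_abs (pd i ψ x)]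
          have a1 := bpd x i
          have a3 : S/(ρ-r) ≤ S/(ρ-r)^2 := by
            rw [div_eq_mul_one_div, div_eq_mul_one_div S ((ρ-r)^2)]
            exact mul_le_mul_of_nonneg_left hh2 (by linarith)
          calc _ ≤ ‖u x s‖ * (1 * (S/(ρ-r)^2)) := by
                have := (c01 s).1
                have := (c01 s).2
                have := PiLp.norm_apply_le (u x s) i
                have := a1.trans a3
                gcongr
            _ = _ := by ring
        refine (Finset.sum_le_sum this).trans ?_
        simp
      have k2 : ‖‖u x s‖ ^ 2 + 2 * P x s‖ ≤ ‖u x s‖^2 + 2 * |P x s| := by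
        refine (norm_add_le _ _).trans ?_
        simp [abs_mul]
      refine (mul_le_mul k1 k2 (by positivity) (by positivity)).trans ?_
      have e : 3 * (‖u x s‖ * (S / (ρ - r) ^ 2)) * (‖u x s‖ ^ 2 + 2 * |P x s|) = S/(ρ-r)^2 * (3*‖u x s‖^3 + 6 * (|P x s| * ‖u x s‖)) := by ring
      have e2 : 6 * S / (ρ - r) ^ 2 * (‖u x s‖ ^ 2 + ‖u x s‖ ^ 3 + |P x s| * ‖u x s‖) = S/(ρ-r)^2 * (6*‖u x s‖^2 + 6 *‖u x s‖^3 + 6 * (|P x s| * ‖u x s‖)) := by ring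
      rw [e, e2]
      refine mul_le_mul_of_nonneg_left ?_ (by positivity)
      have : 0 ≤ ‖u x s‖^3 := by positivity
      have : 0 ≤ ‖u x s‖^2 := by positivity
      linarith
    · obtain ⟨z1, z2, z3⟩ := zer x hx
      simp [z2]
    · obtain ⟨z1, z2⟩ := czer s hs
      simp [z1]
  have hcd : ENNReal.ofReal ((7*S+S')/(ρ-r)^2) * A = ENNReal.ofReal ((S+S')/(ρ-r)^2) * A + ENNReal.ofReal ((6*S)/(ρ-r)^2) * A := by
    rw [← add_mul, ← ENNReal.ofReal_add (by positivity) (by positivity)]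
    congr 2; ring
  rw [hcd]
  have n1 : 0 ≤ ∫ x in B1, ‖u x t‖ ^ 2 * (χ t * ψ x) :=
    integral_nonneg fun x => mul_nonneg (by positivity) (mul_nonneg (c01 t).1 (b01 x).1)
  have n2 : 0 ≤ ∫ s in Ioo (-(1^2):ℝ) t, ∫ x in B1, (∑ i : Fin 3, ∑ j : Fin 3, (sol.gu x s i j) ^ 2) * (χ s * ψ x) :=
    integral_nonneg fun s => integral_nonneg fun x => mul_nonneg (g0 x s) (mul_nonneg (c01 s).1 (b01 x).1)
  have tot : ∀ a : ℝ, a ≤ (∫ s in Ioo (-(1^2):ℝ) t, ∫ x in B1, ‖u x s‖ ^ 2 * (deriv χ s * ψ x + χ s * lap ψ x)) +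
      ∫ s in Ioo (-(1^2):ℝ) t, ∫ x in B1, (∑ i : Fin 3, u x s i * (χ s * pd i ψ x)) * (‖u x s‖ ^ 2 + 2 * P x s) →
      ENNReal.ofReal a ≤ ENNReal.ofReal ((S+S')/(ρ-r)^2) * A + ENNReal.ofReal ((6*S)/(ρ-r)^2) * A := fun a ha => by
    refine (ENNReal.ofReal_le_ofReal ha).trans (ENNReal.ofReal_add_le.trans (add_le_add (le_trans ?_ hc) (le_trans ?_ hd)))
    · exact Real.ofReal_le_enorm _
    · exact Real.ofReal_le_enorm _
  constructor
  · refine le_trans ?_ (tot (∫ x in B1, ‖u x t‖ ^ 2 * (χ t * ψ x)) (le_trans (le_add_of_nonneg_right (mul_nonneg (by norm_num) n2)) hE))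
    rw [ofReal_integral_eq_lintegral_ofReal isl (Eventually.of_forall fun x => mul_nonneg (by positivity) (mul_nonneg (c01 t).1 (b01 x).1))]
    rw [← lintegral_indicator measurableSet_ball, ← lintegral_indicator measurableSet_ball]
    refine lintegral_mono fun x => ?_
    by_cases hx : x ∈ ball (0:E3) r
    · have hx' : ‖x‖ < r := by simpa using hx
      rw [indicator_of_mem hx, indicator_of_mem (ball_subset_ball (by linarith) hx), cone t tr.le tn.le, one x hx'.le,
        ← ofReal_norm, ENNReal.ofReal_rpow_of_nonneg (norm_nonneg _) (by norm_num)]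
      simp
    · rw [indicator_of_notMem hx]; exact zero_le
  · have := tot _ (le_trans (show (∫ s in Ioo (-(1^2):ℝ) t, ∫ x in B1, (∑ i : Fin 3, ∑ j : Fin 3, (sol.gu x s i j) ^ 2) * (χ s * ψ x)) ≤ _ by linarith) hE)
    refine le_trans ?_ this
    have e := lintReal (F := fun z : E3 × ℝ => (∑ i : Fin 3, ∑ j : Fin 3, (sol.gu z.1 z.2 i j)^2) * (χ z.2 * ψ z.1)) ig (mg.mul mt) (fun z => mul_nonneg (g0 _ _) (mul_nonneg (c01 _).1 (b01 _).1)) tT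
    simp only at e
    rw [e]
    rw [← lintegral_indicator measurableSet_Ioo, ← lintegral_indicator measurableSet_Ioo]
    refine lintegral_mono fun s => ?_
    by_cases hs : s ∈ Ioo (-(r^2)) t
    swap
    · rw [indicator_of_notMem hs]; exact zero_le
    rw [indicator_of_mem hs, indicator_of_mem (show s ∈ Ioo (-(1^2):ℝ) t from ⟨by nlinarith [hs.1], hs.2⟩)]
    rw [← lintegral_indicator measurableSet_ball, ← lintegral_indicator measurableSet_ball]
    refine lintegral_mono fun x => ?_
    by_cases hx : x ∈ ball (0:E3) r
    · have hx' : ‖x‖ < r := by simpa using hx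
      rw [indicator_of_mem hx, indicator_of_mem (ball_subset_ball (by linarith) hx), cone s (by linarith [hs.1]) (by linarith [hs.2]), one x hx'.le]
      simp [Gr]
    · rw [indicator_of_notMem hx]; exact zero_le

lemma energy : ∃ C : ℝ, 0 ≤ C ∧ ∀ (u : E3 → ℝ → E3) (P : E3 → ℝ → ℝ) (sol : SuitableWeakSolution 1 u P) (r ρ : ℝ), 1/2 ≤ r → r < ρ → ρ ≤ 1 →
    linfL2sq r u + gradL2sq r sol.gu ≤ ENNReal.ofReal (C/(ρ-r)^2) * ∫⁻ s in Ioo (-(ρ^2)) 0, ∫⁻ x in ball (0:E3) ρ, Dn u P x s := by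
  obtain ⟨C, hC, H⟩ := energy_aux
  refine ⟨2*C, by positivity, fun u P sol r ρ hr hrρ hρ => ?_⟩
  have H2 := fun n => H u P sol r ρ hr hrρ hρ n
  rw [← ae_all_iff] at H2
  set A := ENNReal.ofReal (C/(ρ-r)^2) * ∫⁻ s in Ioo (-(ρ^2)) 0, ∫⁻ x in ball (0:E3) ρ, Dn u P x s with hA
  have ex : ∀ t : ℝ, t < 0 → ∃ n : ℕ, t < -(2/((n:ℝ)+1)) := fun t ht => by
    obtain ⟨n, hn⟩ := exists_nat_gt (2/(-t))
    refine ⟨n, ?_⟩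
    have : 2/((n:ℝ)+1) < -t := by
      rw [div_lt_comm₀ (by positivity) (by linarith)]; linarith
    linarith
  have h1 : linfL2sq r u ≤ A := by
    unfold linfL2sq
    refine essSup_le_of_ae_le _ ?_
    show ∀ᵐ t ∂_, _ ≤ A
    rw [ae_restrict_iff' measurableSet_Ioo]
    filter_upwards [H2] with t H2 ht
    obtain ⟨n, hn⟩ := ex t ht.2
    refine le_trans (le_of_eq ?_) (H2 n ⟨by nlinarith [ht.1], ht.2⟩ (by linarith [ht.1]) hn).1
    simp only [ENNReal.rpow_two]; rfl
  have h2 : gradL2sq r sol.gu ≤ A := by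
    unfold gradL2sq
    have hd : Dense {t : ℝ | ∀ n : ℕ, t ∈ T1 → -r^2 < t → t < -(2/((n:ℝ)+1)) →
      ∫⁻ x in ball (0:E3) r, ‖u x t‖ₑ^(2:ℝ) ≤ A ∧ ∫⁻ s in Ioo (-(r^2)) t, ∫⁻ x in ball (0:E3) r, Gr (sol.gu x s) ≤ A} := Measure.dense_of_ae H2
    have key : ∀ b : ℝ, b < 0 → ∫⁻ s in Ioo (-(r^2)) b, ∫⁻ x in ball (0:E3) r, Gr (sol.gu x s) ≤ A := fun b hb => by
      obtain ⟨t, ht1, ht2⟩ := hd.exists_mem_open (isOpen_Ioo (a := max b (-r^2)) (b := 0)) (nonempty_Ioo.2 (max_lt hb (by nlinarith)))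
      obtain ⟨n, hn⟩ := ex t ht2.2
      have hb2 : b < t := lt_of_le_of_lt (le_max_left _ _) ht2.1
      have hb3 : -r^2 < t := lt_of_le_of_lt (le_max_right _ _) ht2.1
      exact (lintegral_mono_set (Ioo_subset_Ioo le_rfl hb2.le)).trans (ht1 n ⟨by nlinarith, ht2.2⟩ hb3 hn).2
    have hU : Ioo (-(r^2)) 0 = ⋃ n : ℕ, Ioo (-(r^2)) (-(1/((n:ℝ)+1))) := by
      ext t
      simp only [mem_iUnion, mem_Ioo]
      constructor
      · rintro ⟨a, b⟩
        obtain ⟨n, hn⟩ := ex t b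
        refine ⟨n, a, hn.trans_le ?_⟩
        have : 1/((n:ℝ)+1) ≤ 2/((n:ℝ)+1) := by gcongr; norm_num
        linarith
      · rintro ⟨n, a, b⟩
        have : 0 < 1/((n:ℝ)+1) := by positivity
        exact ⟨a, by linarith⟩
    rw [hU, setLIntegral_iUnion_of_directed]
    · refine iSup_le fun n => key _ ?_
      have : 0 < 1/((n:ℝ)+1) := by positivity
      linarith
    · refine Monotone.directed_le fun m n hmn => Ioo_subset_Ioo le_rfl ?_
      have : (m:ℝ) ≤ n := by exact_mod_cast hmn
      have : 1/((n:ℝ)+1) ≤ 1/((m:ℝ)+1) := by gcongr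
      linarith
  calc _ ≤ A + A := add_le_add h1 h2
    _ = _ := by
      rw [hA, ← two_mul, ← mul_assoc]
      congr 1
      rw [mul_div_assoc, ENNReal.ofReal_mul (by norm_num)]
      simp
end energy

end

section

lemma rpow_absorb2 {g K Y : ℝ≥0∞} {w : ℝ} (h0 : 0 < w) (h1 : w < 1) (hg : g ≠ ∞) (h : g ≤ K * (Y ^ w * g ^ (1-w))) :
    g ≤ K ^ (1/w) * Y := by
  by_cases hz : g = 0
  · rw [hz]; exact zero_le
  have e : g = g ^ w * g ^ (1-w) := by
    rw [← ENNReal.rpow_add_of_nonneg _ _ h0.le (by linarith)]; norm_num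
  have p0 : g ^ (1-w) ≠ 0 := by
    simp only [ne_eq, ENNReal.rpow_eq_zero_iff, not_or, not_and]
    exact ⟨fun h => absurd h hz, fun h => absurd h hg⟩
  have p1 : g ^ (1-w) ≠ ∞ := ENNReal.rpow_ne_top_of_nonneg (by linarith) hg
  have h2 : g ^ w ≤ K * Y ^ w := by
    have : g ^ w * g ^ (1-w) ≤ (K * Y ^ w) * g ^ (1-w) := by
      rw [← e, mul_assoc]; exact h
    exact (ENNReal.mul_le_mul_iff_left p0 p1).1 this
  calc g = (g ^ w) ^ (1/w) := by rw [← ENNReal.rpow_mul, mul_one_div_cancel h0.ne', ENNReal.rpow_one]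
    _ ≤ (K * Y ^ w) ^ (1/w) := ENNReal.rpow_le_rpow h2 (by positivity)
    _ = _ := by
      rw [ENNReal.mul_rpow_of_nonneg _ _ (by positivity), ← ENNReal.rpow_mul, mul_one_div_cancel h0.ne', ENNReal.rpow_one]

lemma iter_lemma {w : Fin 4 → ℝ} (w0 : ∀ i, 0 < w i) (w1 : ∀ i, w i < 1) {A : ℝ≥0∞} (hA : A ≠ ∞) :
    ∃ C : ℝ≥0∞, C ≠ ∞ ∧ ∀ (f : ℝ → ℝ≥0∞) (M Y : ℝ≥0∞), M ≠ ∞ → (∀ r, r ≤ 1 → f r ≤ M) →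
      (∀ r ρ, 1/2 ≤ r → r < ρ → ρ ≤ 1 → f r ≤ A * ENNReal.ofReal (ρ-r) ^ (-5:ℝ) * ∑ i, Y ^ (w i) * (f ρ) ^ (1 - w i)) →
      f (1/2) ≤ C * Y := by
  obtain ⟨v, hv0, hv⟩ : ∃ v : ℝ, 0 < v ∧ ∀ i, v ≤ w i := by
    refine ⟨Finset.univ.inf' Finset.univ_nonempty w, ?_, fun i => Finset.inf'_le _ (Finset.mem_univ i)⟩
    rw [Finset.lt_inf'_iff]; exact fun i _ => w0 i
  set K := 5/v with hK
  have K0 : 0 < K := by positivity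
  set B := 2 ^ K * A with hB
  have h2K : (2:ℝ≥0∞)^K ≠ ∞ := ENNReal.rpow_ne_top_of_nonneg K0.le (by norm_num)
  have hBf : B ≠ ∞ := ENNReal.mul_ne_top h2K hA
  refine ⟨2^K * ∑ i, (4 * B) ^ (1/w i), ?_, fun f M Y hM hf H => ?_⟩
  · refine ENNReal.mul_ne_top h2K ?_
    rw [ENNReal.sum_ne_top]
    exact fun i _ => ENNReal.rpow_ne_top_of_nonneg (by have := w0 i; positivity) (ENNReal.mul_ne_top (by norm_num) hBf)
  set g := ⨆ r ∈ Ico (1/2:ℝ) 1, ENNReal.ofReal (1-r) ^ K * f r with hg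
  have gle : ∀ r, 1/2 ≤ r → r < 1 → ENNReal.ofReal (1-r) ^ K * f r ≤ g := fun r h1 h2 =>
    le_iSup₂ (f := fun r (_ : r ∈ Ico (1/2:ℝ) 1) => ENNReal.ofReal (1-r) ^ K * f r) r ⟨h1, h2⟩
  have gfin : g ≠ ∞ := by
    refine ne_top_of_le_ne_top hM (iSup₂_le fun r hr => ?_)
    calc _ ≤ 1 * f r := by
          gcongr
          refine ENNReal.rpow_le_one ?_ K0.le
          rw [← ENNReal.ofReal_one]
          exact ENNReal.ofReal_le_ofReal (by linarith [hr.1])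
      _ ≤ M := by rw [one_mul]; exact hf r hr.2.le
  have main : g ≤ ∑ i, B * (Y ^ w i * g ^ (1 - w i)) := by
    refine iSup₂_le fun r hr => ?_
    obtain ⟨h, eh⟩ : ∃ h, h = (1-r)/2 := ⟨_, rfl⟩
    have hh : 0 < h := by rw [eh]; linarith [hr.2]
    have hh1 : h ≤ 1 := by rw [eh]; linarith [hr.1]
    have e1 : (1-r) = 2*h := by rw [eh]; ring
    set G := ENNReal.ofReal h with hG
    have G0 : G ≠ 0 := by simpa [hG] using hh
    have G1 : G ≤ 1 := by rw [hG, ← ENNReal.ofReal_one]; exact ENNReal.ofReal_le_ofReal hh1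
    have Gf : G ≠ ∞ := ENNReal.ofReal_ne_top
    have H1 := H r (r+h) hr.1 (by linarith) (by linarith)
    have H2 := gle (r+h) (by linarith [hr.1]) (by linarith)
    rw [show r+h-r = h by ring] at H1
    rw [show 1-(r+h) = h by linarith] at H2
    rw [e1, ENNReal.ofReal_mul (by norm_num), ENNReal.mul_rpow_of_nonneg _ _ K0.le]
    calc _ ≤ (ENNReal.ofReal 2 ^ K * G ^ K) * (A * G ^ (-5:ℝ) * ∑ i, Y ^ (w i) * (f (r+h)) ^ (1 - w i)) := by gcongr
      _ = ∑ i, B * (Y ^ w i * ((G ^ K * G ^ (-5:ℝ)) * f (r+h) ^ (1 - w i))) := by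
        rw [Finset.mul_sum, Finset.mul_sum]
        refine Finset.sum_congr rfl fun i _ => ?_
        rw [hB, show ENNReal.ofReal 2 = 2 by simp]; ring
      _ ≤ _ := by
        refine Finset.sum_le_sum fun i _ => ?_
        gcongr
        rw [← ENNReal.rpow_add _ _ G0 Gf]
        calc _ ≤ (G ^ K) ^ (1 - w i) * f (r+h) ^ (1 - w i) := by
              gcongr
              rw [← ENNReal.rpow_mul]
              refine ENNReal.rpow_le_rpow_of_exponent_ge G1 ?_
              have : 5 ≤ K * w i := by
                rw [hK, div_mul_eq_mul_div, le_div_iff₀ hv0]; nlinarith [hv i]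
              linarith
          _ = (G ^ K * f (r+h)) ^ (1 - w i) := by
              rw [ENNReal.mul_rpow_of_nonneg _ _ (by linarith [w1 i])]
          _ ≤ _ := ENNReal.rpow_le_rpow H2 (by linarith [w1 i])
  have hex : ∃ i ∈ (Finset.univ : Finset (Fin 4)), g / 4 ≤ B * (Y ^ w i * g ^ (1 - w i)) := by
    by_contra hcon
    push Not at hcon
    have hlt := ENNReal.sum_lt_sum_of_nonempty Finset.univ_nonempty hcon
    have e4 : ∑ _i : Fin 4, g / 4 = g := by
      rw [Finset.sum_const, Finset.card_univ, Fintype.card_fin, nsmul_eq_mul]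
      exact ENNReal.mul_div_cancel (by norm_num) (by norm_num)
    rw [e4] at hlt
    exact absurd hlt (not_lt.2 main)
  obtain ⟨i, -, hi⟩ := hex
  have hi2 : g ≤ (4 * B) * (Y ^ w i * g ^ (1 - w i)) := by
    rw [mul_assoc]
    rw [ENNReal.div_le_iff (by norm_num) (by norm_num)] at hi
    rwa [mul_comm 4]
  have hi3 := rpow_absorb2 (w0 i) (w1 i) gfin hi2
  have e2 : (2:ℝ≥0∞)^K * ENNReal.ofReal (1-1/2) ^ K = 1 := by
    rw [← ENNReal.mul_rpow_of_nonneg _ _ K0.le, show (2:ℝ≥0∞) = ENNReal.ofReal 2 by simp, ← ENNReal.ofReal_mul (by norm_num)]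
    norm_num
  calc f (1/2) = 2^K * (ENNReal.ofReal (1-1/2) ^ K * f (1/2)) := by rw [← mul_assoc, e2, one_mul]
    _ ≤ 2^K * g := by gcongr; exact gle _ le_rfl (by norm_num)
    _ ≤ 2^K * ((∑ i, (4 * B) ^ (1/w i)) * Y) := by
      gcongr
      refine hi3.trans ?_
      gcongr
      exact Finset.single_le_sum (f := fun i => (4 * B) ^ (1/w i)) (fun _ _ => zero_le) (Finset.mem_univ i)
    _ = _ := by ring

lemma params {π a1 a2 a3 α : ℝ} (hπ0 : 0 ≤ π) (hπ1 : π ≤ 1) (p1 : 0 < a1) (p2 : 0 < a2) (p3 : 0 < a3)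
    (l1 : a1 < 1) (l2 : a2 < 1) (l3 : a3 < 1) (hα : α * (2*π + (a1+a2+a3)) = 2) (hα1 : 1 < α)
    (y1 : 0 ≤ α*a1 - (α-1)/2) (y2 : 0 ≤ α*a2 - (α-1)/2) (y3 : 0 ≤ α*a3 - (α-1)/2) (h7 : 0 ≤ 7 - 3*α - 4*α*π) :
    ∃ κ θ t1 t2 t3 ε : ℝ, GNP a1 a2 a3 κ θ t1 t2 t3 ∧ 0 < ε ∧ ε < 1 ∧ 3*κ*π + 3*θ/2 ≤ 1 ∧ 3*κ*(1-ε/3) = α ∧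
      3*κ*(1-ε/3)*π + (3*θ*(1-ε/3)+ε)/2 ≤ 1 ∧ α < 3*κ ∧ κ < 1 := by
  obtain ⟨η, hη⟩ : ∃ η, η = (α-1)/7 := ⟨_, rfl⟩
  have η0 : 0 < η := by rw [hη]; linarith
  obtain ⟨d0, hd0⟩ : ∃ d, d = (7 - 3*α - 4*(α*π))/2 := ⟨_, rfl⟩
  have d00 : 0 ≤ d0 := by rw [hd0]; linarith
  have απ : 0 ≤ α * π := by positivity
  have ηπ : η * π ≤ η := by nlinarith
  have ηπ0 : 0 ≤ η * π := by positivity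
  have sy : (α*a1 - (α-1)/2) + (α*a2 - (α-1)/2) + (α*a3 - (α-1)/2) = d0 := by
    rw [hd0]; linarith
  have tb : ∀ a, 0 < a → a < 1 → 0 ≤ α*a - (α-1)/2 → max (((α+η)*a - (α+η-1)/2)/3) 0 ≤ (α*a - (α-1)/2 + η/2)/3 := by
    intro a ha ha1 hy
    refine max_le ?_ ?_
    · nlinarith
    · linarith
  have tl : ∀ a, 0 < a → a < 1 → 1/3 + max (((α+η)*a - (α+η-1)/2)/3) 0 < 1 := by
    intro a ha ha1
    have : max (((α+η)*a - (α+η-1)/2)/3) 0 < 2/3 := by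
      refine max_lt ?_ (by norm_num)
      nlinarith
    linarith
  have α3 : α + η < 3 := by linarith
  have α0 : 0 < α + η := by linarith
  refine ⟨(α+η)/3, (d0 + 5*η/2)/3, max (((α+η)*a1 - (α+η-1)/2)/3) 0, max (((α+η)*a2 - (α+η-1)/2)/3) 0, max (((α+η)*a3 - (α+η-1)/2)/3) 0,
    3*η/(α+η), ⟨p1, p2, p3, by linarith, by linarith, by linarith, by linarith, le_max_right _ _, le_max_right _ _, le_max_right _ _,
      tl _ p1 l1, tl _ p2 l2, tl _ p3 l3, ?_, ?_, ?_, ?_⟩, by positivity, ?_, ?_, ?_, ?_, by linarith, by linarith⟩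
  · have := le_max_left (((α+η)*a1 - (α+η-1)/2)/3) 0; linarith
  · have := le_max_left (((α+η)*a2 - (α+η-1)/2)/3) 0; linarith
  · have := le_max_left (((α+η)*a3 - (α+η-1)/2)/3) 0; linarith
  · have := tb _ p1 l1 y1
    have := tb _ p2 l2 y2
    have := tb _ p3 l3 y3
    linarith
  · rw [div_lt_one α0]; linarith
  · linarith
  · field_simp; ring
  · have e : 3*((α+η)/3)*(1-3*η/(α+η)/3) = α := by field_simp; ring
    rw [e]
    have hε0 : 0 < 3*η/(α+η) := by positivity
    have hε : 3*η/(α+η) ≤ 3 * η := by rw [div_le_iff₀ α0]; nlinarith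
    have : 3*((d0 + 5*η/2)/3)*(1-3*η/(α+η)/3) ≤ d0 + 5*η/2 := by nlinarith
    linarith

end

section

lemma add_rpow_le2 (x y : ℝ≥0∞) {s : ℝ} (hs : 0 ≤ s) : (x + y)^s ≤ 2^s * (x^s + y^s) := by
  have h : x + y ≤ 2 * max x y := by
    rw [two_mul]; exact add_le_add (le_max_left _ _) (le_max_right _ _)
  refine (ENNReal.rpow_le_rpow h hs).trans ?_
  rw [ENNReal.mul_rpow_of_nonneg _ _ hs]
  gcongr
  rcases le_total x y with h | h
  · rw [max_eq_right h]; exact le_add_self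
  · rw [max_eq_left h]; exact le_self_add

lemma lint3 {X : Type*} [MeasurableSpace X] {μ : Measure X} (hμ : μ univ ≤ 1) {f g : X → ℝ≥0∞} (hf : Measurable f) (hg : Measurable g)
    {x y : ℝ} (hx : 0 ≤ x) (hy : 0 ≤ y) (hxy : x + y ≤ 1) : ∫⁻ z, f z ^ x * g z ^ y ∂μ ≤ (∫⁻ z, f z ∂μ)^x * (∫⁻ z, g z ∂μ)^y := by
  have h := ENNReal.lintegral_prod_norm_pow_le (μ := μ) (Finset.univ : Finset (Fin 3)) (f := ![f, g, fun _ => 1]) (p := ![x, y, 1-x-y])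
    (by intro i _; fin_cases i <;> simp <;> fun_prop) (by simp [Fin.sum_univ_three])
    (by intro i _; fin_cases i <;> simp <;> linarith)
  simp only [Fin.prod_univ_three, Matrix.cons_val_zero, Matrix.cons_val_one, Matrix.cons_val, ENNReal.one_rpow, mul_one,
    lintegral_const, one_mul] at h
  refine h.trans ?_
  calc _ ≤ (∫⁻ z, f z ∂μ)^x * (∫⁻ z, g z ∂μ)^y * 1 := by
        gcongr; exact ENNReal.rpow_le_one hμ (by linarith)
    _ = _ := by rw [mul_one]

def tN (p : ℝ≥0∞) (N : ℝ → ℝ≥0∞) : ℝ≥0∞ := if p = ∞ then essSup N (volume.restrict T1) else (∫⁻ t in T1, N t ^ p.toReal) ^ (1/p.toReal)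

lemma time_holder {p : ℝ≥0∞} (hp : 1 ≤ p) {a b : ℝ} (ha : 0 ≤ a) (hb : 0 ≤ b) (hab : a * (1/p.toReal) + b/2 ≤ 1) {I : Set ℝ} (hI : I ⊆ T1)
    {N w : ℝ → ℝ≥0∞} (hN : Measurable N) (hw : Measurable w) :
    ∫⁻ t in I, N t ^ a * w t ^ (b/2) ≤ tN p N ^ a * (∫⁻ t in I, w t) ^ (b/2) := by
  have hμ : (volume.restrict I) univ ≤ 1 := by
    rw [Measure.restrict_apply_univ]
    refine (measure_mono hI).trans ?_
    simp [T1]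
  unfold tN
  split_ifs with h
  · have hb1 : b/2 ≤ 1 := by simpa [h] using hab
    have h1 : ∀ᵐ t ∂(volume.restrict I), N t ≤ essSup N (volume.restrict T1) :=
      ae_mono (Measure.restrict_mono hI le_rfl) (ENNReal.ae_le_essSup N)
    calc _ ≤ ∫⁻ t in I, (essSup N (volume.restrict T1)) ^ a * ((1:ℝ≥0∞) ^ (0:ℝ) * w t ^ (b/2)) := by
          refine lintegral_mono_ae ?_
          filter_upwards [h1] with t ht
          rw [ENNReal.one_rpow, one_mul]
          gcongr
      _ = (essSup N (volume.restrict T1)) ^ a * ∫⁻ t in I, ((1:ℝ≥0∞) ^ (0:ℝ) * w t ^ (b/2)) := lintegral_const_mul _ (by fun_prop)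
      _ ≤ (essSup N (volume.restrict T1)) ^ a * ((∫⁻ t in I, 1) ^ (0:ℝ) * (∫⁻ t in I, w t) ^ (b/2)) := by
          gcongr
          exact lint3 hμ (f := fun _ => 1) measurable_const hw le_rfl (by positivity) (by linarith)
      _ = _ := by rw [ENNReal.rpow_zero, one_mul]
  · have hp0 : 0 < p.toReal := ENNReal.toReal_pos (by intro h0; simp [h0] at hp) h
    calc _ = ∫⁻ t in I, (N t ^ p.toReal) ^ (a * (1/p.toReal)) * w t ^ (b/2) := by
          refine lintegral_congr fun t => ?_
          rw [← ENNReal.rpow_mul]; congr 2; field_simp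
      _ ≤ (∫⁻ t in I, N t ^ p.toReal) ^ (a * (1/p.toReal)) * (∫⁻ t in I, w t) ^ (b/2) :=
          lint3 hμ (by fun_prop) hw (by positivity) (by positivity) hab
      _ ≤ _ := by
          rw [mul_comm a, ENNReal.rpow_mul]
          gcongr

lemma aniso_meas {u : E3 → ℝ → E3} (hu : Measurable (fun z : E3 × ℝ => u z.1 z.2)) (q1 q2 q3 : ℝ) :
    Measurable (fun t => anisoNorm q1 q2 q3 B1 (fun x => ‖u x t‖)) := by
  have h1 : Measurable (fun z : E3 × ℝ => ENNReal.ofReal |B1.indicator (fun x => ‖u x z.2‖) z.1|) := by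
    have e : (fun z : E3 × ℝ => ENNReal.ofReal |B1.indicator (fun x => ‖u x z.2‖) z.1|) =
        (B1 ×ˢ (univ : Set ℝ)).indicator (fun z => ENNReal.ofReal |‖u z.1 z.2‖|) := by
      ext z
      by_cases hz : z.1 ∈ B1
      · rw [indicator_of_mem hz, indicator_of_mem (by simpa using hz)]
      · rw [indicator_of_notMem hz, indicator_of_notMem (by simpa using hz)]; simp
    rw [e]
    refine Measurable.indicator (by fun_prop) (measurableSet_ball.prod MeasurableSet.univ)
  unfold anisoNorm
  have h2 : Measurable (fun z : ((ℝ × ℝ) × ℝ) × ℝ => ENNReal.ofReal |B1.indicator (fun x => ‖u x z.1.1.1‖) (pt3 z.2 z.1.2 z.1.1.2)| ^ q1) := by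
    refine Measurable.pow_const ?_ _
    exact Measurable.comp (g := fun z : E3 × ℝ => ENNReal.ofReal |B1.indicator (fun x => ‖u x z.2‖) z.1|)
      (f := fun z : ((ℝ × ℝ) × ℝ) × ℝ => (pt3 z.2 z.1.2 z.1.1.2, z.1.1.1)) h1
      (Measurable.prodMk (by fun_prop) (by fun_prop))
  have h3 := ((h2.lintegral_prod_right' (ν := volume)).pow_const (q2/q1)).lintegral_prod_right' (ν := volume)
  have h4 := (h3.pow_const (q3/q2)).lintegral_prod_right' (ν := volume)
  exact h4.pow_const _

section slice
variable {u : E3 → ℝ → E3} {P : E3 → ℝ → ℝ}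

lemma X_slice {q1 q2 q3 κ θ t1 t2 t3 : ℝ} (h1 : 0 < q1) (h2 : 0 < q2) (h3 : 0 < q3) (H : GNP (1/q1) (1/q2) (1/q3) κ θ t1 t2 t3) :
    ∃ C : ℝ≥0∞, C ≠ ∞ ∧ ∀ (u : E3 → ℝ → E3) (P : E3 → ℝ → ℝ) (sol : SuitableWeakSolution 1 u P) (δ ρ ρ2 : ℝ), 0 < δ → δ ≤ 1 → ρ2 + δ ≤ ρ → ρ ≤ 1 →
    ∀ᵐ t, t ∈ T1 → ∀ m : ℝ≥0∞, ∫⁻ x in ball (0:E3) ρ, ‖u x t‖ₑ^(2:ℝ) ≤ m^(2:ℝ) →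
      ∫⁻ x in ball (0:E3) ρ2, ‖u x t‖ₑ^(3:ℝ) ≤ (C * ENNReal.ofReal δ ^ (-1:ℝ) * ((anisoNorm q1 q2 q3 B1 (fun x => ‖u x t‖)) ^ κ * m ^ (1-κ-θ) *
        (m ^ θ + (∫⁻ x in ball (0:E3) ρ, Gr (sol.gu x t)) ^ (θ/2)))) ^ (3:ℝ) := by
  obtain ⟨C, hC, HM⟩ := GN_M H
  set c : ℝ≥0∞ := 2 ^ (5/2:ℝ) * VB 1 ^ (1/2:ℝ) with hc
  have cf : c ≠ ∞ := ENNReal.mul_ne_top (ENNReal.rpow_ne_top_of_nonneg (by norm_num) (by norm_num)) (ENNReal.rpow_ne_top_of_nonneg (by norm_num) VB_fin)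
  have θ0 := H.θ0
  refine ⟨C * (1 + c^θ), ENNReal.mul_ne_top hC (ENNReal.add_ne_top.2 ⟨by simp, ENNReal.rpow_ne_top_of_nonneg θ0.le cf⟩), ?_⟩
  intro u P sol δ ρ ρ2 hδ hδ1 hρ2 hρ
  have hfin : ∀ᵐ t, t ∈ T1 → ∫⁻ x in B1, ‖u x t‖ₑ ≠ ∞ := by
    have hb : Integrable (fun z : E3 × ℝ => ‖u z.1 z.2‖) (volume.restrict Q1) := by
      have um := u_meas sol
      refine intQ (by fun_prop) (r := 2) (by norm_num) (lt_of_le_of_lt (lintegral_mono fun z => le_of_eq ?_) (u_L2 sol))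
      rw [enorm_norm]
    rw [Q1_vol] at hb
    rw [← ae_restrict_iff' measurableSet_Ioo]
    filter_upwards [hb.prod_left_ae] with t ht
    have := ht.2
    simpa [hasFiniteIntegral_iff_enorm, lt_top_iff_ne_top] using this
  filter_upwards [D_slice sol, hfin] with t hD hfin tT m hm
  have hv : Measurable (fun x => u x t) := (u_meas sol).comp (Measurable.prodMk measurable_id measurable_const)
  set v : E3 → E3 := fun x => u x t with hvd
  set w := ∫⁻ x in ball (0:E3) ρ, Gr (sol.gu x t) with hw
  have mixN : mixC (1/q1) (1/q2) (1/q3) (fB ρ v) ≤ anisoNorm q1 q2 q3 B1 (fun x => ‖u x t‖) := by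
    refine le_trans (mixC_mono H.a1p H.a2p H.a3p fun x => ?_) (mixC_le_aniso h1 h2 h3 _ _)
    unfold fB
    by_cases hx : x ∈ ball (0:E3) ρ
    · rw [indicator_of_mem hx, indicator_of_mem (ball_subset_ball hρ hx), abs_of_nonneg (norm_nonneg _), ofReal_norm]
    · rw [indicator_of_notMem hx]; exact zero_le
  have fBr : ∀ s : ℝ, 0 < s → ∫⁻ x, fB ρ v x ^ s = ∫⁻ x in ball (0:E3) ρ, ‖u x t‖ₑ ^ s := fun s hs => by
    rw [← lintegral_indicator measurableSet_ball]
    refine lintegral_congr fun x => ?_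
    unfold fB
    by_cases hx : x ∈ ball (0:E3) ρ
    · rw [indicator_of_mem hx, indicator_of_mem hx]
    · rw [indicator_of_notMem hx, indicator_of_notMem hx, ENNReal.zero_rpow_of_pos hs]
  have hL : (∫⁻ x, fB ρ v x ^ (2:ℝ)) ^ (1/2:ℝ) ≤ m := by
    rw [fBr 2 (by norm_num)]
    calc _ ≤ (m^(2:ℝ))^(1/2:ℝ) := ENNReal.rpow_le_rpow hm (by norm_num)
      _ = m := by rw [← ENNReal.rpow_mul]; norm_num
  have hW : ∀ s : ℝ, 0 < s → s ≤ 1 → (∫⁻ x, QB1 ρ v s x ^ (2:ℝ)) ^ (1/2:ℝ) ≤ ENNReal.ofReal s ^ (5/2:ℝ) * (c * w^(1/2:ℝ)) := fun s hs hs1 => by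
    calc _ ≤ (ENNReal.ofReal (2*s)^(2:ℝ) * (VB (2*s) * w)) ^ (1/2:ℝ) := ENNReal.rpow_le_rpow (hD tT ρ s hρ hs) (by norm_num)
      _ = (ENNReal.ofReal (2*s)^(5:ℝ) * (VB 1 * w)) ^ (1/2:ℝ) := by
          rw [VB_eq (by positivity), show (5:ℝ) = 2 + 3 by norm_num, ENNReal.rpow_add_of_nonneg _ _ (by norm_num) (by norm_num)]
          congr 1; ring
      _ = ENNReal.ofReal (2*s)^(5/2:ℝ) * (VB 1 ^ (1/2:ℝ) * w^(1/2:ℝ)) := by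
          rw [ENNReal.mul_rpow_of_nonneg _ _ (by norm_num), ENNReal.mul_rpow_of_nonneg _ _ (by norm_num), ← ENNReal.rpow_mul]; norm_num
      _ = _ := by
          rw [ENNReal.ofReal_mul (by norm_num), ENNReal.mul_rpow_of_nonneg _ _ (by norm_num), hc]
          rw [show ENNReal.ofReal 2 = 2 by simp]; ring
  have HM2 := HM ρ δ v _ m _ hρ hδ hδ1 hv mixN hL hW
  have hfB : ∫⁻ x, fB ρ v x ≠ ∞ := by
    have := fBr 1 one_pos
    simp only [ENNReal.rpow_one] at this
    rw [this]
    exact ne_top_of_le_ne_top (hfin tT) (lintegral_mono_set (ball_subset_ball hρ))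
  have hle := fB_le_MB H.θ0 H.θ1 hδ hρ2 hv hfB
  have HX := GN_X_aux (fB_meas hv) hle (fun Φ hΦ => (HM2 Φ hΦ).trans (le_of_eq (by rw [mul_left_comm, mul_comm]))) 
  have e3 : ∫⁻ x in ball (0:E3) ρ2, ‖u x t‖ₑ^(3:ℝ) = ∫⁻ x in ball 0 ρ2, fB ρ v x ^ (3:ℝ) := by
    refine setLIntegral_congr_fun measurableSet_ball fun x hx => ?_
    unfold fB
    beta_reduce
    rw [indicator_of_mem (ball_subset_ball (by linarith) hx)]
  rw [e3]
  refine HX.trans (ENNReal.rpow_le_rpow ?_ (by norm_num))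
  have eW : (c * w^(1/2:ℝ)) ^ θ = c^θ * w^(θ/2) := by
    rw [ENNReal.mul_rpow_of_nonneg _ _ θ0.le, ← ENNReal.rpow_mul]; congr 2; ring
  rw [eW]
  have : m^θ + c^θ * w^(θ/2) ≤ (1 + c^θ) * (m^θ + w^(θ/2)) := by
    calc _ ≤ m^θ + c^θ * w^(θ/2) + (w^(θ/2) + c^θ * m^θ) := le_self_add
      _ = _ := by ring
  calc _ ≤ C * ENNReal.ofReal δ ^ (-1:ℝ) * (anisoNorm q1 q2 q3 B1 (fun x => ‖u x t‖) ^ κ * m ^ (1 - κ - θ) * ((1 + c^θ) * (m^θ + w^(θ/2)))) := by gcongr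
    _ = _ := by ring
end slice

end

section

lemma X_int {p : ℝ≥0∞} (hp : 1 ≤ p) {κ θ ε s : ℝ} (κ0 : 0 ≤ κ) (θ0 : 0 ≤ θ) (κθ : κ + θ ≤ 1) (ε0 : 0 ≤ ε) (s0 : 0 ≤ s)
    (hab : s * κ * (1/p.toReal) + (s*θ+ε)/2 ≤ 1) {I : Set ℝ} (hI : I ⊆ T1) {N w X : ℝ → ℝ≥0∞} (hN : Measurable N) (hw : Measurable w)
    {K m : ℝ≥0∞} (hK : K ≠ ∞)
    (hX : ∀ᵐ t ∂(volume.restrict I), X t ≤ K * (N t ^ κ * m ^ (1-κ-θ) * (m ^ θ + w t ^ (θ/2))) ^ s)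
    (hw2 : ∫⁻ t in I, w t ≤ m ^ (2:ℝ)) :
    ∫⁻ t in I, X t * w t ^ (ε/2) ≤ K * 2 ^ s * 2 * tN p N ^ (s*κ) * m ^ (s*(1-κ)+ε) := by
  have c0 : 0 ≤ 1 - κ - θ := by linarith
  have hp' : 0 ≤ 1/p.toReal := by positivity
  have sκ : 0 ≤ s*κ := by positivity
  have sθ : 0 ≤ s*θ := by positivity
  have sc : 0 ≤ s*(1-κ-θ) := by positivity
  have h1 := time_holder hp sκ ε0 (by linarith) hI hN hw
  have h2 := time_holder hp sκ (b := s*θ+ε) (by positivity) (by linarith) hI hN hw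
  have hm : ∀ b : ℝ, 0 ≤ b → (∫⁻ t in I, w t) ^ (b/2) ≤ m ^ b := fun b hb => by
    refine (ENNReal.rpow_le_rpow hw2 (by positivity)).trans (le_of_eq ?_)
    rw [← ENNReal.rpow_mul]; congr 1; ring
  have hpt : ∀ᵐ t ∂(volume.restrict I), X t * w t ^ (ε/2) ≤ (K * 2 ^ s) *
      (m ^ (s*(1-κ-θ) + s*θ) * (N t ^ (s*κ) * w t ^ (ε/2)) + m ^ (s*(1-κ-θ)) * (N t ^ (s*κ) * w t ^ ((s*θ+ε)/2))) := by
    filter_upwards [hX] with t ht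
    calc X t * w t ^ (ε/2) ≤ (K * (N t ^ κ * m ^ (1-κ-θ) * (m ^ θ + w t ^ (θ/2))) ^ s) * w t ^ (ε/2) := by gcongr
      _ = (K * (N t ^ (s*κ) * m ^ (s*(1-κ-θ)) * (m ^ θ + w t ^ (θ/2)) ^ s)) * w t ^ (ε/2) := by
          rw [ENNReal.mul_rpow_of_nonneg _ _ s0, ENNReal.mul_rpow_of_nonneg _ _ s0, ← ENNReal.rpow_mul, ← ENNReal.rpow_mul, mul_comm κ, mul_comm (1-κ-θ)]
      _ ≤ (K * (N t ^ (s*κ) * m ^ (s*(1-κ-θ)) * (2^s * ((m ^ θ)^s + (w t ^ (θ/2))^s)))) * w t ^ (ε/2) := by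
          gcongr; exact add_rpow_le2 _ _ s0
      _ = _ := by
          rw [← ENNReal.rpow_mul, ← ENNReal.rpow_mul, mul_comm θ s, show θ/2*s = s*θ/2 by ring, add_div,
            ENNReal.rpow_add_of_nonneg (x := m) _ _ sc sθ, ENNReal.rpow_add_of_nonneg (x := w t) _ _ (by positivity) (by positivity)]
          ring
  have hm1 : Measurable (fun t => m ^ (s*(1-κ-θ) + s*θ) * (N t ^ (s*κ) * w t ^ (ε/2))) := by fun_prop
  calc _ ≤ _ := lintegral_mono_ae hpt
    _ = (K * 2 ^ s) * ∫⁻ t in I, (m ^ (s*(1-κ-θ) + s*θ) * (N t ^ (s*κ) * w t ^ (ε/2)) + m ^ (s*(1-κ-θ)) * (N t ^ (s*κ) * w t ^ ((s*θ+ε)/2))) :=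
        lintegral_const_mul' _ _ (ENNReal.mul_ne_top hK (ENNReal.rpow_ne_top_of_nonneg s0 (by norm_num)))
    _ = (K * 2 ^ s) * (m ^ (s*(1-κ-θ) + s*θ) * (∫⁻ t in I, (N t ^ (s*κ) * w t ^ (ε/2))) + m ^ (s*(1-κ-θ)) * (∫⁻ t in I, (N t ^ (s*κ) * w t ^ ((s*θ+ε)/2)))) := by
        rw [lintegral_add_left hm1, lintegral_const_mul _ (by fun_prop), lintegral_const_mul _ (by fun_prop)]
    _ ≤ (K * 2 ^ s) * (m ^ (s*(1-κ-θ) + s*θ) * (tN p N ^ (s*κ) * m ^ ε) + m ^ (s*(1-κ-θ)) * (tN p N ^ (s*κ) * m ^ (s*θ+ε))) := by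
        gcongr
        · exact h1.trans (by gcongr; exact hm _ ε0)
        · exact h2.trans (by gcongr; exact hm _ (by positivity))
    _ = _ := by
        rw [show s*(1-κ)+ε = s*(1-κ-θ) + s*θ + ε by ring, ENNReal.rpow_add_of_nonneg (x := m) (s*(1-κ-θ) + s*θ) _ (by positivity) ε0,
          ENNReal.rpow_add_of_nonneg (x := m) _ _ sc sθ, ENNReal.rpow_add_of_nonneg (x := m) _ _ sθ ε0]
        ring

def EE (u : E3 → ℝ → E3) (g : E3 → ℝ → Fin 3 → Fin 3 → ℝ) (ρ : ℝ) : ℝ≥0∞ := linfL2sq ρ u + gradL2sq ρ g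

lemma EE_ae (u : E3 → ℝ → E3) (g : E3 → ℝ → Fin 3 → Fin 3 → ℝ) (ρ : ℝ) :
    ∀ᵐ t ∂(volume.restrict (Ioo (-(ρ^2)) 0)), ∫⁻ x in ball (0:E3) ρ, ‖u x t‖ₑ^(2:ℝ) ≤ EE u g ρ := by
  filter_upwards [ENNReal.ae_le_essSup (μ := volume.restrict (Ioo (-(ρ^2)) 0)) (fun t => ∫⁻ x in ball (0 : E3) ρ, ((‖u x t‖₊ : ℝ≥0∞)) ^ 2)] with t ht
  refine le_trans ?_ (ht.trans le_self_add)
  refine lintegral_mono fun x => le_of_eq ?_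
  rw [ENNReal.rpow_two]; rfl

lemma EE_g (u : E3 → ℝ → E3) (g : E3 → ℝ → Fin 3 → Fin 3 → ℝ) (ρ : ℝ) :
    ∫⁻ t in Ioo (-(ρ^2)) 0, ∫⁻ x in ball (0:E3) ρ, Gr (g x t) ≤ EE u g ρ := le_add_self

lemma I_sub {ρ : ℝ} (h0 : 0 ≤ ρ) (h : ρ ≤ 1) : Ioo (-(ρ^2)) 0 ⊆ T1 := Ioo_subset_Ioo_left (by nlinarith)

lemma Gslice_meas {u : E3 → ℝ → E3} {P : E3 → ℝ → ℝ} (sol : SuitableWeakSolution 1 u P) (ρ : ℝ) :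
    Measurable (fun t => ∫⁻ x in ball (0:E3) ρ, Gr (sol.gu x t)) := by
  have h : Measurable (fun z : E3 × ℝ => Gr (sol.gu z.1 z.2)) := Gr_meas.comp (gu_meas sol)
  exact Measurable.lintegral_prod_left' (μ := volume.restrict (ball (0:E3) ρ)) h

lemma X_time {p : ℝ≥0∞} (hp : 1 ≤ p) {q1 q2 q3 κ θ t1 t2 t3 ε σ : ℝ} (h1 : 0 < q1) (h2 : 0 < q2) (h3 : 0 < q3) (H : GNP (1/q1) (1/q2) (1/q3) κ θ t1 t2 t3)
    (ε0 : 0 ≤ ε) (σ0 : 0 ≤ σ) (σ1 : σ ≤ 1) (hab : 3 * σ * κ * (1/p.toReal) + (3*σ*θ+ε)/2 ≤ 1) :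
    ∃ C : ℝ≥0∞, C ≠ ∞ ∧ ∀ (u : E3 → ℝ → E3) (P : E3 → ℝ → ℝ) (sol : SuitableWeakSolution 1 u P) (δ ρ ρ2 : ℝ), 0 < δ → δ ≤ 1 → ρ2 + δ ≤ ρ → 0 ≤ ρ → ρ ≤ 1 →
    ∫⁻ t in Ioo (-(ρ^2)) 0, (∫⁻ x in ball (0:E3) ρ2, ‖u x t‖ₑ^(3:ℝ))^σ * (∫⁻ x in ball (0:E3) ρ, Gr (sol.gu x t))^(ε/2) ≤
      C * ENNReal.ofReal δ ^ (-3:ℝ) * (tN p (fun t => anisoNorm q1 q2 q3 B1 (fun x => ‖u x t‖)) ^ (3*σ*κ) * (EE u sol.gu ρ) ^ ((3*σ*(1-κ)+ε)/2)) := by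
  obtain ⟨C, hC, HX⟩ := X_slice h1 h2 h3 H
  have s0 : 0 ≤ 3*σ := by positivity
  refine ⟨C^(3*σ) * 2^(3*σ) * 2, by
    refine ENNReal.mul_ne_top (ENNReal.mul_ne_top (ENNReal.rpow_ne_top_of_nonneg s0 hC) (ENNReal.rpow_ne_top_of_nonneg s0 (by norm_num))) (by norm_num), ?_⟩
  intro u P sol δ ρ ρ2 hδ hδ1 hρ2 hρ0 hρ
  set m := (EE u sol.gu ρ)^(1/2:ℝ) with hm
  have hm2 : m^(2:ℝ) = EE u sol.gu ρ := by rw [hm, ← ENNReal.rpow_mul]; norm_num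
  have dpos : ENNReal.ofReal δ ≠ 0 := by simpa using hδ
  have dle : ENNReal.ofReal δ ≤ 1 := by simpa using hδ1
  have hd : (ENNReal.ofReal δ ^ (-1:ℝ))^(3*σ) ≤ ENNReal.ofReal δ ^ (-3:ℝ) := by
    rw [← ENNReal.rpow_mul]
    exact ENNReal.rpow_le_rpow_of_exponent_ge dle (by linarith)
  have hIm := I_sub hρ0 hρ
  have key := X_int (K := C^(3*σ) * ENNReal.ofReal δ ^ (-3:ℝ)) (m := m) (X := fun t => (∫⁻ x in ball (0:E3) ρ2, ‖u x t‖ₑ^(3:ℝ))^σ) hp H.κ0 H.θ0.le H.κθ ε0 s0 hab hIm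
    (aniso_meas (u_meas sol) q1 q2 q3) (Gslice_meas sol ρ) (by
      refine ENNReal.mul_ne_top (ENNReal.rpow_ne_top_of_nonneg s0 hC) ?_
      exact ENNReal.rpow_ne_top_of_ne_zero dpos (by simp))
    (by
      filter_upwards [EE_ae u sol.gu ρ, ae_restrict_of_ae (HX u P sol δ ρ ρ2 hδ hδ1 hρ2 hρ), ae_restrict_mem measurableSet_Ioo] with t e1 e2 e3
      have := e2 (hIm e3) m (by rw [hm2]; exact e1)
      calc _ ≤ _ := ENNReal.rpow_le_rpow this σ0
        _ = C^(3*σ) * (ENNReal.ofReal δ ^ (-1:ℝ))^(3*σ) * (anisoNorm q1 q2 q3 B1 (fun x => ‖u x t‖) ^ κ * m ^ (1 - κ - θ) *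
              (m ^ θ + (∫⁻ x in ball (0:E3) ρ, Gr (sol.gu x t)) ^ (θ/2)))^(3*σ) := by
            rw [← ENNReal.rpow_mul, ENNReal.mul_rpow_of_nonneg _ _ s0, ENNReal.mul_rpow_of_nonneg _ _ s0]
        _ ≤ _ := by gcongr)
    (by rw [hm2]; exact EE_g u sol.gu ρ)
  refine key.trans (le_of_eq ?_)
  have : m ^ (3*σ*(1-κ)+ε) = (EE u sol.gu ρ) ^ ((3*σ*(1-κ)+ε)/2) := by
    rw [hm, ← ENNReal.rpow_mul]; congr 1; ring
  rw [this]
  ring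

end

section

lemma mass_holder {X : Type*} [MeasurableSpace X] {μ : Measure X} {f : X → ℝ≥0∞} (hf : Measurable f) {x : ℝ} (hx : 0 ≤ x) (hx1 : x ≤ 1) :
    ∫⁻ z, f z ^ x ∂μ ≤ (∫⁻ z, f z ∂μ)^x * μ univ ^ (1-x) := by
  have h := ENNReal.lintegral_prod_norm_pow_le (μ := μ) (Finset.univ : Finset (Fin 2)) (f := ![f, fun _ => 1]) (p := ![x, 1-x])
    (by intro i _; fin_cases i <;> simp <;> fun_prop) (by simp [Fin.sum_univ_two])
    (by intro i _; fin_cases i <;> simp <;> linarith)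
  simpa only [Fin.prod_univ_two, Matrix.cons_val_zero, Matrix.cons_val_one, Matrix.cons_val, ENNReal.one_rpow, mul_one,
    lintegral_const, one_mul] using h

def YY (α : ℝ) (N Pi1 : ℝ≥0∞) : ℝ≥0∞ := N^(2:ℝ) + N^(2*α/(α-1)) + Pi1^(2:ℝ)

lemma YY_bounds {α κ : ℝ} (hα : 1 < α) (hκ : α < 3*κ) (N Pi1 : ℝ≥0∞) :
    N^(2*κ) ≤ YY α N Pi1 ^ κ ∧ N^(3*κ) ≤ YY α N Pi1 ^ ((3*κ-1)/2) ∧ N^α ≤ YY α N Pi1 ^ ((α-1)/2) ∧ Pi1 ≤ YY α N Pi1 ^ (1/2:ℝ) := by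
  have h1 : N^(2:ℝ) ≤ YY α N Pi1 := by unfold YY; rw [add_assoc]; exact le_self_add
  have h2 : N^(2*α/(α-1)) ≤ YY α N Pi1 := by unfold YY; rw [add_right_comm]; exact le_add_self
  have h3 : Pi1^(2:ℝ) ≤ YY α N Pi1 := by unfold YY; exact le_add_self
  have a1 : 0 < α - 1 := by linarith
  have k1 : 0 < 3*κ - 1 := by linarith
  refine ⟨?_, ?_, ?_, ?_⟩
  · rw [ENNReal.rpow_mul]; exact ENNReal.rpow_le_rpow h1 (by linarith)
  · have h4 : N^(6*κ/(3*κ-1)) ≤ YY α N Pi1 := by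
      rcases le_total N 1 with h | h
      · refine le_trans (ENNReal.rpow_le_rpow_of_exponent_ge h ?_) h1
        rw [le_div_iff₀ k1]; linarith
      · refine le_trans (ENNReal.rpow_le_rpow_of_exponent_le h ?_) h2
        rw [div_le_div_iff₀ k1 a1]; nlinarith
    have : 3*κ = 6*κ/(3*κ-1) * ((3*κ-1)/2) := by field_simp; ring
    conv_lhs => rw [this, ENNReal.rpow_mul]
    exact ENNReal.rpow_le_rpow h4 (by linarith)
  · have : α = 2*α/(α-1) * ((α-1)/2) := by field_simp
    conv_lhs => rw [this, ENNReal.rpow_mul]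
    exact ENNReal.rpow_le_rpow h2 (by linarith)
  · calc Pi1 = (Pi1^(2:ℝ))^(1/2:ℝ) := by rw [← ENNReal.rpow_mul]; norm_num
      _ ≤ _ := ENNReal.rpow_le_rpow h3 (by norm_num)

def NN (p : ℝ≥0∞) (q1 q2 q3 : ℝ) (u : E3 → ℝ → E3) : ℝ≥0∞ := tN p (fun t => anisoNorm q1 q2 q3 B1 (fun x => ‖u x t‖))
def PP (P : E3 → ℝ → ℝ) : ℝ≥0∞ := ∫⁻ t in T1, ∫⁻ x in B1, ‖P x t‖ₑ

lemma slice_meas {u : E3 → ℝ → E3} {P : E3 → ℝ → ℝ} (sol : SuitableWeakSolution 1 u P) (s : ℝ) (ρ : ℝ) :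
    Measurable (fun t => ∫⁻ x in ball (0:E3) ρ, ‖u x t‖ₑ^s) := by
  have um := u_meas sol
  have h : Measurable (fun z : E3 × ℝ => ‖u z.1 z.2‖ₑ^s) := by fun_prop
  exact Measurable.lintegral_prod_left' (μ := volume.restrict (ball (0:E3) ρ)) h

lemma Pslice_meas {u : E3 → ℝ → E3} {P : E3 → ℝ → ℝ} (sol : SuitableWeakSolution 1 u P) (ρ : ℝ) :
    Measurable (fun t => ∫⁻ x in ball (0:E3) ρ, ‖P x t‖ₑ) := by
  have um := P_meas sol
  have h : Measurable (fun z : E3 × ℝ => ‖P z.1 z.2‖ₑ) := by fun_prop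
  exact Measurable.lintegral_prod_left' (μ := volume.restrict (ball (0:E3) ρ)) h

lemma PUslice_meas {u : E3 → ℝ → E3} {P : E3 → ℝ → ℝ} (sol : SuitableWeakSolution 1 u P) (ρ : ℝ) :
    Measurable (fun t => ∫⁻ x in ball (0:E3) ρ, ‖P x t‖ₑ * ‖u x t‖ₑ) := by
  have um := P_meas sol
  have um2 := u_meas sol
  have h : Measurable (fun z : E3 × ℝ => ‖P z.1 z.2‖ₑ * ‖u z.1 z.2‖ₑ) := by fun_prop
  exact Measurable.lintegral_prod_left' (μ := volume.restrict (ball (0:E3) ρ)) h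

lemma Dn_split {u : E3 → ℝ → E3} {P : E3 → ℝ → ℝ} (sol : SuitableWeakSolution 1 u P) {I J : Set ℝ} (hIJ : I ⊆ J) (ρ : ℝ) :
    ∫⁻ s in I, ∫⁻ x in ball (0:E3) ρ, Dn u P x s ≤ (∫⁻ s in J, ∫⁻ x in ball (0:E3) ρ, ‖u x s‖ₑ^(2:ℝ)) +
      (∫⁻ s in J, ∫⁻ x in ball (0:E3) ρ, ‖u x s‖ₑ^(3:ℝ)) + ∫⁻ s in J, ∫⁻ x in ball (0:E3) ρ, ‖P x s‖ₑ * ‖u x s‖ₑ := by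
  refine (lintegral_mono_set hIJ).trans (le_of_eq ?_)
  have m2 := slice_meas sol 2 ρ
  have m3 := slice_meas sol 3 ρ
  rw [← lintegral_add_left m2, ← lintegral_add_left (f := fun a => (∫⁻ x in ball (0:E3) ρ, ‖u x a‖ₑ^(2:ℝ)) + ∫⁻ x in ball (0:E3) ρ, ‖u x a‖ₑ^(3:ℝ)) (m2.add m3)]
  refine lintegral_congr fun s => ?_
  have us : Measurable (fun x => u x s) := (u_meas sol).comp (Measurable.prodMk measurable_id measurable_const)
  rw [← lintegral_add_left (by fun_prop), ← lintegral_add_left (by fun_prop)]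
  rfl

/-- velocity term -/
lemma u2_slice {u : E3 → ℝ → E3} {P : E3 → ℝ → ℝ} (sol : SuitableWeakSolution 1 u P) {ρ : ℝ} (h : ρ ≤ 1) (t : ℝ) :
    ∫⁻ x in ball (0:E3) ρ, ‖u x t‖ₑ^(2:ℝ) ≤ VB 1 ^ (1/3:ℝ) * (∫⁻ x in ball (0:E3) ρ, ‖u x t‖ₑ^(3:ℝ))^(2/3:ℝ) := by
  have us : Measurable (fun x => u x t) := (u_meas sol).comp (Measurable.prodMk measurable_id measurable_const)
  have := mass_holder (μ := volume.restrict (ball (0:E3) ρ)) (f := fun x => ‖u x t‖ₑ^(3:ℝ)) (by fun_prop) (x := 2/3) (by norm_num) (by norm_num)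
  simp only [← ENNReal.rpow_mul, show (3:ℝ)*(2/3) = 2 by norm_num, Measure.restrict_apply_univ, show (1:ℝ)-2/3 = 1/3 by norm_num] at this
  rw [mul_comm]
  refine this.trans ?_
  gcongr
  exact measure_mono (ball_subset_ball h)

lemma u1_slice {u : E3 → ℝ → E3} {P : E3 → ℝ → ℝ} (sol : SuitableWeakSolution 1 u P) {ρ : ℝ} (h : ρ ≤ 1) (t : ℝ) :
    ∫⁻ x in ball (0:E3) ρ, ‖u x t‖ₑ ≤ VB 1 ^ (1/2:ℝ) * (∫⁻ x in ball (0:E3) ρ, ‖u x t‖ₑ^(2:ℝ))^(1/2:ℝ) := by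
  have us : Measurable (fun x => u x t) := (u_meas sol).comp (Measurable.prodMk measurable_id measurable_const)
  have := mass_holder (μ := volume.restrict (ball (0:E3) ρ)) (f := fun x => ‖u x t‖ₑ^(2:ℝ)) (by fun_prop) (x := 1/2) (by norm_num) (by norm_num)
  simp only [← ENNReal.rpow_mul, show (2:ℝ)*(1/2) = 1 by norm_num, ENNReal.rpow_one, Measure.restrict_apply_univ, show (1:ℝ)-1/2 = 1/2 by norm_num] at this
  rw [mul_comm]
  refine this.trans ?_
  gcongr
  exact measure_mono (ball_subset_ball h)

lemma step {p : ℝ≥0∞} (hp : 1 ≤ p) {q1 q2 q3 κ θ t1 t2 t3 ε α : ℝ} (h1 : 0 < q1) (h2 : 0 < q2) (h3 : 0 < q3) (H : GNP (1/q1) (1/q2) (1/q3) κ θ t1 t2 t3)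
    (ε0 : 0 < ε) (ε1 : ε < 1) (e1 : 3*κ*(1/p.toReal) + 3*θ/2 ≤ 1) (e2 : 3*κ*(1-ε/3) = α)
    (e3 : 3*κ*(1-ε/3)*(1/p.toReal) + (3*θ*(1-ε/3)+ε)/2 ≤ 1) (hα : 1 < α) (hκ : α < 3*κ) :
    ∃ A : ℝ≥0∞, A ≠ ∞ ∧ ∀ (u : E3 → ℝ → E3) (P : E3 → ℝ → ℝ) (sol : SuitableWeakSolution 1 u P) (r ρ : ℝ), 1/2 ≤ r → r < ρ → ρ ≤ 1 →
      EE u sol.gu r ≤ A * ENNReal.ofReal (ρ-r) ^ (-5:ℝ) * ∑ i, (YY α (NN p q1 q2 q3 u) (PP P)) ^ ((![κ, (3*κ-1)/2, (α-1)/2, 1/2] : Fin 4 → ℝ) i) *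
        (EE u sol.gu ρ) ^ (1 - (![κ, (3*κ-1)/2, (α-1)/2, 1/2] : Fin 4 → ℝ) i) := by
  obtain ⟨C0, C00, HE⟩ := energy
  obtain ⟨Cp, hCp, HP⟩ := press_slice ε0 ε1
  have hp' : 0 ≤ 1/p.toReal := by positivity
  have κ0 := H.κ0
  have θ0 := H.θ0
  obtain ⟨C2, hC2, H2⟩ := X_time hp h1 h2 h3 H (ε := 0) (σ := 2/3) le_rfl (by norm_num) (by norm_num) (by nlinarith)
  obtain ⟨C3, hC3, H3⟩ := X_time hp h1 h2 h3 H (ε := 0) (σ := 1) le_rfl (by norm_num) (by norm_num) (by linarith)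
  obtain ⟨C4, hC4, H4⟩ := X_time hp h1 h2 h3 H (ε := ε) (σ := 1-ε/3) ε0.le (by linarith) (by linarith) (by linarith)
  have V3 : VB 1 ^ (1/3:ℝ) ≠ ∞ := ENNReal.rpow_ne_top_of_nonneg (by norm_num) VB_fin
  have V2 : VB 1 ^ (1/2:ℝ) ≠ ∞ := ENNReal.rpow_ne_top_of_nonneg (by norm_num) VB_fin
  set K : ℝ≥0∞ := VB 1 ^ (1/3:ℝ) * C2 + C3 + Cp * (VB 1 ^ (1/2:ℝ) + C4) with hK
  have Kf : K ≠ ∞ := by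
    refine ENNReal.add_ne_top.2 ⟨ENNReal.add_ne_top.2 ⟨ENNReal.mul_ne_top V3 hC2, hC3⟩, ENNReal.mul_ne_top hCp (ENNReal.add_ne_top.2 ⟨V2, hC4⟩)⟩
  refine ⟨ENNReal.ofReal (16*C0) * 512 * K, ENNReal.mul_ne_top (ENNReal.mul_ne_top ENNReal.ofReal_ne_top (by norm_num)) Kf, ?_⟩
  intro u P sol r ρ hr hrρ hρ
  set h := ρ - r with hh
  have h0 : 0 < h := by linarith
  have h12 : h ≤ 1/2 := by linarith
  set N := NN p q1 q2 q3 u with hN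
  set F := EE u sol.gu ρ with hF
  set Y := YY α N (PP P) with hY
  set D := ENNReal.ofReal (h/8) ^ (-3:ℝ) with hD
  obtain ⟨y0, y1, y2, y3⟩ := YY_bounds hα hκ N (PP P)
  have δ0 : 0 < h/8 := by linarith
  have δ1 : h/8 ≤ 1 := by linarith
  have D1 : 1 ≤ D := by
    rw [hD, show (-3:ℝ) = -(3) by norm_num, ENNReal.rpow_neg, ENNReal.one_le_inv]
    exact ENNReal.rpow_le_one (by simpa using δ1) (by norm_num)
  have Df : D ≠ ∞ := ENNReal.rpow_ne_top_of_ne_zero (by simpa using δ0) (by simp)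
  have hen := HE u P sol r (r+h/4) hr (by linarith) (by linarith)
  have X2 := H2 u P sol (h/8) ρ (r+3*h/4) δ0 δ1 (by linarith) (by linarith) hρ
  have X3 := H3 u P sol (h/8) ρ (r+3*h/4) δ0 δ1 (by linarith) (by linarith) hρ
  have X4 := H4 u P sol (h/8) ρ (r+3*h/4) δ0 δ1 (by linarith) (by linarith) hρ
  have hp2 := HP u P sol (h/8) (r+h/4) (r+3*h/4) δ0 δ1 (by linarith) (by linarith)
  set J := Ioo (-(ρ^2)) (0:ℝ) with hJ
  have JT : J ⊆ T1 := I_sub (by linarith) hρ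
  have sub12 : ball (0:E3) (r+h/4) ⊆ ball 0 (r+3*h/4) := ball_subset_ball (by linarith)
  have sub2 : ball (0:E3) (r+3*h/4) ⊆ ball 0 ρ := ball_subset_ball (by linarith)
  have sub1 : ball (0:E3) (r+h/4) ⊆ ball 0 ρ := ball_subset_ball (by linarith)
  simp only [zero_div, ENNReal.rpow_zero, mul_one, ENNReal.rpow_one, add_zero] at X2 X3
  have T2 : ∫⁻ s in J, ∫⁻ x in ball (0:E3) (r+h/4), ‖u x s‖ₑ^(2:ℝ) ≤ VB 1 ^ (1/3:ℝ) * C2 * (D * (Y^κ * F^(1-κ))) := by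
    calc _ ≤ ∫⁻ s in J, VB 1 ^ (1/3:ℝ) * (∫⁻ x in ball (0:E3) (r+3*h/4), ‖u x s‖ₑ^(3:ℝ))^(2/3:ℝ) := by
          refine lintegral_mono fun s => (u2_slice sol (by linarith) s).trans ?_
          gcongr
      _ = VB 1 ^ (1/3:ℝ) * ∫⁻ s in J, (∫⁻ x in ball (0:E3) (r+3*h/4), ‖u x s‖ₑ^(3:ℝ))^(2/3:ℝ) := lintegral_const_mul' _ _ V3
      _ ≤ VB 1 ^ (1/3:ℝ) * (C2 * D * (N^(3*(2/3)*κ) * F^((3*(2/3)*(1-κ))/2))) := by gcongr; exact X2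
      _ ≤ VB 1 ^ (1/3:ℝ) * (C2 * D * (Y^κ * F^(1-κ))) := by
          rw [show 3*(2/3)*κ = 2*κ by ring, show 3*(2/3)*(1-κ)/2 = 1-κ by ring]
          gcongr
      _ = _ := by ring
  have T3 : ∫⁻ s in J, ∫⁻ x in ball (0:E3) (r+h/4), ‖u x s‖ₑ^(3:ℝ) ≤ C3 * (D * (Y^((3*κ-1)/2) * F^(1-(3*κ-1)/2))) := by
    calc _ ≤ ∫⁻ s in J, ∫⁻ x in ball (0:E3) (r+3*h/4), ‖u x s‖ₑ^(3:ℝ) := lintegral_mono fun s => lintegral_mono_set sub12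
      _ ≤ _ := X3
      _ ≤ C3 * D * (Y^((3*κ-1)/2) * F^(1-(3*κ-1)/2)) := by
          rw [show 3*(1-κ)/2 = 1-(3*κ-1)/2 by ring]
          gcongr
          exact y1
      _ = _ := by ring
  have T4 : ∫⁻ s in J, (∫⁻ x in ball (0:E3) (r+3*h/4), ‖u x s‖ₑ^(3:ℝ))^(1-ε/3) * (∫⁻ x in ball (0:E3) ρ, Gr (sol.gu x s))^(ε/2) ≤ C4 * (D * (Y^((α-1)/2) * F^(1-(α-1)/2))) := by
    refine X4.trans ?_
    rw [show 3*(1-ε/3)*κ = α by rw [← e2]; ring, show (3*(1-ε/3)*(1-κ)+ε)/2 = 1-(α-1)/2 by rw [← e2]; ring, mul_assoc]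
    gcongr
    exact y2
  have T5 : ∫⁻ s in J, (∫⁻ x in B1, ‖P x s‖ₑ) * ∫⁻ x in ball (0:E3) (r+h/4), ‖u x s‖ₑ ≤ VB 1 ^ (1/2:ℝ) * (Y^(1/2:ℝ) * F^(1-1/2:ℝ)) := by
    calc _ ≤ ∫⁻ s in J, (∫⁻ x in B1, ‖P x s‖ₑ) * (VB 1 ^ (1/2:ℝ) * F^(1-1/2:ℝ)) := by
          refine lintegral_mono_ae ?_
          filter_upwards [EE_ae u sol.gu ρ] with s hs
          gcongr
          refine (lintegral_mono_set sub1).trans ((u1_slice sol hρ s).trans ?_)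
          rw [show (1-1/2:ℝ) = 1/2 by norm_num]
          gcongr
      _ = (∫⁻ s in J, ∫⁻ x in B1, ‖P x s‖ₑ) * (VB 1 ^ (1/2:ℝ) * F^(1-1/2:ℝ)) := lintegral_mul_const _ (Pslice_meas sol 1)
      _ ≤ Y^(1/2:ℝ) * (VB 1 ^ (1/2:ℝ) * F^(1-1/2:ℝ)) := by
          gcongr
          exact (lintegral_mono_set JT).trans y3
      _ = _ := by ring
  have TP : ∫⁻ s in J, ∫⁻ x in ball (0:E3) (r+h/4), ‖P x s‖ₑ * ‖u x s‖ₑ ≤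
      Cp * (VB 1 ^ (1/2:ℝ) * (D * (Y^(1/2:ℝ) * F^(1-1/2:ℝ))) + C4 * (D * (Y^((α-1)/2) * F^(1-(α-1)/2)))) := by
    have us1 := slice_meas sol 1 (r+h/4)
    simp only [ENNReal.rpow_one] at us1
    have ps1 := Pslice_meas sol 1
    calc _ ≤ ∫⁻ s in J, Cp * (D * ((∫⁻ x in B1, ‖P x s‖ₑ) * ∫⁻ x in ball (0:E3) (r+h/4), ‖u x s‖ₑ) +
            (∫⁻ x in ball (0:E3) (r+3*h/4), ‖u x s‖ₑ^(3:ℝ))^(1-ε/3) * (∫⁻ x in ball (0:E3) ρ, Gr (sol.gu x s))^(ε/2)) := by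
          refine lintegral_mono_ae ?_
          filter_upwards [ae_restrict_of_ae hp2, ae_restrict_mem measurableSet_Ioo] with s hs hsJ
          refine (hs (JT hsJ)).trans ?_
          gcongr
      _ = Cp * (D * (∫⁻ s in J, (∫⁻ x in B1, ‖P x s‖ₑ) * ∫⁻ x in ball (0:E3) (r+h/4), ‖u x s‖ₑ) + 
            ∫⁻ s in J, (∫⁻ x in ball (0:E3) (r+3*h/4), ‖u x s‖ₑ^(3:ℝ))^(1-ε/3) * (∫⁻ x in ball (0:E3) ρ, Gr (sol.gu x s))^(ε/2)) := by
          rw [lintegral_const_mul' _ _ hCp, lintegral_add_left (f := fun s => D * ((∫⁻ x in B1, ‖P x s‖ₑ) * ∫⁻ x in ball (0:E3) (r+h/4), ‖u x s‖ₑ)) ((ps1.mul us1).const_mul D),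
            lintegral_const_mul' _ _ Df]
      _ ≤ Cp * (D * (VB 1 ^ (1/2:ℝ) * (Y^(1/2:ℝ) * F^(1-1/2:ℝ))) + C4 * (D * (Y^((α-1)/2) * F^(1-(α-1)/2)))) := by gcongr
      _ = _ := by ring
  have hS : ∑ i, Y ^ ((![κ, (3*κ-1)/2, (α-1)/2, 1/2] : Fin 4 → ℝ) i) * F ^ (1 - (![κ, (3*κ-1)/2, (α-1)/2, 1/2] : Fin 4 → ℝ) i)
      = Y^κ * F^(1-κ) + Y^((3*κ-1)/2) * F^(1-(3*κ-1)/2) + Y^((α-1)/2) * F^(1-(α-1)/2) + Y^(1/2:ℝ) * F^(1-1/2:ℝ) := by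
    simp only [Fin.sum_univ_four, Matrix.cons_val_zero, Matrix.cons_val_one, Matrix.cons_val]
  rw [hS]
  set Z0 := Y^κ * F^(1-κ)
  set Z1 := Y^((3*κ-1)/2) * F^(1-(3*κ-1)/2)
  set Z2 := Y^((α-1)/2) * F^(1-(α-1)/2)
  set Z3 := Y^(1/2:ℝ) * F^(1-1/2:ℝ)
  have hc : ENNReal.ofReal (C0/(r+h/4-r)^2) * D = ENNReal.ofReal (16*C0) * 512 * ENNReal.ofReal h ^ (-5:ℝ) := by
    rw [hD, ENNReal.ofReal_rpow_of_pos δ0, ENNReal.ofReal_rpow_of_pos h0, ← ENNReal.ofReal_mul (by positivity), show (512:ℝ≥0∞) = ENNReal.ofReal 512 by simp,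
      ← ENNReal.ofReal_mul (by positivity), ← ENNReal.ofReal_mul (by positivity)]
    congr 1
    rw [show (-3:ℝ) = -((3:ℕ):ℝ) by norm_num, show (-5:ℝ) = -((5:ℕ):ℝ) by norm_num, Real.rpow_neg δ0.le, Real.rpow_neg h0.le, Real.rpow_natCast, Real.rpow_natCast,
      show r+h/4-r = h/4 by ring]
    field_simp
    norm_num
  calc EE u sol.gu r ≤ _ := hen
    _ ≤ ENNReal.ofReal (C0/(r+h/4-r)^2) * (VB 1 ^ (1/3:ℝ) * C2 * (D * Z0) + C3 * (D * Z1) + Cp * (VB 1 ^ (1/2:ℝ) * (D * Z3) + C4 * (D * Z2))) := by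
        gcongr
        refine (Dn_split sol (J := J) (Ioo_subset_Ioo_left (by nlinarith)) _).trans ?_
        gcongr
    _ = ENNReal.ofReal (C0/(r+h/4-r)^2) * D * (VB 1 ^ (1/3:ℝ) * C2 * Z0 + C3 * Z1 + Cp * (VB 1 ^ (1/2:ℝ) * Z3 + C4 * Z2)) := by ring
    _ ≤ ENNReal.ofReal (C0/(r+h/4-r)^2) * D * (K * (Z0 + Z1 + Z2 + Z3)) := by
        have k0 : VB 1 ^ (1/3:ℝ) * C2 ≤ K := by rw [hK, add_assoc]; exact le_self_add
        have k1 : C3 ≤ K := by rw [hK, add_right_comm]; exact le_add_self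
        have k2 : Cp * VB 1 ^ (1/2:ℝ) ≤ K := by rw [hK, mul_add, ← add_assoc, add_right_comm]; exact le_add_self
        have k3 : Cp * C4 ≤ K := by rw [hK, mul_add, ← add_assoc]; exact le_add_self
        calc _ = ENNReal.ofReal (C0/(r+h/4-r)^2) * D * (VB 1 ^ (1/3:ℝ) * C2 * Z0 + C3 * Z1 + Cp * C4 * Z2 + Cp * VB 1 ^ (1/2:ℝ) * Z3) := by ring
          _ ≤ ENNReal.ofReal (C0/(r+h/4-r)^2) * D * (K * Z0 + K * Z1 + K * Z2 + K * Z3) := by gcongr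
          _ = _ := by ring
    _ = _ := by rw [hc]; ring

end

section

lemma EE_mono (u : E3 → ℝ → E3) (g : E3 → ℝ → Fin 3 → Fin 3 → ℝ) {r s : ℝ} (h0 : 0 ≤ r) (h : r ≤ s) : EE u g r ≤ EE u g s := by
  have hI : Ioo (-(r^2)) (0:ℝ) ⊆ Ioo (-(s^2)) 0 := Ioo_subset_Ioo_left (by nlinarith)
  have hB : ball (0:E3) r ⊆ ball 0 s := ball_subset_ball h
  unfold EE
  refine add_le_add ?_ ?_
  · unfold linfL2sq
    refine le_trans (essSup_mono_measure' (Measure.restrict_mono hI le_rfl)) ?_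
    exact essSup_mono_ae (Eventually.of_forall fun t => lintegral_mono_set hB)
  · unfold gradL2sq
    exact (lintegral_mono_set hI).trans (lintegral_mono fun t => lintegral_mono_set hB)

lemma unit_case {p : ℝ≥0∞} (hp : 1 ≤ p) {q1 q2 q3 α : ℝ} (hq1 : 1 < q1) (hq2 : 1 < q2) (hq3 : 1 < q3)
    (hα : α * (2*(1/p.toReal) + (1/q1 + 1/q2 + 1/q3)) = 2) (hα1 : 1 < α)
    (hqa1 : q1 ≤ 2*α/(α-1)) (hqa2 : q2 ≤ 2*α/(α-1)) (hqa3 : q3 ≤ 2*α/(α-1))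
    (h7 : 0 ≤ 7 - 3*α - 4*α*(1/p.toReal)) :
    ∃ C : ℝ≥0∞, C ≠ ∞ ∧ ∀ (u : E3 → ℝ → E3) (P : E3 → ℝ → ℝ) (sol : SuitableWeakSolution 1 u P),
      EE u sol.gu (1/2) ≤ C * YY α (NN p q1 q2 q3 u) (PP P) := by
  have a1 : 0 < α - 1 := by linarith
  have hy : ∀ q : ℝ, 1 < q → q ≤ 2*α/(α-1) → 0 ≤ α*(1/q) - (α-1)/2 := fun q hq h => by
    rw [le_div_iff₀ a1] at h
    have : (α-1)/2 ≤ α*(1/q) := by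
      rw [mul_one_div, div_le_div_iff₀ two_pos (by linarith)]; linarith
    linarith
  have hl : ∀ q : ℝ, 1 < q → 1/q < 1 := fun q hq => by rw [div_lt_one (by linarith)]; exact hq
  have hpp : 1/p.toReal ≤ 1 := by
    by_cases h : p = ∞
    · simp [h]
    · have : 1 ≤ p.toReal := by
        rw [← ENNReal.toReal_one]; exact ENNReal.toReal_mono h hp
      rw [div_le_one (by linarith)]; exact this
  obtain ⟨κ, θ, t1, t2, t3, ε, H, ε0, ε1, e1, e2, e3, hκ, κ1⟩ := params (π := 1/p.toReal) (by positivity) hpp (a1 := 1/q1) (a2 := 1/q2) (a3 := 1/q3)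
    (by positivity) (by positivity) (by positivity) (hl _ hq1) (hl _ hq2) (hl _ hq3) hα hα1 (hy _ hq1 hqa1) (hy _ hq2 hqa2) (hy _ hq3 hqa3) h7
  obtain ⟨A, hA, HA⟩ := step hp (by linarith) (by linarith) (by linarith) H ε0 ε1 e1 e2 e3 hα1 hκ
  obtain ⟨C, hC, HC⟩ := iter_lemma (w := ![κ, (3*κ-1)/2, (α-1)/2, 1/2])
    (by intro i; fin_cases i <;> simp <;> linarith) (by intro i; fin_cases i <;> simp <;> linarith) hA
  refine ⟨C, hC, fun u P sol => ?_⟩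
  have := HC (fun r => if 1/2 ≤ r then EE u sol.gu r else 0) (EE u sol.gu 1) (YY α (NN p q1 q2 q3 u) (PP P))
    (ENNReal.add_ne_top.2 ⟨sol.bdd_L2.ne, sol.grad_L2.ne⟩)
    (by
      intro r hr
      split_ifs with h
      · exact EE_mono _ _ (by linarith) hr
      · exact zero_le)
    (by
      intro r ρ hr hrρ hρ
      rw [if_pos hr, if_pos (by linarith)]
      exact HA u P sol r ρ hr hrρ hρ)
  simpa using this

end

section

lemma emb3 {R : ℝ} (hR : 0 < R) : MeasurableEmbedding (fun x : E3 => R • x) :=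
  (Homeomorph.smulOfNeZero R hR.ne').measurableEmbedding

lemma emb1 {R : ℝ} (hR : 0 < R) : MeasurableEmbedding (fun t : ℝ => R * t) :=
  (Homeomorph.mulLeft₀ R hR.ne').measurableEmbedding

lemma map3 {R : ℝ} (hR : 0 < R) (a : ℝ) : Measure.map (fun x : E3 => R • x) (volume.restrict (ball 0 a)) =
    (ENNReal.ofReal R ^ (-3:ℝ)) • volume.restrict (ball (0:E3) (R*a)) := by
  have h1 : ball (0:E3) a = (fun x : E3 => R • x) ⁻¹' (ball 0 (R*a)) := by
    ext x
    simp only [mem_ball_zero_iff, mem_preimage, norm_smul, Real.norm_eq_abs, abs_of_pos hR]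
    exact (mul_lt_mul_iff_right₀ hR).symm
  rw [h1, ← (emb3 hR).restrict_map, Measure.map_addHaar_smul _ hR.ne', Measure.restrict_smul]
  congr 1
  rw [ENNReal.ofReal_rpow_of_pos hR, abs_of_pos (by positivity), show (-3:ℝ) = -((3:ℕ):ℝ) by norm_num, Real.rpow_neg hR.le, Real.rpow_natCast]
  simp

lemma map1 {R : ℝ} (hR : 0 < R) (b c : ℝ) : Measure.map (fun x : ℝ => R * x) (volume.restrict (Ioo b c)) =
    (ENNReal.ofReal R ^ (-1:ℝ)) • volume.restrict (Ioo (R*b) (R*c)) := by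
  have h1 : Ioo b c = (fun x : ℝ => R * x) ⁻¹' (Ioo (R*b) (R*c)) := by
    ext x
    simp only [mem_Ioo, mem_preimage, mul_lt_mul_iff_right₀ hR]
  have h2 := Measure.map_addHaar_smul (volume : Measure ℝ) hR.ne'
  simp only [smul_eq_mul] at h2
  rw [h1, ← (emb1 hR).restrict_map]
  have h3 : Measure.map (fun x : ℝ => R * x) volume = (ENNReal.ofReal R ^ (-1:ℝ)) • volume := by
    refine Eq.trans h2 ?_
    congr 1
    rw [ENNReal.ofReal_rpow_of_pos hR, abs_of_pos (by positivity), Real.rpow_neg_one]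
    simp
  rw [h3, Measure.restrict_smul]

lemma map1' {R : ℝ} (hR : 0 < R) : Measure.map (fun x : ℝ => R * x) volume = (ENNReal.ofReal R ^ (-1:ℝ)) • volume := by
  have h2 := Measure.map_addHaar_smul (volume : Measure ℝ) hR.ne'
  refine Eq.trans h2 ?_
  congr 1
  rw [ENNReal.ofReal_rpow_of_pos hR, abs_of_pos (by positivity), Real.rpow_neg_one]
  simp

lemma lint_s3 {R : ℝ} (hR : 0 < R) (a : ℝ) (f : E3 → ℝ≥0∞) :
    ∫⁻ x in ball 0 a, f (R • x) = ENNReal.ofReal R ^ (-3:ℝ) * ∫⁻ x in ball (0:E3) (R*a), f x := by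
  rw [← (emb3 hR).lintegral_map, map3 hR, lintegral_smul_measure]; rfl

lemma lint_s1 {R : ℝ} (hR : 0 < R) (b c : ℝ) (f : ℝ → ℝ≥0∞) :
    ∫⁻ t in Ioo b c, f (R * t) = ENNReal.ofReal R ^ (-1:ℝ) * ∫⁻ x in Ioo (R*b) (R*c), f x := by
  rw [← (emb1 hR).lintegral_map, map1 hR, lintegral_smul_measure]; rfl

lemma lint_s1' {R : ℝ} (hR : 0 < R) (f : ℝ → ℝ≥0∞) :
    ∫⁻ t, f (R * t) = ENNReal.ofReal R ^ (-1:ℝ) * ∫⁻ x, f x := by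
  rw [← (emb1 hR).lintegral_map, map1' hR, lintegral_smul_measure]; rfl

lemma ofR_toReal {R : ℝ} (hR : 0 < R) (k : ℝ) : (ENNReal.ofReal R ^ k).toReal = R ^ k := by
  rw [ENNReal.ofReal_rpow_of_pos hR, ENNReal.toReal_ofReal (by positivity)]

lemma int_s3 {R : ℝ} (hR : 0 < R) (a : ℝ) (f : E3 → ℝ) :
    ∫ x in ball 0 a, f (R • x) = R ^ (-3:ℝ) * ∫ x in ball (0:E3) (R*a), f x := by
  rw [← (emb3 hR).integral_map, map3 hR, integral_smul_measure, ofR_toReal hR]; rfl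

lemma int_s1 {R : ℝ} (hR : 0 < R) (b c : ℝ) (f : ℝ → ℝ) :
    ∫ t in Ioo b c, f (R * t) = R ^ (-1:ℝ) * ∫ x in Ioo (R*b) (R*c), f x := by
  rw [← (emb1 hR).integral_map, map1 hR, integral_smul_measure, ofR_toReal hR]; rfl

lemma ae_s1 {R : ℝ} (hR : 0 < R) (b c : ℝ) {p : ℝ → Prop} (h : ∀ᵐ t ∂(volume.restrict (Ioo (R*b) (R*c))), p t) :
    ∀ᵐ t ∂(volume.restrict (Ioo b c)), p (R*t) := by
  rw [← (emb1 hR).ae_map_iff (p := p), map1 hR]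
  exact Measure.ae_smul_measure h _

lemma ess_s1 {R : ℝ} (hR : 0 < R) (b c : ℝ) (f : ℝ → ℝ≥0∞) :
    essSup (fun t => f (R*t)) (volume.restrict (Ioo b c)) = essSup f (volume.restrict (Ioo (R*b) (R*c))) := by
  have h1 := (emb1 hR).essSup_map_measure (g := f) (μ := volume.restrict (Ioo b c))
  have : essSup (fun t => f (R*t)) (volume.restrict (Ioo b c)) = essSup f (Measure.map (fun t => R*t) (volume.restrict (Ioo b c))) := h1.symm
  rw [this, map1 hR]
  unfold essSup
  congr 1
  rw [Measure.ae_ennreal_smul_measure_eq]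
  refine (ENNReal.rpow_pos ?_ ?_).ne' <;> simp [hR]

lemma two_s {R : ℝ} (hR : 0 < R) (τ : ℝ) (c : ℝ) {G F : E3 → ℝ → ℝ} (h : ∀ x t, G x t = c * F (R • x) (R^2*t)) :
    ∫ t in Ioo (-(1^2)) τ, ∫ x in ball (0:E3) 1, G x t = c * R^(-5:ℝ) * ∫ t in Ioo (-(R^2)) (R^2*τ), ∫ x in ball (0:E3) R, F x t := by
  simp only [h, integral_const_mul]
  have e1 : ∀ t, ∫ x in ball (0:E3) 1, F (R • x) (R^2*t) = R^(-3:ℝ) * ∫ x in ball (0:E3) R, F x (R^2*t) := fun t => by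
    have := int_s3 hR 1 (fun x => F x (R^2*t))
    rw [mul_one] at this; exact this
  simp only [e1, integral_const_mul]
  have e2 := int_s1 (R := R^2) (by positivity) (-(1^2)) τ (fun s => ∫ x in ball (0:E3) R, F x s)
  simp only [one_pow, mul_neg, mul_one] at e2 ⊢
  rw [e2, ← mul_assoc, ← mul_assoc, mul_assoc c]
  congr 2
  rw [show (R^2:ℝ) = R^(2:ℝ) by norm_cast, ← Real.rpow_mul hR.le, ← Real.rpow_add hR]
  norm_num

lemma two_sL {R : ℝ} (hR : 0 < R) {c : ℝ≥0∞} (hc : c ≠ ∞) {G F : E3 → ℝ → ℝ≥0∞} (a : ℝ) (h : ∀ x t, G x t = c * F (R • x) (R^2*t)) :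
    ∫⁻ t in Ioo (-(a^2)) 0, ∫⁻ x in ball (0:E3) a, G x t = c * ENNReal.ofReal R^(-5:ℝ) * ∫⁻ t in Ioo (-((R*a)^2)) 0, ∫⁻ x in ball (0:E3) (R*a), F x t := by
  have R0 : ENNReal.ofReal R ≠ 0 := by simpa using hR
  simp only [h, lintegral_const_mul' _ _ hc]
  have e1 : ∀ t, ∫⁻ x in ball (0:E3) a, F (R • x) (R^2*t) = ENNReal.ofReal R^(-3:ℝ) * ∫⁻ x in ball (0:E3) (R*a), F x (R^2*t) := fun t =>
    lint_s3 hR a (fun x => F x (R^2*t))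
  simp only [e1, lintegral_const_mul' _ _ (ENNReal.rpow_ne_top_of_ne_zero R0 ENNReal.ofReal_ne_top)]
  have e2 := lint_s1 (R := R^2) (by positivity) (-(a^2)) 0 (fun s => ∫⁻ x in ball (0:E3) (R*a), F x s)
  simp only [mul_neg, mul_zero] at e2
  rw [e2, ← mul_assoc, ← mul_assoc, mul_assoc c, mul_pow, show ENNReal.ofReal (R^2) = ENNReal.ofReal R ^ (2:ℝ) by rw [ENNReal.rpow_two, ENNReal.ofReal_pow hR.le],
    ← ENNReal.rpow_mul, ← ENNReal.rpow_add _ _ R0 ENNReal.ofReal_ne_top]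
  norm_num

lemma pd_s (R : ℝ) (j : Fin 3) (F : E3 → ℝ) (x : E3) : pd j (fun y => F (R • y)) x = R * pd j F (R • x) := by
  unfold pd
  rw [fderiv_comp_smul]; rfl

lemma pd_cm (R : ℝ) (j : Fin 3) (F : E3 → ℝ) (x : E3) : pd j (fun y => R * F y) x = R * pd j F x := by
  unfold pd
  have h : fderiv ℝ (fun y => R * F y) x = R • fderiv ℝ F x := congrFun (fderiv_const_smul_field (𝕜 := ℝ) (f := F) R) x
  rw [h]; rfl

lemma lap_s (R : ℝ) (F : E3 → ℝ) (x : E3) : lap (fun y => F (R • y)) x = R^2 * lap F (R • x) := by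
  unfold lap
  rw [Finset.mul_sum]
  refine Finset.sum_congr rfl fun i _ => ?_
  simp only [pd_s, pd_cm]
  ring

lemma deriv_s (R : ℝ) (F : ℝ → ℝ) (t : ℝ) : deriv (fun s => F (R^2*s)) t = R^2 * deriv F (R^2*t) :=
  deriv_comp_mul_left (R^2) F t

end

section

def sH {R : ℝ} (hR : 0 < R) : (E3 × ℝ) ≃ₜ (E3 × ℝ) :=
  (Homeomorph.smulOfNeZero R⁻¹ (inv_ne_zero hR.ne')).prodCongr (Homeomorph.mulLeft₀ ((R^2)⁻¹) (by positivity))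

lemma test_s {F : Type*} [NormedAddCommGroup F] [NormedSpace ℝ F] {R : ℝ} (hR : 0 < R) {φ : E3 → ℝ → F}
    (h : ContDiff ℝ (⊤ : ℕ∞) (fun z : E3 × ℝ => φ z.1 z.2) ∧ HasCompactSupport (fun z : E3 × ℝ => φ z.1 z.2) ∧
      tsupport (fun z : E3 × ℝ => φ z.1 z.2) ⊆ (ball (0 : E3) 1) ×ˢ (Ioo (-(1^2)) 0)) :
    ContDiff ℝ (⊤ : ℕ∞) (fun z : E3 × ℝ => φ (R⁻¹ • z.1) ((R^2)⁻¹ * z.2)) ∧ HasCompactSupport (fun z : E3 × ℝ => φ (R⁻¹ • z.1) ((R^2)⁻¹ * z.2)) ∧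
      tsupport (fun z : E3 × ℝ => φ (R⁻¹ • z.1) ((R^2)⁻¹ * z.2)) ⊆ (ball (0 : E3) R) ×ˢ (Ioo (-(R^2)) 0) := by
  obtain ⟨h1, h2, h3⟩ := h
  have e : (fun z : E3 × ℝ => φ (R⁻¹ • z.1) ((R^2)⁻¹ * z.2)) = (fun z : E3 × ℝ => φ z.1 z.2) ∘ (sH hR) := rfl
  refine ⟨?_, ?_, ?_⟩
  · exact h1.comp (f := fun z : E3 × ℝ => (R⁻¹ • z.1, (R^2)⁻¹ * z.2)) (by fun_prop)
  · rw [e]; exact h2.comp_homeomorph _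
  · rw [e, tsupport_comp_eq_preimage]
    intro z hz
    have := h3 hz
    change (R⁻¹ • z.1) ∈ ball (0:E3) 1 ∧ (R^2)⁻¹ * z.2 ∈ Ioo (-(1^2):ℝ) 0 at this
    obtain ⟨m1, m2, m3⟩ := this
    have R2 : 0 < R^2 := by positivity
    have R2' : 0 < (R^2)⁻¹ := by positivity
    refine ⟨?_, ?_, ?_⟩
    · rw [mem_ball_zero_iff, norm_smul, Real.norm_eq_abs, abs_of_pos (by positivity), inv_mul_lt_iff₀ hR, mul_one] at m1
      rwa [mem_ball_zero_iff]
    · rw [lt_inv_mul_iff₀ R2] at m2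
      linarith
    · by_contra hc
      push Not at hc
      have : 0 ≤ (R^2)⁻¹ * z.2 := by positivity
      linarith

lemma back_x {R : ℝ} (hR : 0 < R) (x : E3) : R⁻¹ • R • x = x := by rw [smul_smul, inv_mul_cancel₀ hR.ne', one_smul]
lemma back_t {R : ℝ} (hR : 0 < R) (t : ℝ) : (R^2)⁻¹ * (R^2 * t) = t := by field_simp

def uS (R : ℝ) (u : E3 → ℝ → E3) : E3 → ℝ → E3 := fun x t => R • u (R • x) (R^2*t)
def pS (R : ℝ) (P : E3 → ℝ → ℝ) : E3 → ℝ → ℝ := fun x t => R^2 * P (R • x) (R^2*t)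
def gS (R : ℝ) (g : E3 → ℝ → Fin 3 → Fin 3 → ℝ) : E3 → ℝ → Fin 3 → Fin 3 → ℝ := fun x t i j => R^2 * g (R • x) (R^2*t) i j

/-- A version of `two_s` including the correct end point at zero. -/
lemma two_s0 {R : ℝ} (hR : 0 < R) (c : ℝ) {G F : E3 → ℝ → ℝ} (h : ∀ x t, G x t = c * F (R • x) (R^2*t)) :
    ∫ t in Ioo (-(1^2)) 0, ∫ x in ball (0:E3) 1, G x t = c * R^(-5:ℝ) * ∫ t in Ioo (-(R^2)) 0, ∫ x in ball (0:E3) R, F x t := by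
  have := two_s hR 0 c h
  rwa [mul_zero] at this

lemma linf_s {R : ℝ} (hR : 0 < R) (u : E3 → ℝ → E3) (a : ℝ) : linfL2sq a (uS R u) = ENNReal.ofReal R ^ (-1:ℝ) * linfL2sq (R*a) u := by
  have R0 : ENNReal.ofReal R ≠ 0 := by simpa using hR
  unfold linfL2sq
  have e : ∀ t, ∫⁻ x in ball (0:E3) a, ((‖uS R u x t‖₊ : ℝ≥0∞)) ^ 2 = ENNReal.ofReal R ^ (-1:ℝ) * ∫⁻ x in ball (0:E3) (R*a), ((‖u x (R^2*t)‖₊ : ℝ≥0∞)) ^ 2 := fun t => by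
    have e1 : ∀ x, ((‖uS R u x t‖₊ : ℝ≥0∞)) ^ 2 = ENNReal.ofReal R ^ (2:ℝ) * ((‖u (R • x) (R^2*t)‖₊ : ℝ≥0∞)) ^ 2 := fun x => by
      unfold uS
      have : (‖R‖₊ : ℝ≥0∞) = ENNReal.ofReal R := by
        have := Real.enorm_eq_ofReal hR.le
        exact this
      rw [nnnorm_smul, ENNReal.coe_mul, mul_pow, this, ENNReal.rpow_two]
    simp only [e1]
    rw [lintegral_const_mul' _ _ (ENNReal.rpow_ne_top_of_ne_zero R0 ENNReal.ofReal_ne_top), lint_s3 hR a (fun x => ((‖u x (R^2*t)‖₊ : ℝ≥0∞)) ^ 2),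
      ← mul_assoc, ← ENNReal.rpow_add _ _ R0 ENNReal.ofReal_ne_top]
    norm_num
  simp only [e]
  rw [ENNReal.essSup_const_mul]
  congr 1
  have := ess_s1 (R := R^2) (by positivity) (-(a^2)) 0 (fun s => ∫⁻ x in ball (0:E3) (R*a), ((‖u x s‖₊ : ℝ≥0∞)) ^ 2)
  rw [this]
  congr 3
  · ring
  · ring

lemma grad_s {R : ℝ} (hR : 0 < R) (g : E3 → ℝ → Fin 3 → Fin 3 → ℝ) (a : ℝ) : gradL2sq a (gS R g) = ENNReal.ofReal R ^ (-1:ℝ) * gradL2sq (R*a) g := by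
  have R0 : ENNReal.ofReal R ≠ 0 := by simpa using hR
  unfold gradL2sq
  rw [two_sL hR (c := ENNReal.ofReal R ^ (4:ℝ)) (ENNReal.rpow_ne_top_of_ne_zero R0 ENNReal.ofReal_ne_top) (F := fun x t => ENNReal.ofReal (∑ i : Fin 3, ∑ j : Fin 3, (g x t i j) ^ 2)) a,
    ← ENNReal.rpow_add _ _ R0 ENNReal.ofReal_ne_top]
  · norm_num
  · intro x t
    rw [ENNReal.ofReal_rpow_of_pos hR, ← ENNReal.ofReal_mul (by positivity)]
    congr 1
    rw [show (4:ℝ) = ((4:ℕ):ℝ) by norm_num, Real.rpow_natCast, Finset.mul_sum]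
    refine Finset.sum_congr rfl fun i _ => ?_
    rw [Finset.mul_sum]
    refine Finset.sum_congr rfl fun j _ => ?_
    unfold gS; ring

lemma press_s {R : ℝ} (hR : 0 < R) (P : E3 → ℝ → ℝ) {k : ℝ} (hk : 0 ≤ k) :
    ∫⁻ t in Ioo (-(1^2)) 0, ∫⁻ x in ball (0 : E3) 1, (ENNReal.ofReal |pS R P x t|) ^ k =
      ENNReal.ofReal R ^ (2*k-5) * ∫⁻ t in Ioo (-(R^2)) 0, ∫⁻ x in ball (0 : E3) R, (ENNReal.ofReal |P x t|) ^ k := by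
  have R0 : ENNReal.ofReal R ≠ 0 := by simpa using hR
  rw [two_sL hR (c := ENNReal.ofReal R ^ (2*k)) (ENNReal.rpow_ne_top_of_ne_zero R0 ENNReal.ofReal_ne_top) (F := fun x t => (ENNReal.ofReal |P x t|) ^ k) 1,
    ← ENNReal.rpow_add _ _ R0 ENNReal.ofReal_ne_top, mul_one]
  · congr 1
  · intro x t
    unfold pS
    rw [abs_mul, abs_of_pos (by positivity : 0 < R^2), ENNReal.ofReal_mul (by positivity), ENNReal.mul_rpow_of_nonneg _ _ hk, ENNReal.ofReal_pow hR.le, ENNReal.rpow_mul, ENNReal.rpow_two]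

end

section

section scaled
variable {R : ℝ} {u : E3 → ℝ → E3} {P : E3 → ℝ → ℝ}

lemma sm_meas (R : ℝ) : Measurable (fun z : E3 × ℝ => (R • z.1, R^2 * z.2)) := by fun_prop

def scaled (hR : 0 < R) (sol : SuitableWeakSolution R u P) : SuitableWeakSolution 1 (uS R u) (pS R P) where
  gu := gS R sol.gu
  meas_u := by
    have h := (sol.meas_u.comp (sm_meas R)).const_smul R
    exact h
  meas_gu := by
    have h := (sol.meas_gu.comp (sm_meas R)).const_smul (R^2)
    exact h
  meas_press := by
    have h := (sol.meas_press.comp (sm_meas R)).const_mul (R^2)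
    exact h
  bdd_L2 := by
    have h := linf_s hR u 1
    unfold linfL2sq at h
    rw [h, mul_one]
    exact ENNReal.mul_lt_top (ENNReal.rpow_ne_top_of_ne_zero (by simpa using hR) ENNReal.ofReal_ne_top).lt_top sol.bdd_L2
  grad_L2 := by
    have h := grad_s hR sol.gu 1
    unfold gradL2sq at h
    rw [h, mul_one]
    exact ENNReal.mul_lt_top (ENNReal.rpow_ne_top_of_ne_zero (by simpa using hR) ENNReal.ofReal_ne_top).lt_top sol.grad_L2
  press_L32 := by
    rw [press_s hR P (by norm_num)]
    exact ENNReal.mul_lt_top (ENNReal.rpow_ne_top_of_ne_zero (by simpa using hR) ENNReal.ofReal_ne_top).lt_top sol.press_L32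
  is_grad := by
    intro φ hφ i j
    have hψ := sol.is_grad (fun y s => φ (R⁻¹ • y) ((R^2)⁻¹ * s)) (test_s hR hφ) i j
    rw [two_s0 hR (R^2) (F := fun x t => u x t i * pd j (fun y => φ (R⁻¹ • y) ((R^2)⁻¹ * t)) x),
      two_s0 hR (R^2) (F := fun x t => sol.gu x t i j * φ (R⁻¹ • x) ((R^2)⁻¹ * t)), hψ]
    · ring
    · intro x t
      rw [back_x hR, back_t hR]; unfold gS; ring
    · intro x t
      have e := pd_s R j (fun y => φ (R⁻¹ • y) t) x
      simp only [back_x hR] at e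
      rw [back_t hR, e]
      change R * u (R • x) (R^2*t) i * _ = _
      ring
  weak_NS := by
    intro w hw
    have hψ := sol.weak_NS (fun y s => w (R⁻¹ • y) ((R^2)⁻¹ * s)) (test_s hR hw)
    rw [two_s0 hR (R^3) (F := fun x t => (-(∑ i : Fin 3, u x t i * deriv (fun s => w (R⁻¹ • x) ((R^2)⁻¹ * s) i) t)
          - (∑ i : Fin 3, u x t i * lap (fun y => w (R⁻¹ • y) ((R^2)⁻¹ * t) i) x)
          - (∑ i : Fin 3, ∑ j : Fin 3, u x t i * u x t j * pd i (fun y => w (R⁻¹ • y) ((R^2)⁻¹ * t) j) x)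
          - P x t * (∑ j : Fin 3, pd j (fun y => w (R⁻¹ • y) ((R^2)⁻¹ * t) j) x))), hψ, mul_zero]
    intro x t
    have e1 : ∀ i j, pd i (fun y => w y t j) x = R * pd i (fun y => w (R⁻¹ • y) t j) (R • x) := fun i j => by
      have e := pd_s R i (fun y => w (R⁻¹ • y) t j) x
      simpa only [back_x hR] using e
    have e2 : ∀ j, lap (fun y => w y t j) x = R^2 * lap (fun y => w (R⁻¹ • y) t j) (R • x) := fun j => by
      have e := lap_s R (fun y => w (R⁻¹ • y) t j) x
      simpa only [back_x hR] using e
    have e3 : ∀ j, deriv (fun s => w x s j) t = R^2 * deriv (fun s => w x ((R^2)⁻¹ * s) j) (R^2*t) := fun j => by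
      have e := deriv_s R (fun s => w x ((R^2)⁻¹ * s) j) t
      simpa only [back_t hR] using e
    simp only [e1, e2, e3, back_x hR, back_t hR, Fin.sum_univ_three]
    have eu : ∀ i, uS R u x t i = R * u (R • x) (R^2*t) i := fun i => rfl
    simp only [eu, pS]
    ring
  weak_div := by
    intro φ hφ
    have hψ := sol.weak_div (fun y s => φ (R⁻¹ • y) ((R^2)⁻¹ * s)) (test_s hR hφ)
    rw [two_s0 hR (R^2) (F := fun x t => ∑ i : Fin 3, u x t i * pd i (fun y => φ (R⁻¹ • y) ((R^2)⁻¹ * t)) x), hψ, mul_zero]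
    intro x t
    have e1 : ∀ i, pd i (fun y => φ y t) x = R * pd i (fun y => φ (R⁻¹ • y) t) (R • x) := fun i => by
      have e := pd_s R i (fun y => φ (R⁻¹ • y) t) x
      simpa only [back_x hR] using e
    have eu : ∀ i, uS R u x t i = R * u (R • x) (R^2*t) i := fun i => rfl
    simp only [e1, eu, back_t hR, Fin.sum_univ_three]
    ring
  local_energy := by
    intro φ hφ h0
    have hψ := sol.local_energy (fun y s => φ (R⁻¹ • y) ((R^2)⁻¹ * s)) (test_s hR hφ) (fun x t => h0 _ _)
    have hR2 : 0 < R^2 := by positivity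
    have hae := ae_s1 (R := R^2) hR2 (-(1^2)) 0 (p := fun t => (∫ x in ball (0 : E3) R, ‖u x t‖ ^ 2 * φ (R⁻¹ • x) ((R^2)⁻¹ * t))
          + 2 * ∫ s in Ioo (-(R^2)) t, ∫ x in ball (0 : E3) R,
              (∑ i : Fin 3, ∑ j : Fin 3, (sol.gu x s i j) ^ 2) * φ (R⁻¹ • x) ((R^2)⁻¹ * s)
        ≤ (∫ s in Ioo (-(R^2)) t, ∫ x in ball (0 : E3) R,
              ‖u x s‖ ^ 2 * (deriv (fun τ => φ (R⁻¹ • x) ((R^2)⁻¹ * τ)) s + lap (fun y => φ (R⁻¹ • y) ((R^2)⁻¹ * s)) x))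
          + ∫ s in Ioo (-(R^2)) t, ∫ x in ball (0 : E3) R,
              (∑ i : Fin 3, u x s i * pd i (fun y => φ (R⁻¹ • y) ((R^2)⁻¹ * s)) x) * (‖u x s‖ ^ 2 + 2 * P x s))
      (by
        rw [show R^2 * (-(1^2)) = -(R^2) by ring, mul_zero]
        exact hψ)
    filter_upwards [hae] with t ht
    have un : ∀ x s, ‖uS R u x s‖^2 = R^2 * ‖u (R • x) (R^2*s)‖^2 := fun x s => by
      unfold uS; rw [norm_smul, Real.norm_eq_abs, mul_pow, sq_abs]
    have e1 : ∀ t x i, pd i (fun y => φ y t) x = R * pd i (fun y => φ (R⁻¹ • y) t) (R • x) := fun t x i => by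
      have e := pd_s R i (fun y => φ (R⁻¹ • y) t) x
      simpa only [back_x hR] using e
    have e2 : ∀ t x, lap (fun y => φ y t) x = R^2 * lap (fun y => φ (R⁻¹ • y) t) (R • x) := fun t x => by
      have e := lap_s R (fun y => φ (R⁻¹ • y) t) x
      simpa only [back_x hR] using e
    have e3 : ∀ t x, deriv (fun s => φ x s) t = R^2 * deriv (fun s => φ x ((R^2)⁻¹ * s)) (R^2*t) := fun t x => by
      have e := deriv_s R (fun s => φ x ((R^2)⁻¹ * s)) t
      simpa only [back_t hR] using e
    have eu : ∀ x t i, uS R u x t i = R * u (R • x) (R^2*t) i := fun x t i => rfl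
    have I1 : ∫ x in ball (0 : E3) 1, ‖uS R u x t‖ ^ 2 * φ x t = R^4 * R^(-5:ℝ) * ∫ x in ball (0 : E3) R, ‖u x (R^2*t)‖ ^ 2 * φ (R⁻¹ • x) ((R^2)⁻¹ * (R^2*t)) := by
      have e := int_s3 hR 1 (fun x => ‖u x (R^2*t)‖ ^ 2 * φ (R⁻¹ • x) ((R^2)⁻¹ * (R^2*t)))
      rw [mul_one] at e
      have e' : ∀ x, ‖uS R u x t‖ ^ 2 * φ x t = R^2 * (‖u (R • x) (R^2*t)‖ ^ 2 * φ (R⁻¹ • R • x) ((R^2)⁻¹ * (R^2*t))) := fun x => by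
        rw [un, back_x hR, back_t hR]; ring
      simp only [e']
      rw [integral_const_mul, e, ← mul_assoc]
      congr 1
      rw [show (-5:ℝ) = -3 - 2 by norm_num, Real.rpow_sub hR]
      norm_num
      field_simp
    have I2 := two_s hR t (R^4) (G := fun x s => (∑ i : Fin 3, ∑ j : Fin 3, (gS R sol.gu x s i j) ^ 2) * φ x s)
      (F := fun x s => (∑ i : Fin 3, ∑ j : Fin 3, (sol.gu x s i j) ^ 2) * φ (R⁻¹ • x) ((R^2)⁻¹ * s)) (fun x s => by
        simp only [back_x hR, back_t hR, gS, Fin.sum_univ_three]; ring)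
    have I3 := two_s hR t (R^4) (G := fun x s => ‖uS R u x s‖ ^ 2 * (deriv (fun τ => φ x τ) s + lap (fun y => φ y s) x))
      (F := fun x s => ‖u x s‖ ^ 2 * (deriv (fun τ => φ (R⁻¹ • x) ((R^2)⁻¹ * τ)) s + lap (fun y => φ (R⁻¹ • y) ((R^2)⁻¹ * s)) x)) (fun x s => by
        simp only [e2, e3, un, back_x hR, back_t hR]; ring)
    have I4 := two_s hR t (R^4) (G := fun x s => (∑ i : Fin 3, uS R u x s i * pd i (fun y => φ y s) x) * (‖uS R u x s‖ ^ 2 + 2 * pS R P x s))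
      (F := fun x s => (∑ i : Fin 3, u x s i * pd i (fun y => φ (R⁻¹ • y) ((R^2)⁻¹ * s)) x) * (‖u x s‖ ^ 2 + 2 * P x s)) (fun x s => by
        simp only [e1, un, eu, pS, back_t hR, Fin.sum_univ_three]; ring)
    rw [I1, I2, I3, I4]
    have hc : 0 ≤ R^4 * R^(-5:ℝ) := by positivity
    have := mul_le_mul_of_nonneg_left ht hc
    linarith

lemma scaled_gu (hR : 0 < R) (sol : SuitableWeakSolution R u P) : (scaled hR sol).gu = gS R sol.gu := rfl

end scaled

end


lemma pt3_smul (R a b c : ℝ) : R • pt3 a b c = pt3 (R*a) (R*b) (R*c) := by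
  ext i
  fin_cases i <;> simp [pt3]

lemma aniso_s {R : ℝ} (hR : 0 < R) {q1 q2 q3 : ℝ} (h1 : 0 < q1) (h2 : 0 < q2) (h3 : 0 < q3) (f : E3 → ℝ) :
    anisoNorm q1 q2 q3 (ball 0 1) (fun x => R * f (R • x)) = ENNReal.ofReal R ^ (1 - (1/q1+1/q2+1/q3)) * anisoNorm q1 q2 q3 (ball 0 R) f := by
  have R0 : ENNReal.ofReal R ≠ 0 := by simpa using hR
  have Rt : ENNReal.ofReal R ≠ ∞ := ENNReal.ofReal_ne_top
  have rf : ∀ k : ℝ, ENNReal.ofReal R ^ k ≠ ∞ := fun k => ENNReal.rpow_ne_top_of_ne_zero R0 Rt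
  unfold anisoNorm
  set g : E3 → ℝ≥0∞ := fun x => ENNReal.ofReal |(ball (0:E3) R).indicator f x| with hg
  have e0 : ∀ a b c, (ENNReal.ofReal |(ball (0:E3) 1).indicator (fun x => R * f (R • x)) (pt3 a b c)|) ^ q1 =
      ENNReal.ofReal R ^ q1 * g (pt3 (R*a) (R*b) (R*c)) ^ q1 := fun a b c => by
    rw [← ENNReal.mul_rpow_of_nonneg _ _ h1.le, hg]
    congr 1
    dsimp only
    rw [← pt3_smul, ← ENNReal.ofReal_mul hR.le]
    congr 1
    by_cases hx : pt3 a b c ∈ ball (0:E3) 1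
    · have hx' : R • pt3 a b c ∈ ball (0:E3) R := by
        rw [mem_ball_zero_iff] at hx ⊢
        rw [norm_smul, Real.norm_eq_abs, abs_of_pos hR]; nlinarith
      rw [indicator_of_mem hx, indicator_of_mem hx', abs_mul, abs_of_pos hR]
    · have hx' : R • pt3 a b c ∉ ball (0:E3) R := by
        rw [mem_ball_zero_iff] at hx ⊢
        rw [norm_smul, Real.norm_eq_abs, abs_of_pos hR]; nlinarith
      rw [indicator_of_notMem hx, indicator_of_notMem hx']; simp
  have e1 : ∀ b c, (∫⁻ a, (ENNReal.ofReal |(ball (0:E3) 1).indicator (fun x => R * f (R • x)) (pt3 a b c)|) ^ q1) ^ (q2/q1) =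
      ENNReal.ofReal R ^ (q2 - q2/q1) * (∫⁻ a, g (pt3 a (R*b) (R*c)) ^ q1) ^ (q2/q1) := fun b c => by
    simp only [e0]
    rw [lintegral_const_mul' _ _ (rf _), lint_s1' hR (fun a => g (pt3 a (R*b) (R*c)) ^ q1), ← mul_assoc, ← ENNReal.rpow_add _ _ R0 Rt,
      ENNReal.mul_rpow_of_nonneg _ _ (by positivity), ← ENNReal.rpow_mul]
    congr 2
    field_simp
    ring
  have e2 : ∀ c, (∫⁻ b, (∫⁻ a, (ENNReal.ofReal |(ball (0:E3) 1).indicator (fun x => R * f (R • x)) (pt3 a b c)|) ^ q1) ^ (q2/q1)) ^ (q3/q2) =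
      ENNReal.ofReal R ^ (q3 - q3/q1 - q3/q2) * (∫⁻ b, (∫⁻ a, g (pt3 a b (R*c)) ^ q1) ^ (q2/q1)) ^ (q3/q2) := fun c => by
    simp only [e1]
    rw [lintegral_const_mul' _ _ (rf _), lint_s1' hR (fun b => (∫⁻ a, g (pt3 a b (R*c)) ^ q1) ^ (q2/q1)), ← mul_assoc, ← ENNReal.rpow_add _ _ R0 Rt,
      ENNReal.mul_rpow_of_nonneg _ _ (by positivity), ← ENNReal.rpow_mul]
    congr 2
    field_simp
    ring
  simp only [e2]
  rw [lintegral_const_mul' _ _ (rf _), lint_s1' hR (fun c => (∫⁻ b, (∫⁻ a, g (pt3 a b c) ^ q1) ^ (q2/q1)) ^ (q3/q2)), ← mul_assoc, ← ENNReal.rpow_add _ _ R0 Rt,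
      ENNReal.mul_rpow_of_nonneg _ _ (by positivity), ← ENNReal.rpow_mul]
  congr 2
  field_simp
  ring

lemma mixed_s {R : ℝ} (hR : 0 < R) {p : ℝ≥0∞} (hp : 1 ≤ p) {q1 q2 q3 : ℝ} (h1 : 0 < q1) (h2 : 0 < q2) (h3 : 0 < q3) (u : E3 → ℝ → E3) :
    NN p q1 q2 q3 (uS R u) = ENNReal.ofReal R ^ (1 - (1/q1+1/q2+1/q3) - 2*(1/p.toReal)) * mixedNorm p q1 q2 q3 R (fun x t => ‖u x t‖) := by
  have R0 : ENNReal.ofReal R ≠ 0 := by simpa using hR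
  have Rt : ENNReal.ofReal R ≠ ∞ := ENNReal.ofReal_ne_top
  have rf : ∀ k : ℝ, ENNReal.ofReal R ^ k ≠ ∞ := fun k => ENNReal.rpow_ne_top_of_ne_zero R0 Rt
  have e : ∀ t, anisoNorm q1 q2 q3 B1 (fun x => ‖uS R u x t‖) = ENNReal.ofReal R ^ (1 - (1/q1+1/q2+1/q3)) * anisoNorm q1 q2 q3 (ball 0 R) (fun x => ‖u x (R^2*t)‖) := fun t => by
    rw [← aniso_s hR h1 h2 h3]
    congr 1
    ext x
    unfold uS
    rw [norm_smul, Real.norm_eq_abs, abs_of_pos hR]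
  unfold NN tN mixedNorm
  simp only [e]
  set F : ℝ → ℝ≥0∞ := fun t => anisoNorm q1 q2 q3 (ball 0 R) (fun x => ‖u x t‖) with hF
  have hR2 : 0 < R^2 := by positivity
  split_ifs with h
  · rw [ENNReal.essSup_const_mul]
    have := ess_s1 hR2 (-(1^2)) 0 F
    rw [show R^2 * (-(1^2)) = -(R^2) by ring, mul_zero] at this
    rw [show essSup (fun t => F (R^2*t)) (volume.restrict T1) = _ from this, h]
    simp
  · have hp0 : 0 < p.toReal := ENNReal.toReal_pos (by intro h0; simp [h0] at hp) h
    simp only [ENNReal.mul_rpow_of_nonneg _ _ hp0.le]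
    have := lint_s1 hR2 (-(1^2)) 0 (fun t => F t ^ p.toReal)
    rw [show R^2 * (-(1^2)) = -(R^2) by ring, mul_zero] at this
    rw [lintegral_const_mul' _ _ (by rw [← ENNReal.rpow_mul]; exact rf _)]
    rw [show ∫⁻ t in T1, F (R^2*t) ^ p.toReal = _ from this, ENNReal.ofReal_pow hR.le, ← ENNReal.rpow_two, ← ENNReal.rpow_mul, ← ENNReal.rpow_mul, ← mul_assoc, ← ENNReal.rpow_add _ _ R0 Rt,
      ENNReal.mul_rpow_of_nonneg _ _ (by positivity), ← ENNReal.rpow_mul]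
    congr 2
    field_simp
    ring

/-- The Caccioppoli type inequality (4.5): with `α = 2/(2/p + 1/q̄) > 1`,
`q_j ≤ 2α/(α−1)` and `7 − 3α − 4α/p ≥ 0`, for every suitable weak solution on `Q(R)`:
`‖u‖²_{L^∞L²(Q(R/2))} + ‖∇u‖²_{L²(Q(R/2))}
  ≤ C R^{-(4−3α)/α} ‖u‖²_{LᵖLq⃗(Q(R))} + C R^{-(5−3α)/(α−1)} ‖u‖^{2α/(α−1)}_{LᵖLq⃗(Q(R))}
    + C R^{-5} ‖Π‖²_{L¹(Q(R))}`. -/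
theorem caccioppoli_one_scale
    (p : ℝ≥0∞) (q1 q2 q3 α : ℝ) (hp : 1 ≤ p)
    (hq1 : 1 < q1) (hq2 : 1 < q2) (hq3 : 1 < q3)
    (hα : α = 2 / (2 / p.toReal + (1/q1 + 1/q2 + 1/q3)))
    (hα1 : 1 < α)
    (hqa1 : q1 ≤ 2*α/(α-1)) (hqa2 : q2 ≤ 2*α/(α-1)) (hqa3 : q3 ≤ 2*α/(α-1))
    (h7 : 0 ≤ 7 - 3*α - 4*α/p.toReal) :
    ∃ C : ℝ, 0 < C ∧
      ∀ (R : ℝ) (u : E3 → ℝ → E3) (P : E3 → ℝ → ℝ), 0 < R →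
        ∀ (sol : SuitableWeakSolution R u P),
        linfL2sq (R/2) u + gradL2sq (R/2) sol.gu
          ≤ ENNReal.ofReal C * (ENNReal.ofReal R) ^ (-((4 - 3*α)/α))
              * (mixedNorm p q1 q2 q3 R (fun x t => ‖u x t‖)) ^ 2
            + ENNReal.ofReal C * (ENNReal.ofReal R) ^ (-((5 - 3*α)/(α-1)))
              * (mixedNorm p q1 q2 q3 R (fun x t => ‖u x t‖)) ^ (2*α/(α-1))
            + ENNReal.ofReal C * (ENNReal.ofReal R) ^ (-(5:ℝ))
              * (∫⁻ t in Ioo (-(R^2)) 0, ∫⁻ x in ball (0 : E3) R,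
                  ENNReal.ofReal |P x t|) ^ 2 := by
  have hq1p : 0 < q1 := by linarith
  have hq2p : 0 < q2 := by linarith
  have hq3p : 0 < q3 := by linarith
  have sp : 0 < 2 / p.toReal + (1/q1 + 1/q2 + 1/q3) := by positivity
  have hα' : α * (2*(1/p.toReal) + (1/q1 + 1/q2 + 1/q3)) = 2 := by
    rw [hα, mul_one_div]; exact div_mul_cancel₀ _ sp.ne'
  have a1 : 0 < α - 1 := by linarith
  have a0 : 0 < α := by linarith
  obtain ⟨C, hC, HC⟩ := unit_case hp hq1 hq2 hq3 hα' hα1 hqa1 hqa2 hqa3 (by rw [mul_one_div]; exact h7)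
  refine ⟨C.toReal + 1, by positivity, ?_⟩
  intro R u P hR sol
  have hCle : C ≤ ENNReal.ofReal (C.toReal + 1) := by
    rw [ENNReal.le_ofReal_iff_toReal_le hC (by positivity)]; linarith
  have R0 : ENNReal.ofReal R ≠ 0 := by simpa using hR
  have Rt : ENNReal.ofReal R ≠ ∞ := ENNReal.ofReal_ne_top
  have h := HC _ _ (scaled hR sol)
  rw [scaled_gu] at h
  unfold EE at h
  rw [linf_s hR, grad_s hR, mixed_s hR hp hq1p hq2p hq3p, ← mul_add, show R*(1/2) = R/2 by ring] at h
  have hP : PP (pS R P) = ENNReal.ofReal R ^ (-3:ℝ) * ∫⁻ t in Ioo (-(R^2)) 0, ∫⁻ x in ball (0 : E3) R, ENNReal.ofReal |P x t| := by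
    have := press_s hR P (k := 1) (by norm_num)
    simp only [ENNReal.rpow_one] at this
    rw [show (2*1-5:ℝ) = -3 by norm_num] at this
    rw [← this]
    unfold PP
    simp only [Real.enorm_eq_ofReal_abs]
  rw [hP] at h
  have hexp : 1 - (1/q1+1/q2+1/q3) - 2*(1/p.toReal) = 1 - 2/α := by
    have : 2/α = 2*(1/p.toReal) + (1/q1 + 1/q2 + 1/q3) := by
      rw [div_eq_iff a0.ne']; linarith
    rw [this]; ring
  rw [hexp] at h
  set N := mixedNorm p q1 q2 q3 R (fun x t => ‖u x t‖)
  set Q := ∫⁻ t in Ioo (-(R^2)) 0, ∫⁻ x in ball (0 : E3) R, ENNReal.ofReal |P x t|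
  set L := linfL2sq (R/2) u + gradL2sq (R/2) sol.gu
  set ρ := ENNReal.ofReal R
  have hL : L = ρ ^ (1:ℝ) * (ρ ^ (-1:ℝ) * L) := by
    rw [← mul_assoc, ← ENNReal.rpow_add _ _ R0 Rt]; norm_num
  rw [hL]
  calc ρ ^ (1:ℝ) * (ρ ^ (-1:ℝ) * L) ≤ ρ ^ (1:ℝ) * (C * YY α (ρ ^ (1-2/α) * N) (ρ ^ (-3:ℝ) * Q)) := by gcongr
    _ = C * ρ ^ (-((4 - 3*α)/α)) * N ^ 2 + C * ρ ^ (-((5 - 3*α)/(α-1))) * N ^ (2*α/(α-1)) + C * ρ ^ (-(5:ℝ)) * Q ^ 2 := by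
        unfold YY
        have x1 : -((4 - 3*α)/α) = 1 + (1-2/α)*2 := by field_simp; ring
        have x2 : -((5 - 3*α)/(α-1)) = 1 + (1-2/α)*(2*α/(α-1)) := by field_simp; ring
        have x3 : -(5:ℝ) = 1 + (-3)*2 := by norm_num
        rw [ENNReal.mul_rpow_of_nonneg _ _ (by norm_num), ENNReal.mul_rpow_of_nonneg _ _ (by positivity), ENNReal.mul_rpow_of_nonneg _ _ (by norm_num),
          ← ENNReal.rpow_mul, ← ENNReal.rpow_mul, ← ENNReal.rpow_mul, x1, x2, x3, ENNReal.rpow_add _ _ R0 Rt, ENNReal.rpow_add _ _ R0 Rt, ENNReal.rpow_add _ _ R0 Rt,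
          ENNReal.rpow_two N, ENNReal.rpow_two Q]
        ring
    _ ≤ _ := by gcongr
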